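/- arXiv:2406.04154 — 3 statements merged into one kernel-verified Lean document; each statement's English description precedes it below -/
import Mathlib

section
/- There is an absolute constant c > 0 such that the following holds: for every m ≥ 3 there is ε = ε(m) > 0 such that every sufficiently large n-vertex 3-graph G with no homogeneous set of size at least n^ε satisfies s(G;m) ≥ c·m³. -/
/-- `S` is a clique in the `3`-graph with edge set `E`: every `3`-subset of `S` is an edge. -/
def IsClique3 {n : ℕ} (E : Finset (Finset (Fin n))) (S : Finset (Fin n)) : Prop :=
  ∀ e : Finset (Fin n), e ⊆ S → e.card = 3 → e ∈ E

/-- `S` is an independent set in the `3`-graph with edge set `E`. -/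
def IsIndep3 {n : ℕ} (E : Finset (Finset (Fin n))) (S : Finset (Fin n)) : Prop :=
  ∀ e : Finset (Fin n), e ⊆ S → e.card = 3 → e ∉ E

/-- `s(G;m)`: the number of integers `0 ≤ f ≤ binom(m,3)` such that the `3`-graph `G`
(with edge set `E`) contains a set of `m` vertices spanning exactly `f` edges. -/
noncomputable def numSizes (n m : ℕ) (E : Finset (Finset (Fin n))) : ℕ :=
  Set.ncard {f : ℕ | f ≤ Nat.choose m 3 ∧
    ∃ S : Finset (Fin n), S.card = m ∧ (E.filter (fun e => e ⊆ S)).card = f}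

/-- Sum of `f x y` over the pairs of entries `x`, `y` of a list with `x` before `y`. -/
def pairSum {α : Type*} (f : α → α → ℕ) : List α → ℕ
  | [] => 0
  | x :: l => (l.map (f x)).sum + pairSum f l

/-- Sum of `T x y z` over the triples of entries `x`, `y`, `z` of a list in this order. -/
def tripleSum {α : Type*} (T : α → α → α → ℕ) : List α → ℕ
  | [] => 0
  | x :: l => pairSum (T x) l + tripleSum T l

/-- The adjacency rules of a sequence of blocks, each with vertex set `Q`: whether three vertices
form an edge depends only on their names and on the pattern of blocks they lie in. -/
structure BlockPattern (Q : Type*) where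
  /-- three vertices in one block -/
  inner : Q → Q → Q → ℕ
  /-- two vertices in one block and one in a later block -/
  left : Q → Q → ℕ
  /-- one vertex in a block and two in one later block -/
  right : Q → Q → Q → ℕ
  /-- three vertices in different blocks, the rule only looks at the first two -/
  cross : Q → Q → ℕ
  inner_le : ∀ a b c, inner a b c ≤ 1
  left_le : ∀ a b, left a b ≤ 1
  right_le : ∀ a b c, right a b c ≤ 1
  cross_le : ∀ a b, cross a b ≤ 1

namespace BlockPattern

variable {Q : Type*} (D : BlockPattern Q)

/-- The number of vertices of a sequence of blocks. -/
def size {Q : Type*} (l : List (List Q)) : ℕ := (l.map List.length).sum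

/-- The number of edges containing a vertex `u` and two vertices of the later blocks `l`. -/
def link (u : Q) : List (List Q) → ℕ
  | [] => 0
  | s :: l => pairSum (D.right u) s + (s.map (D.cross u)).sum * size l + link u l

/-- The number of edges spanned by a sequence of blocks. -/
def count : List (List Q) → ℕ
  | [] => 0
  | s :: l => tripleSum D.inner s + pairSum D.left s * size l
      + (s.map (fun u => D.link u l)).sum + count l

@[simp] lemma size_nil : size ([] : List (List Q)) = 0 := rfl
@[simp] lemma size_cons (s : List Q) (l : List (List Q)) :
    size (s :: l) = s.length + size l := by simp [size]
@[simp] lemma size_append (l l' : List (List Q)) : size (l ++ l') = size l + size l' := by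
  simp [size]
@[simp] lemma size_replicate (k : ℕ) (s : List Q) :
    size (List.replicate k s) = k * s.length := by simp [size]

lemma sum_map_le_length {α : Type*} (f : α → ℕ) (c : ℕ) (hf : ∀ x, f x ≤ c) (l : List α) :
    (l.map f).sum ≤ l.length * c := by
  induction l with
  | nil => simp
  | cons x l ih => simp only [List.map_cons, List.sum_cons, List.length_cons]; nlinarith [hf x]

lemma pairSum_le {α : Type*} (f : α → α → ℕ) (hf : ∀ x y, f x y ≤ 1) (l : List α) :
    pairSum f l ≤ l.length * l.length := by
  induction l with
  | nil => simp [pairSum]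
  | cons x l ih =>
    have := sum_map_le_length (f x) 1 (hf x) l
    simp only [pairSum, List.length_cons]
    nlinarith

lemma link_insert (x u : Q) (l l' : List (List Q)) :
    D.link x (l ++ l') ≤ D.link x (l ++ [u] :: l') ∧
      D.link x (l ++ [u] :: l') ≤ D.link x (l ++ l') + size (l ++ l') := by
  induction l with
  | nil =>
    have := D.cross_le x u
    simp only [List.nil_append, link, pairSum, List.map_nil, List.sum_nil, List.map_cons,
      List.sum_cons]
    constructor
    · omega
    · nlinarith
  | cons s l ih =>
    have := sum_map_le_length (D.cross x) 1 (D.cross_le x) s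
    simp only [List.cons_append, link, size_append, size_cons, List.length_cons,
      List.length_nil] at ih ⊢
    have h : size l + (0 + 1 + size l') = size l + size l' + 1 := by omega
    simp only [h, mul_add, mul_one]
    constructor <;> omega

lemma sum_map_sandwich {α : Type*} (f f' : α → ℕ) (c : ℕ)
    (hf : ∀ x, f x ≤ f' x ∧ f' x ≤ f x + c) (l : List α) :
    (l.map f).sum ≤ (l.map f').sum ∧ (l.map f').sum ≤ (l.map f).sum + l.length * c := by
  induction l with
  | nil => simp
  | cons x l ih =>
    have := hf x
    simp only [List.map_cons, List.sum_cons, List.length_cons]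
    constructor
    · omega
    · nlinarith

lemma link_le (x : Q) (l : List (List Q)) : D.link x l ≤ size l * size l := by
  induction l with
  | nil => simp [link]
  | cons s l ih =>
    have h1 := pairSum_le (D.right x) (D.right_le x) s
    have h2 := sum_map_le_length (D.cross x) 1 (D.cross_le x) s
    simp only [link, size_cons]
    nlinarith [Nat.mul_le_mul_right (size l) h2]

lemma count_insert_aux (u : Q) (l l' : List (List Q)) (N : ℕ) (hN : size (l ++ l') ≤ N) :
    D.count (l ++ l') ≤ D.count (l ++ [u] :: l') ∧
      D.count (l ++ [u] :: l') ≤ D.count (l ++ l') + 2 * size l * N + N * N := by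
  induction l with
  | nil =>
    have := D.link_le u l'
    simp only [List.nil_append] at hN
    have := Nat.mul_le_mul hN hN
    simp only [List.nil_append, count, pairSum, tripleSum, List.map_cons, List.map_nil,
      List.sum_cons, List.sum_nil]
    constructor
    · omega
    · nlinarith
  | cons s l ih =>
    have h1 := sum_map_sandwich (fun x => D.link x (l ++ l')) (fun x => D.link x (l ++ [u] :: l'))
      (size (l ++ l')) (fun x => D.link_insert x u l l') s
    have h2 := pairSum_le D.left D.left_le s
    simp only [List.cons_append, size_cons] at hN
    have ih := ih (by omega)
    have h3 : s.length * s.length ≤ s.length * N := Nat.mul_le_mul_left _ (by omega)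
    have h4 : s.length * size (l ++ l') ≤ s.length * N := Nat.mul_le_mul_left _ (by omega)
    simp only [List.cons_append, count, size_cons]
    have h5 : size (l ++ [u] :: l') = size (l ++ l') + 1 := by
      simp only [size_append, size_cons, List.length_cons, List.length_nil]; omega
    rw [h5]
    constructor <;> nlinarith

lemma count_insert (u : Q) (l l' : List (List Q)) (N : ℕ) (hN : size (l ++ l') ≤ N) :
    D.count (l ++ l') ≤ D.count (l ++ [u] :: l') ∧
      D.count (l ++ [u] :: l') ≤ D.count (l ++ l') + 3 * N ^ 2 := by
  have h := D.count_insert_aux u l l' N hN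
  have h2 : size l ≤ N := by rw [size_append] at hN; omega
  exact ⟨h.1, by nlinarith [Nat.mul_le_mul_right N h2]⟩

lemma count_grow (x : Q) (s : List Q) (l : List (List Q)) (N : ℕ) (hN : size (s :: l) ≤ N) :
    D.count (s :: l) ≤ D.count ((x :: s) :: l) ∧
      D.count ((x :: s) :: l) ≤ D.count (s :: l) + 3 * N ^ 2 := by
  have h1 := pairSum_le (D.inner x) (D.inner_le x) s
  have h2 := sum_map_le_length (D.left x) 1 (D.left_le x) s
  have h3 := D.link_le x l
  rw [size_cons] at hN
  have a1 : s.length * s.length ≤ N * N := Nat.mul_le_mul (by omega) (by omega)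
  have a2 : size l * size l ≤ N * N := Nat.mul_le_mul (by omega) (by omega)
  have a3 : s.length * size l ≤ N * N := Nat.mul_le_mul (by omega) (by omega)
  have a4 := Nat.mul_le_mul_right (size l) h2
  simp only [count, tripleSum, pairSum, List.map_cons, List.sum_cons, add_mul]
  constructor
  · omega
  · nlinarith

lemma count_append_singletons (l : List (List Q)) (w : List Q) (N : ℕ)
    (hN : size l + w.length ≤ N) :
    D.count l ≤ D.count (l ++ w.map fun u => [u]) ∧
      D.count (l ++ w.map fun u => [u]) ≤ D.count l + w.length * (3 * N ^ 2) := by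
  induction w with
  | nil => simp
  | cons u w ih =>
    simp only [List.length_cons] at hN
    have ih := ih (by omega)
    have hs : size (w.map fun u => [u]) = w.length := by simp [size, Function.comp_def]
    have h := D.count_insert u l (w.map fun u => [u]) N (by rw [size_append, hs]; omega)
    simp only [List.map_cons, List.length_cons]
    constructor
    · omega
    · nlinarith

end BlockPattern

/-- A walk with steps at most `d` which covers a distance of at least `t * P` visits every one of
`t` disjoint windows of length `P > d`. -/
lemma exists_mem_window (base : ℕ → ℤ) (ℓ : ℕ) (d : ℤ)
    (hstep : ∀ j < ℓ, base (j + 1) ≤ base j + d) (v : ℤ) (h0 : base 0 ≤ v) (hd : 0 ≤ d)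
    (h1 : v ≤ base ℓ) : ∃ j ≤ ℓ, v ≤ base j ∧ base j ≤ v + d := by
  induction ℓ with
  | zero => exact ⟨0, le_rfl, h1, by omega⟩
  | succ ℓ ih =>
    by_cases h : v ≤ base ℓ
    · obtain ⟨j, hj, h⟩ := ih (fun j hj => hstep j (by omega)) h
      exact ⟨j, by omega, h⟩
    · exact ⟨ℓ + 1, le_rfl, h1, by have := hstep ℓ (by omega); omega⟩

lemma exists_many_values_aux {ι : Type*} [Fintype ι] (base : ℕ → ℤ) (ℓ t : ℕ) (d W : ℤ) (hd : 0 ≤ d)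
    (hstep : ∀ j < ℓ, base (j + 1) ≤ base j + d)
    (hfar : t * (d + 2 * W + 1) ≤ base ℓ - base 0)
    (F : ι → ℤ) (hF : Function.Injective F) (hW : ∀ i, |F i| ≤ W) (hW0 : 0 ≤ W) :
    ∃ V : Finset ℤ, (∀ v ∈ V, ∃ j ≤ ℓ, ∃ i, v = base j + F i) ∧ t * Fintype.card ι ≤ V.card := by
  classical
  have key : ∀ i : Fin t, ∃ j ≤ ℓ, base 0 + i * (d + 2 * W + 1) ≤ base j ∧
      base j ≤ base 0 + i * (d + 2 * W + 1) + d := by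
    intro i
    have hi : ((i : ℕ) : ℤ) ≤ t := by exact_mod_cast i.2.le
    apply exists_mem_window base ℓ d hstep _ _ hd
    · nlinarith
    · have : 0 ≤ (i : ℤ) * (d + 2 * W + 1) := by positivity
      omega
  choose j hj hj1 hj2 using key
  refine ⟨Finset.univ.image fun x : Fin t × ι => base (j x.1) + F x.2, ?_, ?_⟩
  · intro v hv
    obtain ⟨x, -, rfl⟩ := Finset.mem_image.1 hv
    exact ⟨_, hj x.1, x.2, rfl⟩
  · rw [Finset.card_image_of_injective]
    · simp
    · rintro ⟨a, i⟩ ⟨b, i'⟩ h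
      simp only at h
      have b1 := abs_le.1 (hW i)
      have b2 := abs_le.1 (hW i')
      have hab : a = b := by
        have l1 : ∀ a b : Fin t, a < b → ¬ base (j a) + W ≥ base (j b) - W := by
          intro a b hlt hh
          have : ((a : ℕ) : ℤ) + 1 ≤ (b : ℕ) := by exact_mod_cast hlt
          have := hj2 a
          have := hj1 b
          nlinarith
        rcases lt_trichotomy a b with hlt | heq | hlt
        · exact (l1 a b hlt (by omega)).elim
        · exact heq
        · exact (l1 b a hlt (by omega)).elim
      subst hab
      simp only [Prod.mk.injEq, true_and]
      exact hF (by omega)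

lemma exists_many_values {ι : Type*} [Fintype ι] (base : ℕ → ℤ) (ℓ t : ℕ) (d W : ℤ) (hd : 0 ≤ d)
    (hstep : ∀ j < ℓ, |base (j + 1) - base j| ≤ d)
    (hfar : t * (d + 2 * W + 1) ≤ |base ℓ - base 0|)
    (F : ι → ℤ) (hF : Function.Injective F) (hW : ∀ i, |F i| ≤ W) (hW0 : 0 ≤ W) :
    ∃ V : Finset ℤ, (∀ v ∈ V, ∃ j ≤ ℓ, ∃ i, v = base j + F i) ∧ t * Fintype.card ι ≤ V.card := by
  rcases abs_cases (base ℓ - base 0) with ⟨h, -⟩ | ⟨h, -⟩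
  · exact exists_many_values_aux base ℓ t d W hd
      (fun j hj => by have := (abs_le.1 (hstep j hj)).2; omega) (h ▸ hfar) F hF hW hW0
  · obtain ⟨V, hV, hc⟩ := exists_many_values_aux (fun j => base (ℓ - j)) ℓ t d W hd
      (fun j hj => by
        have h1 := (abs_le.1 (hstep (ℓ - (j + 1)) (by omega))).1
        have h2 : ℓ - (j + 1) + 1 = ℓ - j := by omega
        rw [h2] at h1
        omega)
      (by simp only [Nat.sub_self, Nat.sub_zero]; omega) F hF hW hW0
    refine ⟨V, fun v hv => ?_, hc⟩
    obtain ⟨j, hj, i, rfl⟩ := hV v hv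
    exact ⟨ℓ - j, by omega, i, rfl⟩

/-- If exchanging adjacent letters of a word always changes `Φ` by the same amount `σ`, then `Φ`
takes all values of an arithmetic progression with difference `σ`. -/
lemma exists_word_of_swap (σ : ℤ) (k : ℕ) : ∀ (U : ℕ) (Φ : List Bool → ℤ)
    (_ : ∀ w₁ w₂, Φ (w₁ ++ false :: true :: w₂) = Φ (w₁ ++ true :: false :: w₂) - σ)
    (i : ℕ), i ≤ k * U → ∃ w, w.count true = k ∧ w.count false = U ∧
      Φ w = Φ (List.replicate k true ++ List.replicate U false) - i * σ := by
  have move : ∀ (Φ : List Bool → ℤ)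
      (_ : ∀ w₁ w₂, Φ (w₁ ++ false :: true :: w₂) = Φ (w₁ ++ true :: false :: w₂) - σ)
      (j : ℕ) (w₁ w₂ : List Bool),
      Φ (w₁ ++ List.replicate j false ++ true :: w₂) =
        Φ (w₁ ++ true :: List.replicate j false ++ w₂) - j * σ := by
    intro Φ hΦ j
    induction j with
    | zero => intro w₁ w₂; simp
    | succ j ih =>
      intro w₁ w₂
      have h1 := ih (w₁ ++ [false]) w₂
      have h2 := hΦ w₁ (List.replicate j false ++ w₂)
      simp only [List.replicate_succ, List.append_assoc, List.cons_append, List.nil_append]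
        at h1 h2 ⊢
      rw [h1, h2]
      push_cast
      ring
  induction k with
  | zero =>
    intro U Φ _ i hi
    obtain rfl : i = 0 := by omega
    exact ⟨List.replicate U false, by simp [List.count_replicate], by simp, by simp⟩
  | succ k ih =>
    intro U Φ hΦ i hi
    rcases le_total i U with h | h
    · refine ⟨List.replicate k true ++ List.replicate i false ++
        true :: List.replicate (U - i) false, ?_, ?_, ?_⟩
      · simp [List.count_replicate]
      · simp only [List.count_append, List.count_replicate, List.count_cons]
        simp
        omega
      · rw [move Φ hΦ]
        congr 2
        obtain ⟨V, rfl⟩ := Nat.exists_eq_add_of_le h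
        rw [List.replicate_succ', Nat.add_sub_cancel_left, ← List.replicate_append_replicate]
        simp
    · obtain ⟨w, h1, h2, h3⟩ := ih U (fun w => Φ (w ++ [true]))
        (fun w₁ w₂ => by simpa using hΦ w₁ (w₂ ++ [true])) (i - U) (by
          rw [Nat.succ_mul] at hi; omega)
      refine ⟨w ++ [true], by simp [h1], by simp [h2], ?_⟩
      rw [h3, move Φ hΦ]
      have : List.replicate k true ++ true :: List.replicate U false ++ [] =
          List.replicate (k + 1) true ++ List.replicate U false := by
        simp [List.replicate_succ']
      rw [this]
      push_cast [h]
      ring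

namespace BlockPattern

variable {Q : Type*} (D : BlockPattern Q)

/-- The value `v` is the number of edges of a sequence of few blocks with `m` vertices. -/
def Attains (m : ℕ) (v : ℤ) : Prop :=
  ∃ l : List (List Q), size l = m ∧ l.length ≤ m + 1 ∧ (∀ s ∈ l, s.Nodup) ∧ (D.count l : ℤ) = v

lemma exists_attains {ι : Type*} [Fintype ι] (m k : ℕ) (base : ℕ → ℤ) (ℓ : ℕ)
    (F : ι → ℤ) (hF : Function.Injective F) (hk : m < 20000 * k)
    (hstep : ∀ j < ℓ, |base (j + 1) - base j| ≤ 3 * m ^ 2)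
    (hfar : 6 * k * (m : ℤ) ^ 2 ≤ |base ℓ - base 0|)
    (hW : ∀ i, |F i| ≤ (m : ℤ) ^ 2) (hι : k ^ 2 ≤ Fintype.card ι) (hm : 1 ≤ m)
    (hat : ∀ j ≤ ℓ, ∀ i, D.Attains m (base j + F i)) :
    ∃ V : Finset ℤ, (∀ v ∈ V, D.Attains m v) ∧ m ^ 3 ≤ 20000 ^ 3 * V.card := by
  obtain ⟨V, hV, hc⟩ := exists_many_values base ℓ k (3 * m ^ 2) ((m : ℤ) ^ 2) (by positivity) hstep
    (by
      have : (1 : ℤ) ≤ (m : ℤ) ^ 2 := by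
        have : (1 : ℤ) ≤ m := by exact_mod_cast hm
        nlinarith
      have : (k : ℤ) * (3 * m ^ 2 + 2 * m ^ 2 + 1) ≤ k * (6 * m ^ 2) := by gcongr; omega
      linarith) F hF hW (by positivity)
  refine ⟨V, fun v hv => ?_, ?_⟩
  · obtain ⟨j, hj, i, rfl⟩ := hV v hv
    exact hat j hj i
  · calc m ^ 3 ≤ (20000 * k) ^ 3 := by gcongr
      _ = 20000 ^ 3 * (k * k ^ 2) := by ring
      _ ≤ _ := by gcongr; exact (Nat.mul_le_mul_left _ hι).trans hc

end BlockPattern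

namespace BlockPattern

variable {Q : Type*} (D : BlockPattern Q)

lemma link_append_congr (x : Q) (l t t' : List (List Q)) (hs : size t = size t')
    (h : D.link x t = D.link x t') : D.link x (l ++ t) = D.link x (l ++ t') := by
  induction l with
  | nil => simpa
  | cons s l ih => simp [link, hs, ih]

lemma count_append_congr (l t t' : List (List Q)) (hs : size t = size t')
    (h : ∀ x, D.link x t = D.link x t') :
    D.count (l ++ t) + D.count t' = D.count (l ++ t') + D.count t := by
  induction l with
  | nil => simp [add_comm]
  | cons s l ih =>
    have := fun x => D.link_append_congr x l t t' hs (h x)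
    simp only [List.cons_append, count, size_append, hs, this]
    omega

/-- The sequence of one-vertex blocks with the given vertices. -/
def sing (w : List Q) : List (List Q) := w.map fun u => [u]

@[simp] lemma size_sing (w : List Q) : size (sing w) = w.length := by
  simp [sing, size, Function.comp_def]

@[simp] lemma length_sing (w : List Q) : (sing w).length = w.length := by simp [sing]

lemma count_append_sing (l : List (List Q)) (w : List Q) (N : ℕ) (hN : size l + w.length ≤ N) :
    D.count l ≤ D.count (l ++ sing w) ∧
      D.count (l ++ sing w) ≤ D.count l + w.length * (3 * N ^ 2) :=
  D.count_append_singletons l w N hN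

lemma nodup_of_mem_sing {w s : List Q} (h : s ∈ sing w) : s.Nodup := by
  obtain ⟨u, -, rfl⟩ := List.mem_map.1 h
  simp

lemma link_replicate (u x : Q) (h : ℕ) :
    D.link u (sing (List.replicate h x)) = D.cross u x * h.choose 2 := by
  induction h with
  | zero => simp [sing, link]
  | succ h ih =>
    simp only [List.replicate_succ, sing, List.map_cons] at ih ⊢
    have := size_sing (List.replicate h x)
    simp only [sing, List.length_replicate] at this
    simp only [link, ih, this, pairSum, List.map_cons, List.map_nil, List.sum_cons, List.sum_nil,
      Nat.choose_succ_succ' h 1, Nat.choose_one_right]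
    ring

lemma link_replicate_append (u x y : Q) (h h' : ℕ) :
    D.link u (sing (List.replicate h x ++ List.replicate h' y)) =
      D.cross u x * (h.choose 2 + h * h') + D.cross u y * h'.choose 2 := by
  induction h with
  | zero => simp [link_replicate]
  | succ h ih =>
    have hs := size_sing (List.replicate h x ++ List.replicate h' y)
    simp only [List.replicate_succ, sing, List.map_cons, List.cons_append] at ih hs ⊢
    simp only [link, ih, hs, pairSum, List.map_cons, List.map_nil, List.sum_cons, List.sum_nil,
      Nat.choose_succ_succ' h 1, Nat.choose_one_right, List.length_append, List.length_replicate]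
    ring

lemma count_replicate (x : Q) (h : ℕ) :
    D.count (sing (List.replicate h x)) = D.cross x x * h.choose 3 := by
  induction h with
  | zero => simp [sing, count]
  | succ h ih =>
    have hl := D.link_replicate x x h
    simp only [List.replicate_succ, sing, List.map_cons] at ih hl ⊢
    simp only [count, ih, hl, tripleSum, pairSum, List.map_cons, List.map_nil, List.sum_cons,
      List.sum_nil, Nat.choose_succ_succ' h 2]
    ring

lemma count_replicate_append (x y : Q) (h h' : ℕ) :
    D.count (sing (List.replicate h x ++ List.replicate h' y)) =
      D.cross x x * (h.choose 3 + h.choose 2 * h') + D.cross x y * (h * h'.choose 2) +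
        D.cross y y * h'.choose 3 := by
  induction h with
  | zero => simp [count_replicate]
  | succ h ih =>
    have hl := D.link_replicate_append x x y h h'
    simp only [List.replicate_succ, sing, List.map_cons, List.cons_append] at ih hl ⊢
    simp only [count, ih, hl, tripleSum, pairSum, List.map_cons, List.map_nil, List.sum_cons,
      List.sum_nil, Nat.choose_succ_succ' h 1, Nat.choose_one_right, Nat.choose_succ_succ' h 2]
    ring

lemma count_swap_singletons (a b : Q) (l r : List (List Q)) :
    (D.count (l ++ (sing [a, a, b, a, b, a] ++ r)) : ℤ) =
      D.count (l ++ (sing [a, b, a, a, a, b] ++ r)) -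
        (2 * D.cross a a - 5 * D.cross a b + 4 * D.cross b a - D.cross b b) := by
  have h := D.count_append_congr l (sing [a, a, b, a, b, a] ++ r) (sing [a, b, a, a, a, b] ++ r)
    (by simp) (by intro x; simp [sing, link]; ring)
  have h2 : (D.count (sing [a, a, b, a, b, a] ++ r) : ℤ) =
      D.count (sing [a, b, a, a, a, b] ++ r) -
        (2 * D.cross a a - 5 * D.cross a b + 4 * D.cross b a - D.cross b b) := by
    simp only [sing, List.map_cons, List.map_nil, List.cons_append, List.nil_append, count, link,
      size_cons, tripleSum, pairSum, List.sum_cons, List.sum_nil, List.length_cons,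
      List.length_nil]
    push_cast
    ring
  push_cast [← @Nat.cast_inj ℤ] at h
  linarith

lemma abs_count_exchange_le (x y : Q) (A B : List Q) (N : ℕ)
    (t : List (List Q)) (hN : A.length + B.length + size t ≤ N) :
    |(D.count (sing (A ++ x :: B) ++ t) : ℤ) - D.count (sing (A ++ y :: B) ++ t)| ≤ 3 * N ^ 2 := by
  have h1 := D.count_insert x (sing A) (sing B ++ t) N (by simp; omega)
  have h2 := D.count_insert y (sing A) (sing B ++ t) N (by simp; omega)
  have e : ∀ x, sing (A ++ x :: B) ++ t = sing A ++ [x] :: (sing B ++ t) := by simp [sing]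
  rw [e x, e y, abs_le]
  zify at h1 h2
  constructor <;> linarith [h1.1, h1.2, h2.1, h2.2]

/-- The two words exchanged by the swaps in a sequence of one-vertex blocks. -/
def swapBlock (a b : Q) : Bool → List Q
  | true => [a, b, a]
  | false => [a, a, b]

lemma length_flatMap_swapBlock (a b : Q) (w : List Bool) :
    (w.flatMap (swapBlock a b)).length = 3 * w.length := by
  induction w with
  | nil => rfl
  | cons c w ih => cases c <;> simp [List.flatMap_cons, ih, swapBlock] <;> ring

lemma far_bound (k h m : ℕ) (hm : 2 * m ≤ 3 * (h - 1)) :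
    24 * k * m ^ 2 ≤ 2500 * k * h.choose 2 := by
  have h3 : 2 * h.choose 2 = h * (h - 1) := by
    rw [Nat.choose_two_right, Nat.mul_div_cancel' (Nat.even_mul_pred_self h).two_dvd]
  have h4 : m ^ 2 ≤ 100 * h.choose 2 := by
    have : 2 * m * (2 * m) ≤ 3 * h * (3 * (h - 1)) := Nat.mul_le_mul (by omega) hm
    nlinarith
  calc 24 * k * m ^ 2 ≤ 24 * k * (100 * h.choose 2) := Nat.mul_le_mul_left _ h4
    _ ≤ _ := by nlinarith [Nat.zero_le (k * h.choose 2)]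

lemma exists_attains_of_cross (a b x₀ x y : Q) (hxy : D.cross x₀ x₀ ≠ D.cross x y)
    (hσ : (2 * D.cross a a - 5 * D.cross a b + 4 * D.cross b a - D.cross b b : ℤ) ≠ 0)
    (m k : ℕ) (hk : 1 ≤ k) (hm : 10000 * k ≤ m) (hm2 : m < 20000 * k) :
    ∃ V : Finset ℤ, (∀ v ∈ V, D.Attains m v) ∧ m ^ 3 ≤ 20000 ^ 3 * V.card := by
  set σ : ℤ := 2 * D.cross a a - 5 * D.cross a b + 4 * D.cross b a - D.cross b b with hσd
  obtain ⟨h', hh'⟩ : ∃ h', m = 2500 * k + h' + 6 * k := ⟨m - 2506 * k, by omega⟩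
  set h := 2500 * k with hh
  set e₂ := List.replicate h x ++ List.replicate h' y with he₂
  have le₂ : e₂.length = h + h' := by simp [he₂]
  set e : ℕ → List Q := fun j => e₂.take j ++ List.replicate (h + h' - j) x₀ with he
  set w₀ := List.replicate k true ++ List.replicate k false with hw₀
  set Φ : ℕ → List Bool → ℤ :=
    fun j w => D.count (sing (e j) ++ sing (w.flatMap (swapBlock a b))) with hΦ
  have hlw : ∀ w : List Bool, w.count true = k → w.count false = k →
      (w.flatMap (swapBlock a b)).length = 6 * k := by
    intro w h1 h2
    rw [length_flatMap_swapBlock, ← List.count_false_add_count_true, h1, h2]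
    ring
  have hle : ∀ j ≤ h + h', (e j).length = h + h' := by
    intro j hj
    simp [he, le₂]
    omega
  have hlw₀ := hlw w₀ (by simp [hw₀, List.count_replicate]) (by simp [hw₀, List.count_replicate])
  refine D.exists_attains m k (fun j => Φ j w₀) (h + h')
    (ι := Fin (k ^ 2)) (fun i => -((i : ℕ) * σ)) ?_ hm2 ?_ ?_ ?_ (by simp) (by omega) ?_
  · intro i j hij
    simp only [neg_inj] at hij
    have := mul_right_cancel₀ hσ hij
    exact Fin.ext (by exact_mod_cast this)
  · intro j hj
    have e1 : e (j + 1) = e₂.take j ++ e₂[j]'(by omega) :: List.replicate (h + h' - (j + 1)) x₀ := by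
      simp only [he]
      rw [← List.take_append_getElem (by omega : j < e₂.length)]
      simp only [List.append_assoc, List.cons_append, List.nil_append]
    have e2 : e j = e₂.take j ++ x₀ :: List.replicate (h + h' - (j + 1)) x₀ := by
      simp only [he]
      rw [← List.replicate_succ]
      congr 2
      omega
    simp only [hΦ]
    rw [e1, e2]
    refine D.abs_count_exchange_le _ _ _ _ m _ ?_
    simp [hlw₀, le₂]
    omega
  · have b1 := D.count_append_sing (sing (e (h + h'))) (w₀.flatMap (swapBlock a b)) m
      (by rw [size_sing, hle _ le_rfl, hlw₀]; omega)
    have b2 := D.count_append_sing (sing (e 0)) (w₀.flatMap (swapBlock a b)) m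
      (by rw [size_sing, hle _ (by omega), hlw₀]; omega)
    rw [hlw₀] at b1 b2
    have c1 : e (h + h') = e₂ := by simp [he, ← le₂]
    have c2 : e 0 = List.replicate h x₀ ++ List.replicate h' x₀ := by
      simp [he]
    rw [c1, D.count_replicate_append] at b1
    rw [c2, D.count_replicate_append] at b2
    have l1 := D.cross_le x₀ x₀
    have l2 := D.cross_le x y
    have l3 := D.cross_le x x
    have l4 := D.cross_le y y
    have hc : 24 * k * m ^ 2 ≤ h * h'.choose 2 := far_bound k h' m (by omega)
    have hnn : ∀ z : ℕ, z ≤ 1 → ∀ t : ℕ, z * t ≤ t := fun z hz t => by nlinarith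
    have d1 := hnn _ l3 (h.choose 3 + h.choose 2 * h')
    have d2 := hnn _ l4 (h'.choose 3)
    simp only [hΦ]
    rw [c1, c2]
    rw [le_abs]
    zify at b1 b2 hc d1 d2
    have hcase : (D.cross x₀ x₀ = 0 ∧ D.cross x y = 1) ∨ (D.cross x₀ x₀ = 1 ∧ D.cross x y = 0) := by
      omega
    rcases hcase with ⟨h1, h2⟩ | ⟨h1, h2⟩
    · left
      simp only [h1, h2] at b1 b2
      push_cast at b1 b2
      have : (0 : ℤ) ≤ D.cross x x * (h.choose 3 + h.choose 2 * h') := by positivity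
      have : (0 : ℤ) ≤ D.cross y y * h'.choose 3 := by positivity
      linarith [b1.1, b2.2]
    · right
      simp only [h1, h2] at b1 b2
      push_cast at b1 b2
      linarith [b1.2, b2.1]
  · intro i
    have hi : ((i : ℕ) : ℤ) ≤ k ^ 2 := by exact_mod_cast i.2.le
    have : |σ| ≤ 6 := by
      have l1 := D.cross_le a a
      have l2 := D.cross_le a b
      have l3 := D.cross_le b a
      have l4 := D.cross_le b b
      rw [abs_le]
      omega
    rw [abs_neg, abs_mul, Nat.abs_cast]
    have hkm : (10000 * k : ℤ) ≤ m := by exact_mod_cast hm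
    nlinarith [abs_nonneg σ]
  · intro j hj i
    obtain ⟨w, h1, h2, h3⟩ := exists_word_of_swap σ k k (Φ j) (by
      intro w₁ w₂
      have := D.count_swap_singletons a b (sing (e j) ++ sing (w₁.flatMap (swapBlock a b)))
        (sing (w₂.flatMap (swapBlock a b)))
      simp only [hΦ]
      simpa [sing, swapBlock, List.flatMap_cons] using this) i
      (by have := i.2; rw [← sq]; omega)
    refine ⟨sing (e j) ++ sing (w.flatMap (swapBlock a b)), ?_, ?_, ?_, ?_⟩
    · rw [size_append, size_sing, size_sing, hle j hj, hlw w h1 h2]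
      omega
    · rw [List.length_append, length_sing, length_sing, hle j hj, hlw w h1 h2]
      omega
    · intro s hs
      rcases List.mem_append.1 hs with hs | hs <;> exact nodup_of_mem_sing hs
    · have : (D.count (sing (e j) ++ sing (w.flatMap (swapBlock a b))) : ℤ) = Φ j w := rfl
      rw [this, h3]
      ring

lemma exists_attains_of_cross_ne (a b a' b' : Q) (hne : D.cross a b ≠ D.cross a' b')
    (m k : ℕ) (hk : 1 ≤ k) (hm : 10000 * k ≤ m) (hm2 : m < 20000 * k) :
    ∃ V : Finset ℤ, (∀ v ∈ V, D.Attains m v) ∧ m ^ 3 ≤ 20000 ^ 3 * V.card := by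
  have key : ∃ a b, ¬ (D.cross a b = D.cross a a ∧ D.cross b a = D.cross a a ∧
      D.cross b b = D.cross a a) := by
    by_contra! h
    have h1 := h a b
    have h2 := h a a'
    have h3 := h a' b'
    exact hne (by omega)
  obtain ⟨a, b, h⟩ := key
  have l1 := D.cross_le a a
  have l2 := D.cross_le a b
  have l3 := D.cross_le b a
  have l4 := D.cross_le b b
  have hσ : (2 * D.cross a a - 5 * D.cross a b + 4 * D.cross b a - D.cross b b : ℤ) ≠ 0 := by
    rcases Nat.le_one_iff_eq_zero_or_eq_one.1 l1 with h1 | h1 <;>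
    rcases Nat.le_one_iff_eq_zero_or_eq_one.1 l2 with h2 | h2 <;>
    rcases Nat.le_one_iff_eq_zero_or_eq_one.1 l3 with h3 | h3 <;>
    rcases Nat.le_one_iff_eq_zero_or_eq_one.1 l4 with h4 | h4 <;>
    simp [h1, h2, h3, h4] at h ⊢
  by_cases h1 : D.cross a a = D.cross b b
  · by_cases h2 : D.cross a a = D.cross a b
    · exact D.exists_attains_of_cross a b a b a (by omega) hσ m k hk hm hm2
    · exact D.exists_attains_of_cross a b a a b h2 hσ m k hk hm hm2
  · exact D.exists_attains_of_cross a b a b b h1 hσ m k hk hm hm2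

end BlockPattern

lemma mul_le_pairSum_append {α : Type*} (f : α → α → ℕ) (s t : List α)
    (h : ∀ x ∈ s, ∀ y ∈ t, f x y = 1) : s.length * t.length ≤ pairSum f (s ++ t) := by
  induction s with
  | nil => simp
  | cons x s ih =>
    have ih := ih fun x hx => h x (List.mem_cons_of_mem _ hx)
    have h2 : (t.map (f x)).sum = t.length := by
      rw [List.map_congr_left (fun y hy => h x (by simp) y hy)]
      simp
    simp only [List.cons_append, pairSum, List.map_append, List.sum_append, List.length_cons, h2]
    rw [add_mul, one_mul]
    omega

lemma tripleSum_le {α : Type*} (f : α → α → α → ℕ) (hf : ∀ x y z, f x y z ≤ 1) (l : List α) :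
    tripleSum f l ≤ l.length ^ 3 := by
  induction l with
  | nil => simp [tripleSum]
  | cons x l ih =>
    have := BlockPattern.pairSum_le (f x) (hf x) l
    simp only [tripleSum, List.length_cons]
    nlinarith

lemma pairSum_congr_of_nodup {α : Type*} (f g : α → α → ℕ) (h : ∀ x y, x ≠ y → f x y = g x y)
    (l : List α) (hl : l.Nodup) : pairSum f l = pairSum g l := by
  induction l with
  | nil => rfl
  | cons x l ih =>
    rw [List.nodup_cons] at hl
    rw [pairSum, pairSum, ih hl.2, List.map_congr_left]
    rintro y hy
    exact h x y (by rintro rfl; exact hl.1 hy)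

namespace BlockPattern

variable {Q : Type*} (D : BlockPattern Q)

lemma link_le_of_cross_eq_zero (hg : ∀ a b, D.cross a b = 0) (x : Q) (l : List (List Q))
    (hl : ∀ s ∈ l, s.length ≤ 3) : D.link x l ≤ 3 * size l := by
  induction l with
  | nil => simp [link]
  | cons s l ih =>
    have := ih fun s hs => hl s (List.mem_cons_of_mem _ hs)
    have h2 := pairSum_le (D.right x) (D.right_le x) s
    have h3 := hl s (by simp)
    have h4 : (s.map (D.cross x)).sum = 0 := by
      simp [show D.cross x = fun _ => 0 from funext (hg x)]
    rw [link, size_cons, h4]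
    nlinarith

lemma count_le_of_cross_eq_zero (hg : ∀ a b, D.cross a b = 0) (l : List (List Q))
    (hl : ∀ s ∈ l, s.length ≤ 3) : D.count l ≤ l.length * (27 + 18 * size l) := by
  induction l with
  | nil => simp [count]
  | cons s l ih =>
    have hl' : ∀ s ∈ l, s.length ≤ 3 := fun s hs => hl s (List.mem_cons_of_mem _ hs)
    have ih := ih hl'
    have h1 := pairSum_le D.left D.left_le s
    have h2 := tripleSum_le D.inner D.inner_le s
    have h3 := hl s (by simp)
    have h4 := sum_map_le_length (fun u => D.link u l) _
      (fun u => D.link_le_of_cross_eq_zero hg u l hl') s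
    have h5 : s.length ^ 3 ≤ 3 ^ 3 := Nat.pow_le_pow_left h3 3
    have h6 : s.length * s.length ≤ 9 := by nlinarith
    have h7 : s.length * (3 * size l) ≤ 3 * (3 * size l) := Nat.mul_le_mul_right _ h3
    have h8 : pairSum D.left s * size l ≤ 9 * size l := Nat.mul_le_mul_right _ (h1.trans h6)
    simp only [count, size_cons, List.length_cons]
    have h9 : l.length * (27 + 18 * size l) ≤ l.length * (27 + 18 * (s.length + size l)) :=
      Nat.mul_le_mul_left _ (by omega)
    rw [add_mul]
    omega

lemma count_step (x u : Q) (s : List Q) (t : List (List Q)) (j N : ℕ)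
    (hN : s.length + j + size t ≤ N) :
    |(D.count ((x :: s) :: (List.replicate j [u] ++ t)) : ℤ) -
      D.count (s :: (List.replicate (j + 1) [u] ++ t))| ≤ 3 * N ^ 2 := by
  have h1 := D.count_grow x s (List.replicate j [u] ++ t) N (by simp; omega)
  have h2 := D.count_insert u [s] (List.replicate j [u] ++ t) N (by simp; omega)
  simp only [List.cons_append, List.nil_append] at h2
  rw [List.replicate_succ, List.cons_append, abs_le]
  zify at h1 h2
  constructor <;> linarith [h1.1, h1.2, h2.1, h2.2]

lemma exists_attains_of_fine {ι : Type*} [Fintype ι] (hg : ∀ a b, D.cross a b = 0) (u : Q)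
    (m k f : ℕ) (hk : 1 ≤ k) (hm : 10000 * k ≤ m) (hm2 : m < 20000 * k) (hf : f ≤ 5 * k)
    (p q : Fin m → Q) (hp : p.Injective) (hq : q.Injective) (hpq : ∀ i j, p i ≠ q j)
    (hleft : ∀ i j, D.left (p i) (q j) = 1)
    (fine : ι → List (List Q)) (i₀ : ι) (F : ι → ℤ) (hF : F.Injective)
    (hW : ∀ i, |F i| ≤ (m : ℤ) ^ 2) (hι : k ^ 2 ≤ Fintype.card ι)
    (hsize : ∀ i, size (fine i) = f) (hlen : ∀ i, (fine i).length ≤ f)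
    (hnodup : ∀ i, ∀ s ∈ fine i, s.Nodup) (h3 : ∀ s ∈ fine i₀, s.length ≤ 3)
    (hfine : ∀ l : List (List Q), (∀ s ∈ l, s.Nodup) → size l + f = m → ∀ i,
      (D.count (l ++ fine i) : ℤ) = D.count (l ++ fine i₀) + F i) :
    ∃ V : Finset ℤ, (∀ v ∈ V, D.Attains m v) ∧ m ^ 3 ≤ 20000 ^ 3 * V.card := by
  obtain ⟨h, hh⟩ : ∃ h, h = m / 4 := ⟨_, rfl⟩
  have l1 : ((List.ofFn p).take h).length = h := by simp; omega
  have l2 : ((List.ofFn q).take h).length = h := by simp; omega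
  set E := (List.ofFn p).take h ++ (List.ofFn q).take h with hE
  have hEl : E.length = 2 * h := by rw [hE, List.length_append, l1, l2]; ring
  have hEn : E.Nodup := by
    refine List.Nodup.append ((List.nodup_ofFn.2 hp).sublist (List.take_sublist _ _))
      ((List.nodup_ofFn.2 hq).sublist (List.take_sublist _ _)) ?_
    intro x hx hy
    obtain ⟨i, rfl⟩ := (List.mem_ofFn' _ _).1 (List.mem_of_mem_take hx)
    obtain ⟨j, hj⟩ := (List.mem_ofFn' _ _).1 (List.mem_of_mem_take hy)
    exact hpq i j hj.symm
  set pre : ℕ → List (List Q) :=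
    fun j => E.drop (2 * h - j) :: List.replicate (m - f - j) [u] with hpre
  have hpsize : ∀ j ≤ 2 * h, size (pre j) + f = m := by
    intro j hj
    simp [hpre, hEl]
    omega
  have hpn : ∀ j, ∀ s ∈ pre j, s.Nodup := by
    intro j s hs
    rcases List.mem_cons.1 hs with rfl | hs
    · exact hEn.sublist (List.drop_sublist _ _)
    · rw [List.eq_of_mem_replicate hs]
      simp
  refine D.exists_attains m k (fun j => D.count (pre j ++ fine i₀)) (2 * h) F hF hm2 ?_ ?_ hW hι
    (by omega) ?_
  · intro j hj
    have e1 : E.drop (2 * h - j - 1) = E[2 * h - j - 1]'(by omega) :: E.drop (2 * h - j) := by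
      rw [List.drop_eq_getElem_cons (by omega)]
      congr 2
      omega
    have e2 : m - f - j = m - f - (j + 1) + 1 := by omega
    have e3 : 2 * h - (j + 1) = 2 * h - j - 1 := by omega
    simp only [hpre, List.cons_append]
    rw [e2, e3, e1]
    refine D.count_step _ u _ _ _ m ?_
    rw [List.length_drop, hEl, hsize]
    omega
  · have b0 := D.count_le_of_cross_eq_zero hg (pre 0 ++ fine i₀) (by
      intro s hs
      rcases List.mem_append.1 hs with hs | hs
      · rcases List.mem_cons.1 hs with rfl | hs
        · simp [hEl]
        · rw [List.eq_of_mem_replicate hs]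
          simp
      · exact h3 s hs)
    have b1 : (pre 0 ++ fine i₀).length ≤ m + 1 := by
      have := hlen i₀
      simp [hpre]
      omega
    have b2 : size (pre 0 ++ fine i₀) = m := by
      rw [size_append, hsize, hpsize 0 (by omega)]
    rw [b2] at b0
    have b3 : D.count (pre 0 ++ fine i₀) ≤ 20 * m ^ 2 := by
      have := Nat.mul_le_mul_right (27 + 18 * m) b1
      nlinarith
    have c1 : h * h * (m - 2 * h) ≤ D.count (pre (2 * h) ++ fine i₀) := by
      have := mul_le_pairSum_append D.left ((List.ofFn p).take h) ((List.ofFn q).take h) (by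
        intro x hx y hy
        obtain ⟨i, rfl⟩ := (List.mem_ofFn' _ _).1 (List.mem_of_mem_take hx)
        obtain ⟨j, rfl⟩ := (List.mem_ofFn' _ _).1 (List.mem_of_mem_take hy)
        exact hleft i j)
      rw [← hE, l1, l2] at this
      have e : size (List.replicate (m - f - 2 * h) [u] ++ fine i₀) = m - 2 * h := by
        simp [hsize]
        omega
      simp only [hpre, Nat.sub_self, List.drop_zero, List.cons_append, count, e]
      have := Nat.mul_le_mul_right (m - 2 * h) this
      omega
    have c2 : 26 * k * m ^ 2 ≤ h * h * (m - 2 * h) := by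
      have d1 : 5000 * k ≤ m - 2 * h := by omega
      have d2 : m ^ 2 ≤ 25 * (h * h) := by nlinarith [show m ≤ 5 * h by omega]
      calc 26 * k * m ^ 2 ≤ 26 * k * (25 * (h * h)) := Nat.mul_le_mul_left _ d2
        _ ≤ h * h * (5000 * k) := by nlinarith [Nat.zero_le (h * h * k)]
        _ ≤ _ := Nat.mul_le_mul_left _ d1
    rw [le_abs]
    left
    have d3 : m ^ 2 ≤ k * m ^ 2 := Nat.le_mul_of_pos_left _ hk
    zify at b3 c2 c1 d3
    nlinarith
  · intro j hj i
    refine ⟨pre j ++ fine i, ?_, ?_, ?_, hfine _ (hpn j) (hpsize j hj) i⟩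
    · rw [size_append, hsize, hpsize j hj]
    · have := hlen i
      simp [hpre]
      omega
    · intro s hs
      rcases List.mem_append.1 hs with hs | hs
      · exact hpn j s hs
      · exact hnodup i s hs

/-- A pair block or a one-vertex block. -/
def pairBlock (u v w : Q) : Bool → List Q
  | true => [v, w]
  | false => [u]

lemma size_map_pairBlock (u v w : Q) (t : List Bool) :
    size (t.map (pairBlock u v w)) = 2 * t.count true + t.count false := by
  induction t with
  | nil => simp
  | cons b t ih => cases b <;> simp [ih, pairBlock] <;> ring

lemma link_map_pairBlock (hg : ∀ a b, D.cross a b = 0) (x u v w : Q) (t : List Bool) :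
    D.link x (t.map (pairBlock u v w)) = t.count true * D.right x v w := by
  induction t with
  | nil => simp [link]
  | cons b t ih => cases b <;> simp [ih, pairBlock, link, pairSum, hg]; ring

lemma count_swap_pairBlock (hg : ∀ a b, D.cross a b = 0) (u v w : Q) (l r : List (List Q)) :
    (D.count (l ++ [u] :: [v, w] :: r) : ℤ) =
      D.count (l ++ [v, w] :: [u] :: r) - (D.left v w - D.right u v w) := by
  have h := D.count_append_congr l ([u] :: [v, w] :: r) ([v, w] :: [u] :: r)
    (by simp; ring) (by intro x; simp [link, hg, pairSum])
  have h2 : (D.count ([u] :: [v, w] :: r) : ℤ) =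
      D.count ([v, w] :: [u] :: r) - (D.left v w - D.right u v w) := by
    simp [count, link, tripleSum, pairSum, hg]
    ring
  push_cast [← @Nat.cast_inj ℤ] at h
  linarith

lemma exists_attains_of_left_ne_right (hg : ∀ a b, D.cross a b = 0) (u v w : Q) (hvw : v ≠ w)
    (hne : D.left v w ≠ D.right u v w)
    (m k : ℕ) (hk : 1 ≤ k) (hm : 10000 * k ≤ m) (hm2 : m < 20000 * k)
    (p q : Fin m → Q) (hp : p.Injective) (hq : q.Injective) (hpq : ∀ i j, p i ≠ q j)
    (hleft : ∀ i j, D.left (p i) (q j) = 1) :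
    ∃ V : Finset ℤ, (∀ v ∈ V, D.Attains m v) ∧ m ^ 3 ≤ 20000 ^ 3 * V.card := by
  obtain ⟨σ, hσ⟩ : ∃ σ : ℤ, σ = D.left v w - D.right u v w := ⟨_, rfl⟩
  have hσ0 : σ ≠ 0 := by omega
  have hσ1 : |σ| ≤ 1 := by
    have := D.left_le v w
    have := D.right_le u v w
    rw [abs_le]
    omega
  have hw := fun i : Fin (k ^ 2) => exists_word_of_swap σ k k
    (fun t => (D.count (t.map (pairBlock u v w)) : ℤ)) (by
      intro w₁ w₂
      have := D.count_swap_pairBlock hg u v w (w₁.map (pairBlock u v w))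
        (w₂.map (pairBlock u v w))
      rw [← hσ] at this
      simpa [pairBlock] using this) i (by have := i.2; rw [← sq]; omega)
  choose t ht1 ht2 ht3 using hw
  obtain ⟨i₀, hi₀⟩ : ∃ i : Fin (k ^ 2), (i : ℕ) = 0 := ⟨⟨0, by positivity⟩, rfl⟩
  have hb : ∀ (t : List Bool) (s : List Q), s ∈ t.map (pairBlock u v w) →
      s.Nodup ∧ s.length ≤ 3 := by
    intro t s hs
    obtain ⟨b, -, rfl⟩ := List.mem_map.1 hs
    cases b <;> simp [pairBlock, hvw]
  refine D.exists_attains_of_fine hg u m k (3 * k) hk hm hm2 (by omega) p q hp hq hpq hleft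
    (fun i => (t i).map (pairBlock u v w)) i₀ (fun i : Fin (k ^ 2) => -((i : ℕ) * σ)) ?_ ?_
    (by simp) ?_ ?_ (fun i s hs => (hb _ s hs).1) (fun s hs => (hb _ s hs).2) ?_
  · intro i j hij
    simp only [neg_inj] at hij
    have := mul_right_cancel₀ hσ0 hij
    exact Fin.ext (by exact_mod_cast this)
  · intro i
    have hi : ((i : ℕ) : ℤ) ≤ k ^ 2 := by exact_mod_cast i.2.le
    rw [abs_neg, abs_mul, Nat.abs_cast]
    have hkm : (10000 * k : ℤ) ≤ m := by exact_mod_cast hm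
    nlinarith [abs_nonneg σ]
  · intro i
    rw [size_map_pairBlock, ht1, ht2]
    ring
  · intro i
    rw [List.length_map, ← List.count_false_add_count_true, ht1, ht2]
    omega
  · intro l _ _ i
    have h := D.count_append_congr l ((t i).map (pairBlock u v w)) ((t i₀).map (pairBlock u v w))
      (by simp only [size_map_pairBlock, ht1, ht2])
      (by intro x; simp only [D.link_map_pairBlock hg, ht1])
    have h1 := ht3 i
    have h2 := ht3 i₀
    rw [hi₀] at h2
    push_cast [← @Nat.cast_inj ℤ] at h h2
    linarith

/-- The weighted sum of a function of the blocks. -/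
def blockSum (f : List Q → ℕ) (l : List (List Q)) : ℕ := (l.map f).sum

lemma blockSum_append (f : List Q → ℕ) (l l' : List (List Q)) :
    blockSum f (l ++ l') = blockSum f l + blockSum f l' := by simp [blockSum]

lemma blockSum_replicate (f : List Q → ℕ) (j : ℕ) (s : List Q) :
    blockSum f (List.replicate j s) = j * f s := by simp [blockSum]

lemma link_eq_of_left_eq_right (hg : ∀ a b, D.cross a b = 0)
    (hlr : ∀ u v w, v ≠ w → D.left v w = D.right u v w) (x : Q) (l : List (List Q))
    (hl : ∀ s ∈ l, s.Nodup) : D.link x l = blockSum (pairSum D.left) l := by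
  induction l with
  | nil => simp [link, blockSum]
  | cons s l ih =>
    have ih := ih fun s hs => hl s (List.mem_cons_of_mem _ hs)
    have := pairSum_congr_of_nodup D.left (D.right x) (hlr x) s (hl s (by simp))
    simp only [link, ih, ← this, blockSum, List.map_cons, List.sum_cons]
    simp [show D.cross x = fun _ => 0 from funext (hg x)]

lemma count_eq_of_left_eq_right (hg : ∀ a b, D.cross a b = 0)
    (hlr : ∀ u v w, v ≠ w → D.left v w = D.right u v w) (l : List (List Q))
    (hl : ∀ s ∈ l, s.Nodup) :
    D.count l + blockSum (fun s => pairSum D.left s * s.length) l =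
      blockSum (pairSum D.left) l * size l + blockSum (tripleSum D.inner) l := by
  induction l with
  | nil => simp [count, blockSum]
  | cons s l ih =>
    have hl' : ∀ s ∈ l, s.Nodup := fun s hs => hl s (List.mem_cons_of_mem _ hs)
    have ih := ih hl'
    have h := fun x => D.link_eq_of_left_eq_right hg hlr x l hl'
    simp only [blockSum] at ih h ⊢
    simp only [count, h, List.map_cons, List.sum_cons, size_cons, List.map_const',
      List.sum_replicate, smul_eq_mul]
    nlinarith

lemma eq_of_linear_eq (m k γ d : ℤ) (x y x' y' : ℕ) (hm : 10000 * k ≤ m) (hd1 : 1 ≤ d)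
    (hd3 : d ≤ 3) (hx : x < k) (hx' : x' < k)
    (h : (m - 2) * (γ * x + y) - d * x = (m - 2) * (γ * x' + y') - d * x') : x = x' ∧ y = y' := by
  obtain ⟨A, hA⟩ : ∃ A : ℤ, A = (γ * x + y) - (γ * x' + y') := ⟨_, rfl⟩
  obtain ⟨B, hB⟩ : ∃ B : ℤ, B = x - x' := ⟨_, rfl⟩
  have e : (m - 2 : ℤ) * A = d * B := by
    rw [hA, hB]
    linear_combination h
  have B1 : d * B ≤ 3 * k := by nlinarith
  have B2 : -(3 * k) ≤ d * B := by nlinarith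
  have A0 : A = 0 := by
    rcases lt_trichotomy A 0 with hlt | h0 | hgt
    · nlinarith
    · exact h0
    · nlinarith
  rw [A0, mul_zero] at e
  have hB0 : B = 0 := by
    rcases mul_eq_zero.1 e.symm with h | h <;> omega
  have hx : x = x' := by omega
  subst hx
  exact ⟨rfl, by omega⟩

lemma abs_linear_le (m k γ d : ℤ) (x y : ℕ) (hm : 10000 * k ≤ m) (hk : 1 ≤ k) (hγ0 : 0 ≤ γ)
    (hγ : γ ≤ 3) (hd0 : 0 ≤ d) (hd3 : d ≤ 3) (hx : x < k) (hy : y < k) :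
    |(m - 2) * (γ * x + y) - d * x| ≤ m ^ 2 := by
  have s1 : γ * x + y ≤ 4 * k := by
    have : γ * x ≤ 3 * x := by gcongr
    linarith
  have s2 : 0 ≤ γ * x + y := by positivity
  have s3 : d * x ≤ 3 * k := by
    have : d * x ≤ 3 * x := by gcongr
    linarith
  have s4 : 0 ≤ d * x := by positivity
  have s5 : 0 ≤ (m - 2) * (γ * x + y) := mul_nonneg (by linarith) s2
  have s6 : (m - 2) * (γ * x + y) ≤ (m - 2) * (4 * k) :=
    mul_le_mul_of_nonneg_left s1 (by linarith)
  rw [abs_le]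
  constructor
  · nlinarith
  · nlinarith

lemma exists_attains_of_left_eq_right (hg : ∀ a b, D.cross a b = 0)
    (hlr : ∀ u v w, v ≠ w → D.left v w = D.right u v w)
    (m k : ℕ) (hk : 1 ≤ k) (hm : 10000 * k ≤ m) (hm2 : m < 20000 * k)
    (p q : Fin m → Q) (hp : p.Injective) (hq : q.Injective) (hpq : ∀ i j, p i ≠ q j)
    (hleft : ∀ i j, D.left (p i) (q j) = 1) :
    ∃ V : Finset ℤ, (∀ v ∈ V, D.Attains m v) ∧ m ^ 3 ≤ 20000 ^ 3 * V.card := by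
  obtain ⟨a, ha⟩ : ∃ a, a = p ⟨0, by omega⟩ := ⟨_, rfl⟩
  obtain ⟨a', ha'⟩ : ∃ a, a = p ⟨1, by omega⟩ := ⟨_, rfl⟩
  obtain ⟨b, hb⟩ : ∃ a, a = q ⟨0, by omega⟩ := ⟨_, rfl⟩
  have haa : a ≠ a' := by rw [ha, ha']; exact fun h => by simpa using hp h
  have hab : a ≠ b := by rw [ha, hb]; exact hpq _ _
  have hab' : a' ≠ b := by rw [ha', hb]; exact hpq _ _
  have g1 : D.left a b = 1 := by rw [ha, hb]; exact hleft _ _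
  have g2 : D.left a' b = 1 := by rw [ha', hb]; exact hleft _ _
  obtain ⟨γ, hγ⟩ : ∃ γ : ℕ, γ = D.left a a' + 2 := ⟨_, rfl⟩
  obtain ⟨ρ, hρ⟩ : ∃ ρ, ρ = D.inner a a' b := ⟨_, rfl⟩
  have hγ3 : γ ≤ 3 := by have := D.left_le a a'; omega
  have hρ1 : ρ ≤ 1 := hρ ▸ D.inner_le _ _ _
  obtain ⟨fine, hfd⟩ : ∃ fine : Fin k × Fin k → List (List Q), fine = fun i =>
    List.replicate i.1 [a, a', b] ++ (List.replicate i.2 [a, b] ++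
      List.replicate (5 * k - 3 * i.1 - 2 * i.2) [a]) := ⟨_, rfl⟩
  have hmem : ∀ i, ∀ s ∈ fine i, s.Nodup ∧ s.length ≤ 3 := by
    intro i s hs
    simp only [hfd, List.mem_append] at hs
    rcases hs with hs | hs | hs <;> rw [List.eq_of_mem_replicate hs] <;> simp [haa, hab, hab']
  have hsize : ∀ i, size (fine i) = 5 * k := by
    intro i
    have := i.1.2
    have := i.2.2
    simp [hfd]
    omega
  have hkm : (10000 * k : ℤ) ≤ m := by exact_mod_cast hm
  obtain ⟨i₀, hi₁, hi₂⟩ : ∃ i : Fin k × Fin k, (i.1 : ℕ) = 0 ∧ (i.2 : ℕ) = 0 :=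
    ⟨(⟨0, hk⟩, ⟨0, hk⟩), rfl, rfl⟩
  refine D.exists_attains_of_fine hg a m k (5 * k) hk hm hm2 le_rfl p q hp hq hpq hleft
    fine i₀
    (fun i => (m - 2 : ℤ) * (γ * (i.1 : ℕ) + (i.2 : ℕ)) - (γ - ρ) * (i.1 : ℕ)) ?_ ?_
    (by simp [sq]) hsize ?_ (fun i s hs => (hmem i s hs).1) (fun s hs => (hmem _ s hs).2) ?_
  · rintro ⟨x, y⟩ ⟨x', y'⟩ h
    have := eq_of_linear_eq m k γ (γ - ρ) x y x' y' (by linarith) (by omega) (by omega)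
      (by exact_mod_cast x.2) (by exact_mod_cast x'.2) h
    exact Prod.ext (Fin.ext this.1) (Fin.ext this.2)
  · rintro ⟨x, y⟩
    exact abs_linear_le m k γ (γ - ρ) x y (by linarith)
      (by exact_mod_cast hk) (by omega) (by omega) (by omega) (by omega)
      (by exact_mod_cast x.2) (by exact_mod_cast y.2)
  · intro i
    have := i.1.2
    have := i.2.2
    simp [hfd]
    omega
  · intro l hl hlm i
    have hn : ∀ i, ∀ s ∈ l ++ fine i, s.Nodup := by
      intro i s hs
      rcases List.mem_append.1 hs with hs | hs
      · exact hl s hs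
      · exact (hmem i s hs).1
    have hc := fun i => D.count_eq_of_left_eq_right hg hlr (l ++ fine i) (hn i)
    have h1 := hc i
    have h2 := hc i₀
    simp only [size_append, hsize, hlm] at h1 h2
    simp only [hfd, blockSum_append, blockSum_replicate, pairSum, tripleSum, List.map_cons,
      List.map_nil, List.sum_cons, List.sum_nil, List.length_cons, List.length_nil, g1, g2,
      ← hρ] at h1 h2 ⊢
    push_cast [← @Nat.cast_inj ℤ] at h1 h2
    have h3 : (γ : ℤ) = D.left a a' + 2 := by rw [hγ]; push_cast; rfl
    rw [h3]
    have z1 : ((i₀.1 : ℕ) : ℤ) = 0 := by exact_mod_cast hi₁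
    have z2 : ((i₀.2 : ℕ) : ℤ) = 0 := by exact_mod_cast hi₂
    rw [z1, z2] at h2
    linear_combination h1 - h2

end BlockPattern

/-- A dense relation between `P` and `W` contains all pairs between an `M`-element subset of `W`
and a large subset of `P`. -/
lemma exists_subset_of_dense {α β : Type*} [DecidableEq α] (P : Finset β) (W : Finset α)
    (r : β → α → Prop) [∀ p, DecidablePred (r p)] (d M : ℕ) (hd : 1 ≤ d) (hM : 1 ≤ M)
    (hW : 4 * M * d ≤ W.card)
    (h : P.card * W.card ≤ (∑ p ∈ P, (W.filter (r p)).card) * d) :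
    ∃ X ⊆ W, X.card = M ∧
      P.card ≤ (P.filter fun p => ∀ x ∈ X, r p x).card * (2 * d * (4 * d) ^ M) := by
  have hW0 : 0 < W.card := lt_of_lt_of_le (by positivity) hW
  set G := P.filter fun p => W.card ≤ (W.filter (r p)).card * (2 * d) with hG
  have hGcard : P.card ≤ 2 * d * G.card := by
    have h1 : ∑ p ∈ P, (W.filter (r p)).card * (2 * d) ≤
        ∑ p ∈ P, (W.card + if W.card ≤ (W.filter (r p)).card * (2 * d)
          then W.card * (2 * d) else 0) := by
      refine Finset.sum_le_sum fun p _ => ?_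
      split_ifs with hp
      · exact (Nat.mul_le_mul_right _ (Finset.card_filter_le _ _)).trans (Nat.le_add_left _ _)
      · omega
    rw [Finset.sum_add_distrib, ← Finset.sum_filter, Finset.sum_const, Finset.sum_const,
      ← Finset.sum_mul, smul_eq_mul, smul_eq_mul, ← hG] at h1
    have h2 : P.card * W.card ≤ 2 * d * G.card * W.card := by nlinarith
    exact Nat.le_of_mul_le_mul_right h2 hW0
  by_contra! hcon
  have hdc := Finset.sum_card_bipartiteAbove_eq_sum_card_bipartiteBelow
    (s := G) (t := W.powersetCard M) (fun p X => ∀ x ∈ X, r p x)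
  have hdeg : ∀ p ∈ G, (W.card).choose M ≤
      (Finset.bipartiteAbove (fun p X => ∀ x ∈ X, r p x) (W.powersetCard M) p).card *
        (4 * d) ^ M := by
    intro p hp
    have hp2 := (Finset.mem_filter.1 hp).2
    have h1 : ((W.filter (r p)).card).choose M ≤
        (Finset.bipartiteAbove (fun p X => ∀ x ∈ X, r p x) (W.powersetCard M) p).card := by
      rw [← Finset.card_powersetCard]
      refine Finset.card_le_card fun X hX => ?_
      rw [Finset.mem_powersetCard] at hX
      rw [Finset.mem_bipartiteAbove, Finset.mem_powersetCard]
      exact ⟨⟨hX.1.trans (Finset.filter_subset _ _), hX.2⟩,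
        fun x hx => (Finset.mem_filter.1 (hX.1 hx)).2⟩
    refine le_trans ?_ (Nat.mul_le_mul_right _ h1)
    have h2 := Nat.descFactorial_le_pow W.card M
    have h3 := Nat.pow_sub_le_descFactorial (W.filter (r p)).card M
    have h4 : W.card ^ M ≤ ((W.filter (r p)).card + 1 - M) ^ M * (4 * d) ^ M := by
      rw [← mul_pow]
      refine Nat.pow_le_pow_left ?_ M
      obtain ⟨q, hq⟩ | hlt : (∃ q, (W.filter (r p)).card + 1 = M + q) ∨
          (W.filter (r p)).card + 1 < M := by
        rcases le_or_gt M ((W.filter (r p)).card + 1) with h | h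
        · exact Or.inl (Nat.exists_eq_add_of_le h)
        · exact Or.inr h
      · rw [hq, Nat.add_sub_cancel_left]
        nlinarith
      · exfalso
        nlinarith
    rw [Nat.descFactorial_eq_factorial_mul_choose] at h2 h3
    have h5 : M.factorial * W.card.choose M ≤
        M.factorial * (((W.filter (r p)).card).choose M * (4 * d) ^ M) := by
      rw [← mul_assoc]
      exact h2.trans (h4.trans (Nat.mul_le_mul_right _ h3))
    exact Nat.le_of_mul_le_mul_left h5 (Nat.factorial_pos M)
  have h1 : G.card * W.card.choose M ≤
      (∑ p ∈ G, (Finset.bipartiteAbove (fun p X => ∀ x ∈ X, r p x) (W.powersetCard M) p).card) *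
        (4 * d) ^ M := by
    rw [Finset.sum_mul, ← smul_eq_mul, ← Finset.sum_const]
    exact Finset.sum_le_sum hdeg
  rw [hdc, Finset.sum_mul] at h1
  have hne : (W.powersetCard M).Nonempty :=
    Finset.powersetCard_nonempty.2 (by nlinarith)
  have h2 : ∑ X ∈ W.powersetCard M,
      (Finset.bipartiteBelow (fun p X => ∀ x ∈ X, r p x) G X).card * (4 * d) ^ M <
        ∑ X ∈ W.powersetCard M, G.card := by
    refine Finset.sum_lt_sum_of_nonempty hne fun X hX => ?_
    rw [Finset.mem_powersetCard] at hX
    have h3 := hcon X hX.1 hX.2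
    have h4 : (Finset.bipartiteBelow (fun p X => ∀ x ∈ X, r p x) G X).card ≤
        (P.filter fun p => ∀ x ∈ X, r p x).card := by
      refine Finset.card_le_card fun p hp => ?_
      rw [Finset.mem_bipartiteBelow] at hp
      exact Finset.mem_filter.2 ⟨(Finset.mem_filter.1 hp.1).1, hp.2⟩
    have h5 := Nat.mul_le_mul_right ((4 * d) ^ M) h4
    have h6 : 2 * d * ((Finset.bipartiteBelow (fun p X => ∀ x ∈ X, r p x) G X).card * (4 * d) ^ M) <
        2 * d * G.card := by
      nlinarith
    exact lt_of_mul_lt_mul_left h6 (Nat.zero_le _)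
  rw [Finset.sum_const, Finset.card_powersetCard, smul_eq_mul] at h2
  nlinarith

/-- If every `s`-subset of `W` contains a member of a family of triples, the family is dense. -/
lemma choose_three_le {α : Type*} [DecidableEq α] (E : Finset (Finset α))
    (hE : ∀ e ∈ E, e.card = 3) (s : ℕ) (hs : 3 ≤ s) (W : Finset α) (hW : s ≤ W.card)
    (h : ∀ S ⊆ W, S.card = s → ∃ e ∈ E, e ⊆ S) :
    W.card.choose 3 ≤ (E.filter fun e => e ⊆ W).card * s.choose 3 := by
  have h1 : (W.powersetCard s) ⊆ (E.filter fun e => e ⊆ W).biUnion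
      fun e => ((W \ e).powersetCard (s - 3)).image fun S => S ∪ e := by
    intro S hS
    rw [Finset.mem_powersetCard] at hS
    obtain ⟨e, he, heS⟩ := h S hS.1 hS.2
    simp only [Finset.mem_biUnion, Finset.mem_filter, Finset.mem_image, Finset.mem_powersetCard]
    refine ⟨e, ⟨he, heS.trans hS.1⟩, S \ e, ⟨Finset.sdiff_subset_sdiff hS.1 le_rfl, ?_⟩, ?_⟩
    · rw [Finset.card_sdiff_of_subset heS, hS.2, hE e he]
    · exact Finset.sdiff_union_of_subset heS
  have h2 := (Finset.card_le_card h1).trans (Finset.card_biUnion_le_card_mul _ _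
    ((W.card - 3).choose (s - 3)) (by
      intro e he
      rw [Finset.mem_filter] at he
      refine Finset.card_image_le.trans ?_
      rw [Finset.card_powersetCard, Finset.card_sdiff_of_subset he.2, hE e he.1]))
  rw [Finset.card_powersetCard] at h2
  have h3 := Nat.choose_mul (n := W.card) hs
  have h4 : 0 < (W.card - 3).choose (s - 3) := Nat.choose_pos (by omega)
  have h5 := Nat.mul_le_mul_right (s.choose 3) h2
  rw [h3] at h5
  refine Nat.le_of_mul_le_mul_right (h5.trans (le_of_eq ?_)) h4
  ring

lemma exists_tripartite_card {α : Type*} [DecidableEq α] (E : Finset (Finset α))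
    (hE : ∀ e ∈ E, e.card = 3) (s : ℕ) (hs : 8 ≤ s) (W : Finset α) (hW : s ≤ W.card)
    (h : ∀ S ⊆ W, S.card = s → ∃ e ∈ E, e ⊆ S) :
    (W ×ˢ W).card * W.card ≤
      (∑ p ∈ W ×ˢ W, (W.filter fun x => {x, p.1, p.2} ∈ E).card) * (8 * s ^ 3) := by
  have h1 := choose_three_le E hE s (by omega) W hW h
  have h2 : (E.filter fun e => e ⊆ W).card ≤
      ∑ p ∈ W ×ˢ W, (W.filter fun x => {x, p.1, p.2} ∈ E).card := by
    rw [← Finset.card_sigma]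
    refine Finset.card_le_card_of_surjOn
      (fun q : (_ : α × α) × α => ({q.2, q.1.1, q.1.2} : Finset α)) ?_
    intro e he
    have he := Finset.mem_filter.1 (Finset.mem_coe.1 he)
    obtain ⟨x, y, z, -, -, -, rfl⟩ := Finset.card_eq_three.1 (hE e he.1)
    have hx := he.2 (show x ∈ ({x, y, z} : Finset α) by simp)
    have hy := he.2 (show y ∈ ({x, y, z} : Finset α) by simp)
    have hz := he.2 (show z ∈ ({x, y, z} : Finset α) by simp)
    refine ⟨⟨(y, z), x⟩, ?_, rfl⟩
    simp [hx, hy, hz, he.1]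
  have h3 := Nat.mul_le_mul_right (s.choose 3) h2
  have h4 := Nat.descFactorial_le_pow s 3
  have h5 := Nat.pow_sub_le_descFactorial W.card 3
  rw [Nat.descFactorial_eq_factorial_mul_choose] at h4 h5
  have h6 : W.card ^ 3 ≤ 8 * (W.card + 1 - 3) ^ 3 := by
    obtain ⟨q, hq⟩ : ∃ q, W.card = q + 4 := ⟨W.card - 4, by omega⟩
    have : q + 4 + 1 - 3 = q + 2 := by omega
    rw [hq, this]
    have := Nat.pow_le_pow_left (show q + 4 ≤ 2 * (q + 2) by omega) 3
    rwa [mul_pow] at this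
  rw [Finset.card_product]
  set T := ∑ p ∈ W ×ˢ W, (W.filter fun x => {x, p.1, p.2} ∈ E).card
  have h7 : Nat.factorial 3 = 6 := rfl
  rw [h7] at h4 h5
  have h8 : T * (6 * s.choose 3) ≤ T * s ^ 3 := Nat.mul_le_mul_left _ h4
  nlinarith

/-- A family of triples which meets all `s`-subsets of a large set contains all triples between two
`M`-sets and a large third set. -/
lemma exists_complete_tripartite (M : ℕ) (hM : 1 ≤ M) : ∃ C : ℕ, 1 ≤ C ∧
    ∀ {α : Type} [DecidableEq α] (E : Finset (Finset α)) (_ : ∀ e ∈ E, e.card = 3) (s : ℕ)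
      (_ : 8 ≤ s) (_ : 4 * M ≤ s) (_ : ∀ S : Finset α, S.card = s → ∃ e ∈ E, e ⊆ S)
      (W : Finset α), s ^ C ≤ W.card →
      ∃ x y : Fin M → α, x.Injective ∧ y.Injective ∧ (∀ a, x a ∈ W) ∧ (∀ a, y a ∈ W) ∧
        ∃ T ⊆ W, W.card ≤ T.card * s ^ C ∧ ∀ a b, ∀ t ∈ T, {x a, y b, t} ∈ E := by
  refine ⟨(5 * M + 6) * (M + 1), by nlinarith, ?_⟩
  intro α _ E hE s hs hsM h W hW
  have hs1 : 1 ≤ s := by omega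
  have hsW : s ≤ W.card := (Nat.le_self_pow (by positivity) s).trans hW
  have hd := exists_tripartite_card E hE s hs W hsW fun S _ => h S
  obtain ⟨d, hdd⟩ : ∃ d, d = 8 * s ^ 3 := ⟨_, rfl⟩
  rw [← hdd] at hd
  obtain ⟨d', hdd'⟩ : ∃ d', d' = 2 * d * (4 * d) ^ M := ⟨_, rfl⟩
  have hd1 : 1 ≤ d := by rw [hdd]; exact Nat.one_le_iff_ne_zero.2 (by positivity)
  have hd1' : 1 ≤ d' := by rw [hdd']; exact Nat.one_le_iff_ne_zero.2 (by positivity)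
  have hd5 : 4 * d ≤ s ^ 5 := by
    have : 4 * 8 ≤ s * s := by nlinarith
    calc 4 * d = 4 * 8 * s ^ 3 := by rw [hdd]; ring
      _ ≤ s * s * s ^ 3 := Nat.mul_le_mul_right _ this
      _ = s ^ 5 := by ring
  have hdM : d' ≤ s ^ (5 * (M + 1)) := by
    calc d' ≤ 4 * d * (4 * d) ^ M := by rw [hdd']; exact Nat.mul_le_mul_right _ (by omega)
      _ = (4 * d) ^ (M + 1) := by ring
      _ ≤ (s ^ 5) ^ (M + 1) := Nat.pow_le_pow_left hd5 _
      _ = _ := by rw [pow_mul]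
  have hdM1 : s * d' ≤ s ^ (5 * M + 6) := by
    calc s * d' ≤ s * s ^ (5 * (M + 1)) := Nat.mul_le_mul_left _ hdM
      _ = _ := by ring
  have hbig : 4 * M * d' ≤ W.card := by
    calc 4 * M * d' ≤ s * d' := Nat.mul_le_mul_right _ hsM
      _ ≤ s ^ (5 * M + 6) := hdM1
      _ ≤ s ^ ((5 * M + 6) * (M + 1)) := Nat.pow_le_pow_right hs1 (by nlinarith)
      _ ≤ _ := hW
  have hdd1 : d ≤ d' := by
    rw [hdd']
    calc d ≤ 2 * d * 1 := by omega
      _ ≤ _ := Nat.mul_le_mul_left _ (Nat.one_le_iff_ne_zero.2 (by positivity))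
  obtain ⟨X, hXW, hX, hX2⟩ := exists_subset_of_dense (W ×ˢ W) W
    (fun p x => ({x, p.1, p.2} : Finset α) ∈ E) d M hd1 hM
    ((Nat.mul_le_mul_left _ hdd1).trans hbig) hd
  rw [← hdd'] at hX2
  have hpairs : ((W ×ˢ W).filter fun p => ∀ x ∈ X, ({x, p.1, p.2} : Finset α) ∈ E).card =
      ∑ z ∈ W, (W.filter fun y => ∀ x ∈ X, ({x, y, z} : Finset α) ∈ E).card := by
    rw [Finset.card_filter, Finset.sum_product_right]
    simp only [Finset.card_filter]
  obtain ⟨Y, hYW, hY, hY2⟩ := exists_subset_of_dense W W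
    (fun z y => ∀ x ∈ X, ({x, y, z} : Finset α) ∈ E) d' M hd1' hM hbig (by
      rw [← hpairs, ← Finset.card_product]
      exact hX2)
  refine ⟨fun a => (X.equivFinOfCardEq hX).symm a, fun a => (Y.equivFinOfCardEq hY).symm a,
    Subtype.val_injective.comp (Equiv.injective _),
    Subtype.val_injective.comp (Equiv.injective _),
    fun a => hXW (Subtype.prop _), fun a => hYW (Subtype.prop _),
    W.filter fun z => ∀ y ∈ Y, ∀ x ∈ X, ({x, y, z} : Finset α) ∈ E, Finset.filter_subset _ _,
    hY2.trans (Nat.mul_le_mul_left _ ?_), fun a b t ht =>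
      (Finset.mem_filter.1 ht).2 _ (Subtype.prop _) _ (Subtype.prop _)⟩
  calc 2 * d' * (4 * d') ^ M ≤ (4 * d') * (4 * d') ^ M := Nat.mul_le_mul_right _ (by omega)
    _ = (4 * d') ^ (M + 1) := by ring
    _ ≤ (s * d') ^ (M + 1) := Nat.pow_le_pow_left (Nat.mul_le_mul_right _ (by omega)) _
    _ ≤ (s ^ (5 * M + 6)) ^ (M + 1) := Nat.pow_le_pow_left hdM1 _
    _ = _ := by rw [pow_mul]

/-- A sequence of `L` disjoint blocks inside `W` in which the adjacency of a triple does not depend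
on its vertex in the last block, if this vertex lies in a later block than the other two. -/
structure IsChain3 {α : Type} [DecidableEq α] {M : ℕ} (E : Finset (Finset α)) (P W : Finset α)
    (L : ℕ) (φ : ℕ → Fin 4 × Fin M → α) : Prop where
  mem : ∀ i < L, ∀ a, φ i a ∈ W
  inj : ∀ i < L, ∀ j < L, ∀ a b, φ i a = φ j b → i = j ∧ a = b
  color : ∀ i < L, ∀ x, (x ∈ P ∨ ∃ j ≤ i, ∃ a, x = φ j a) → ∀ b, ∀ k < L, i < k → ∀ k' < L, i < k' →
    ∀ c c', {x, φ i b, φ k c} ∈ E → {x, φ i b, φ k' c'} ∈ E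
  edge : ∀ k < L, ∀ i < k, ∀ a b c, {φ i (0, a), φ i (1, b), φ k c} ∈ E
  nonedge : ∀ k < L, ∀ i < k, ∀ a b c, {φ i (2, a), φ i (3, b), φ k c} ∉ E

lemma ne_of_card_eq_three {α : Type} [DecidableEq α] {E : Finset (Finset α)}
    (hE : ∀ e ∈ E, e.card = 3) {x y z : α} (h : {x, y, z} ∈ E) : x ≠ y ∧ x ≠ z ∧ y ≠ z := by
  have h3 := hE _ h
  refine ⟨?_, ?_, ?_⟩ <;> rintro rfl
  · have := Finset.card_le_two (a := x) (b := z)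
    rw [Finset.insert_eq_of_mem (by simp)] at h3
    omega
  · have := Finset.card_le_two (a := y) (b := x)
    rw [Finset.insert_eq_of_mem (by simp)] at h3
    omega
  · have := Finset.card_le_two (a := x) (b := y)
    rw [Finset.pair_eq_singleton] at h3
    have := Finset.card_le_two (a := x) (b := y)
    omega

/-- One block of a chain, together with a large set of candidates for the later vertices. -/
lemma exists_block (M : ℕ) (hM : 1 ≤ M) (p : ℕ) : ∃ K : ℕ, ∀ (C : ℕ) {α : Type} [DecidableEq α]
    (E E' : Finset (Finset α)) (_ : ∀ e ∈ E, e.card = 3) (_ : ∀ e ∈ E', e.card = 3)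
    (_ : Disjoint E E') (s : ℕ) (_ : 8 ≤ s) (_ : 4 * M ≤ s)
    (_ : ∀ S : Finset α, S.card = s → ∃ e ∈ E, e ⊆ S)
    (_ : ∀ S : Finset α, S.card = s → ∃ e ∈ E', e ⊆ S) (P W : Finset α), P.card ≤ p →
    s ^ (K + C) ≤ W.card →
    ∃ (b : Fin 4 × Fin M → α) (T : Finset α), b.Injective ∧ (∀ a, b a ∈ W) ∧ T ⊆ W ∧
      (∀ a, b a ∉ T) ∧ s ^ C ≤ T.card ∧
      (∀ x, (x ∈ P ∨ ∃ a, x = b a) → ∀ a, ∀ t ∈ T, ∀ t' ∈ T, {x, b a, t} ∈ E → {x, b a, t'} ∈ E) ∧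
      (∀ a a', ∀ t ∈ T, {b (0, a), b (1, a'), t} ∈ E) ∧
      ∀ a a', ∀ t ∈ T, {b (2, a), b (3, a'), t} ∉ E := by
  obtain ⟨K, hK1, hK⟩ := exists_complete_tripartite M hM
  refine ⟨K + K + (p + 4 * M) * (4 * M), ?_⟩
  intro C α _ E E' hE hE' hdis s hs hsM h1 h0 P W hP hW
  have hs1 : 1 ≤ s := by omega
  have hsp : ∀ j, 0 < s ^ j := fun j => by positivity
  obtain ⟨A, hA⟩ : ∃ A, A = (p + 4 * M) * (4 * M) := ⟨_, rfl⟩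
  rw [← hA] at hW
  obtain ⟨x, y, hx, hy, hxW, hyW, T₁, hT₁W, hT₁, hxy⟩ := hK E hE s hs hsM h1 W
    ((Nat.pow_le_pow_right hs1 (by omega)).trans hW)
  have hT₁' : s ^ (K + A + C) ≤ T₁.card := by
    refine Nat.le_of_mul_le_mul_right ?_ (hsp K)
    rw [← pow_add]
    exact (Nat.pow_le_pow_right hs1 (by omega)).trans (hW.trans hT₁)
  obtain ⟨z, w, hz, hw, hzT, hwT, T₂, hT₂T, hT₂, hzw⟩ := hK E' hE' s hs hsM h0 T₁
    ((Nat.pow_le_pow_right hs1 (by omega)).trans hT₁')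
  have hT₂' : s ^ (A + C) ≤ T₂.card := by
    refine Nat.le_of_mul_le_mul_right ?_ (hsp K)
    rw [← pow_add]
    exact (Nat.pow_le_pow_right hs1 (by omega)).trans (hT₁'.trans hT₂)
  obtain ⟨t₀, ht₀⟩ : T₂.Nonempty := Finset.card_pos.1 (lt_of_lt_of_le (hsp _) hT₂')
  have n1 : ∀ a b, x a ≠ y b := fun a b => (ne_of_card_eq_three hE (hxy a b t₀ (hT₂T ht₀))).1
  have n2 : ∀ a b, z a ≠ w b := fun a b => (ne_of_card_eq_three hE' (hzw a b t₀ ht₀)).1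
  have n3 : ∀ a, x a ∉ T₁ := fun a h => (ne_of_card_eq_three hE (hxy a a _ h)).2.1 rfl
  have n4 : ∀ a, y a ∉ T₁ := fun a h => (ne_of_card_eq_three hE (hxy a a _ h)).2.2 rfl
  have n5 : ∀ a, z a ∉ T₂ := fun a h => (ne_of_card_eq_three hE' (hzw a a _ h)).2.1 rfl
  have n6 : ∀ a, w a ∉ T₂ := fun a h => (ne_of_card_eq_three hE' (hzw a a _ h)).2.2 rfl
  have n7 : ∀ a b, x a ≠ z b := fun a b h => n3 a (h ▸ hzT b)
  have n8 : ∀ a b, x a ≠ w b := fun a b h => n3 a (h ▸ hwT b)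
  have n9 : ∀ a b, y a ≠ z b := fun a b h => n4 a (h ▸ hzT b)
  have n10 : ∀ a b, y a ≠ w b := fun a b h => n4 a (h ▸ hwT b)
  obtain ⟨b, hb⟩ : ∃ b : Fin 4 × Fin M → α, b = fun a => ![x, y, z, w] a.1 a.2 := ⟨_, rfl⟩
  have hb0 : ∀ a, b (0, a) = x a := fun a => by rw [hb]; rfl
  have hb1 : ∀ a, b (1, a) = y a := fun a => by rw [hb]; rfl
  have hb2 : ∀ a, b (2, a) = z a := fun a => by rw [hb]; rfl
  have hb3 : ∀ a, b (3, a) = w a := fun a => by rw [hb]; rfl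
  have hbW : ∀ a, b a ∈ W := by
    rintro ⟨i, a⟩
    fin_cases i
    · exact (hb0 a).symm ▸ hxW a
    · exact (hb1 a).symm ▸ hyW a
    · exact (hb2 a).symm ▸ hT₁W (hzT a)
    · exact (hb3 a).symm ▸ hT₁W (hwT a)
  have hbT : ∀ a, b a ∉ T₂ := by
    rintro ⟨i, a⟩
    fin_cases i
    · exact (hb0 a).symm ▸ fun h => n3 a (hT₂T h)
    · exact (hb1 a).symm ▸ fun h => n4 a (hT₂T h)
    · exact (hb2 a).symm ▸ n5 a
    · exact (hb3 a).symm ▸ n6 a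
  have hbinj : b.Injective := by
    rintro ⟨i, a⟩ ⟨j, a'⟩ h
    fin_cases i <;> fin_cases j <;>
      simp only [Fin.zero_eta, Fin.mk_one, Fin.reduceFinMk, hb0, hb1, hb2, hb3] at h
    · rw [hx h]
    · exact (n1 _ _ h).elim
    · exact (n7 _ _ h).elim
    · exact (n8 _ _ h).elim
    · exact (n1 _ _ h.symm).elim
    · rw [hy h]
    · exact (n9 _ _ h).elim
    · exact (n10 _ _ h).elim
    · exact (n7 _ _ h.symm).elim
    · exact (n9 _ _ h.symm).elim
    · rw [hz h]
    · exact (n2 _ _ h).elim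
    · exact (n8 _ _ h.symm).elim
    · exact (n10 _ _ h.symm).elim
    · exact (n2 _ _ h.symm).elim
    · rw [hw h]
  obtain ⟨U, hU⟩ : ∃ U, U = P ∪ Finset.univ.image b := ⟨_, rfl⟩
  have hUc : U.card ≤ p + 4 * M := by
    rw [hU]
    refine (Finset.card_union_le _ _).trans (Nat.add_le_add hP (Finset.card_image_le.trans ?_))
    simp
  obtain ⟨col, hcol⟩ : ∃ col : α → Finset (α × (Fin 4 × Fin M)), col = fun t =>
      (U ×ˢ Finset.univ).filter fun q => {q.1, b q.2, t} ∈ E := ⟨_, rfl⟩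
  obtain ⟨c, -, hc⟩ := Finset.exists_le_card_fiber_of_mul_le_card_of_maps_to
    (s := T₂) (t := (U ×ˢ (Finset.univ : Finset (Fin 4 × Fin M))).powerset) (f := col)
    (n := s ^ C) (by
      intro t _
      rw [hcol]
      exact Finset.mem_powerset.2 (Finset.filter_subset _ _)) ⟨∅, by simp⟩ (by
      refine le_trans ?_ hT₂'
      rw [pow_add, Finset.card_powerset]
      refine Nat.mul_le_mul_right _ ?_
      calc 2 ^ (U ×ˢ (Finset.univ : Finset (Fin 4 × Fin M))).card ≤ 2 ^ A := by
            refine Nat.pow_le_pow_right (by norm_num) ?_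
            rw [Finset.card_product, hA]
            exact Nat.mul_le_mul hUc (by simp)
        _ ≤ s ^ A := Nat.pow_le_pow_left (by omega) _)
  refine ⟨b, T₂.filter fun t => col t = c, hbinj, hbW,
    (Finset.filter_subset _ _).trans (hT₂T.trans hT₁W),
    fun a h => hbT a (Finset.mem_filter.1 h).1, hc, ?_, ?_, ?_⟩
  · intro u hu a t ht t' ht' h
    have e : col t = col t' := (Finset.mem_filter.1 ht).2.trans (Finset.mem_filter.1 ht').2.symm
    have hu' : u ∈ U := by
      rw [hU, Finset.mem_union, Finset.mem_image]
      exact hu.imp id fun ⟨a, ha⟩ => ⟨a, Finset.mem_univ _, ha.symm⟩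
    have : (u, a) ∈ col t := by
      rw [hcol]
      simp [hu', h]
    rw [e, hcol] at this
    exact (Finset.mem_filter.1 this).2
  · intro a a' t ht
    rw [hb0, hb1]
    exact hxy a a' t (hT₂T (Finset.mem_filter.1 ht).1)
  · intro a a' t ht h
    rw [hb2, hb3] at h
    exact Finset.disjoint_left.1 hdis h (hzw a a' t (Finset.mem_filter.1 ht).1)

lemma exists_isChain3 (M : ℕ) (hM : 1 ≤ M) (L : ℕ) : ∀ p : ℕ, ∃ C : ℕ, ∀ {α : Type}
    [DecidableEq α] (E E' : Finset (Finset α)) (_ : ∀ e ∈ E, e.card = 3)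
    (_ : ∀ e ∈ E', e.card = 3)
    (_ : Disjoint E E') (s : ℕ) (_ : 8 ≤ s) (_ : 4 * M ≤ s)
    (_ : ∀ S : Finset α, S.card = s → ∃ e ∈ E, e ⊆ S)
    (_ : ∀ S : Finset α, S.card = s → ∃ e ∈ E', e ⊆ S) (P W : Finset α), P.card ≤ p →
    s ^ C ≤ W.card → ∃ φ : ℕ → Fin 4 × Fin M → α, IsChain3 E P W L φ := by
  induction L with
  | zero =>
    intro p
    refine ⟨0, ?_⟩
    intro α _ E E' _ _ _ s _ _ _ _ P W _ hW
    obtain ⟨w, -⟩ : W.Nonempty := Finset.card_pos.1 (lt_of_lt_of_le (by simp) hW)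
    exact ⟨fun _ _ => w, by simp, by simp, by simp, by simp, by simp⟩
  | succ L ih =>
    intro p
    obtain ⟨K, hK⟩ := exists_block M hM p
    obtain ⟨C, hC⟩ := ih (p + 4 * M)
    refine ⟨K + C, ?_⟩
    intro α _ E E' hE hE' hdis s hs hsM h1 h0 P W hP hW
    obtain ⟨b, T, hb, hbW, hTW, hbT, hT, hcol, he, hne⟩ :=
      hK C E E' hE hE' hdis s hs hsM h1 h0 P W hP hW
    obtain ⟨φ, hφ⟩ := hC E E' hE hE' hdis s hs hsM h1 h0 (P ∪ Finset.univ.image b) T (by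
      refine (Finset.card_union_le _ _).trans (Nat.add_le_add hP (Finset.card_image_le.trans ?_))
      simp) hT
    refine ⟨fun i => Nat.casesOn i b φ, ?_, ?_, ?_, ?_, ?_⟩
    · rintro (_ | i) hi a
      · exact hbW a
      · exact hTW (hφ.mem i (by omega) a)
    · rintro (_ | i) hi (_ | j) hj a a' h
      · exact ⟨rfl, hb h⟩
      · have h' : b a = φ j a' := h
        exact (hbT a (h'.symm ▸ hφ.mem j (by omega) a')).elim
      · have h' : φ i a = b a' := h
        exact (hbT a' (h' ▸ hφ.mem i (by omega) a)).elim
      · have := hφ.inj i (by omega) j (by omega) a a' h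
        exact ⟨by omega, this.2⟩
    · rintro (_ | i) hi x hx a (_ | k) hk hik (_ | k') hk' hik' c c' h
      · omega
      · omega
      · omega
      · refine hcol x ?_ a _ (hφ.mem k (by omega) c) _ (hφ.mem k' (by omega) c') h
        refine hx.imp id ?_
        rintro ⟨j, hj, a, rfl⟩
        obtain rfl : j = 0 := by omega
        exact ⟨a, rfl⟩
      · omega
      · omega
      · omega
      · refine hφ.color i (by omega) x ?_ a k (by omega) (by omega) k' (by omega) (by omega) c c' h
        rcases hx with hx | ⟨_ | j, hj, a, rfl⟩
        · exact Or.inl (Finset.mem_union_left _ hx)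
        · exact Or.inl (Finset.mem_union_right _ (Finset.mem_image_of_mem _ (Finset.mem_univ _)))
        · exact Or.inr ⟨j, by omega, a, rfl⟩
    · rintro (_ | k) hk (_ | i) hi a a' c
      · omega
      · omega
      · exact he a a' _ (hφ.mem k (by omega) c)
      · exact hφ.edge k (by omega) i (by omega) a a' c
    · rintro (_ | k) hk (_ | i) hi a a' c
      · omega
      · omega
      · exact hne a a' _ (hφ.mem k (by omega) c)
      · exact hφ.nonedge k (by omega) i (by omega) a a' c

lemma exists_monochromatic_list_aux {κ : Type} [Fintype κ] [DecidableEq κ] [Nonempty κ] (t : ℕ) :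
    ∃ N : ℕ, ∀ (col : ℕ → ℕ → κ) (S : Finset ℕ), N ≤ S.card → ∀ r : κ → ℕ, ∑ c, r c ≤ t →
      ∃ c, ∃ l : List ℕ, (∀ x ∈ l, x ∈ S) ∧ l.Pairwise (fun x y => x < y ∧ col x y = c) ∧
        r c ≤ l.length := by
  induction t with
  | zero =>
    refine ⟨0, fun col S _ r hr => ⟨Classical.arbitrary κ, [], by simp, by simp, ?_⟩⟩
    exact (Finset.single_le_sum (fun i _ => Nat.zero_le (r i)) (Finset.mem_univ _)).trans hr
  | succ t ih =>
    obtain ⟨N, hN⟩ := ih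
    refine ⟨Fintype.card κ * N + 1, fun col S hS r hr => ?_⟩
    have hne : S.Nonempty := Finset.card_pos.1 (by omega)
    obtain ⟨c, -, hc⟩ := Finset.exists_le_card_fiber_of_mul_le_card_of_maps_to
      (s := S.erase (S.min' hne)) (t := (Finset.univ : Finset κ)) (f := col (S.min' hne)) (n := N)
      (fun _ _ => Finset.mem_univ _) Finset.univ_nonempty (by
        rw [Finset.card_erase_of_mem (S.min'_mem hne), Finset.card_univ]
        omega)
    rcases Nat.eq_zero_or_pos (r c) with h0 | h0
    · exact ⟨c, [], by simp, by simp, by simp [h0]⟩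
    obtain ⟨c', l, h1, h2, h3⟩ := hN col _ hc (Function.update r c (r c - 1)) (by
      refine Nat.le_of_lt_succ (lt_of_lt_of_le ?_ hr)
      refine Finset.sum_lt_sum (fun i _ => ?_) ⟨c, Finset.mem_univ _, by simp [h0]⟩
      by_cases h : i = c
      · subst h; simp
      · simp [h])
    have h4 : ∀ x ∈ l, x ∈ S := fun x hx =>
      Finset.mem_of_mem_erase (Finset.mem_filter.1 (h1 x hx)).1
    by_cases h : c' = c
    · subst h
      refine ⟨c', S.min' hne :: l, ?_, ?_, ?_⟩
      · simpa using ⟨S.min'_mem hne, h4⟩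
      · refine List.pairwise_cons.2 ⟨fun y hy => ⟨?_, (Finset.mem_filter.1 (h1 y hy)).2⟩, h2⟩
        exact Finset.min'_lt_of_mem_erase_min' S hne (Finset.mem_filter.1 (h1 y hy)).1
      · simp only [Function.update_self] at h3
        simp only [List.length_cons]
        omega
    · exact ⟨c', l, h4, h2, by simpa [h] using h3⟩

/-- Ramsey's theorem for pairs. -/
lemma exists_monochromatic (κ : Type) [Finite κ] [Nonempty κ] (T : ℕ) :
    ∃ N : ℕ, ∀ col : ℕ → ℕ → κ, ∃ c, ∃ f : ℕ → ℕ, (∀ i < T, f i < N) ∧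
      ∀ i j, i < j → j < T → f i < f j ∧ col (f i) (f j) = c := by
  classical
  obtain ⟨_⟩ := nonempty_fintype κ
  obtain ⟨N, hN⟩ := exists_monochromatic_list_aux (κ := κ) (Fintype.card κ * T)
  refine ⟨N, fun col => ?_⟩
  obtain ⟨c, l, h1, h2, h3⟩ := hN col (Finset.range N) (by simp) (fun _ => T) (by simp)
  refine ⟨c, fun i => l.getD i 0, fun i hi => ?_, fun i j hij hj => ?_⟩
  · beta_reduce
    rw [List.getD_eq_getElem l 0 (by omega : i < l.length)]
    exact Finset.mem_range.1 (h1 _ (List.getElem_mem _))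
  · beta_reduce
    rw [List.getD_eq_getElem l 0 (by omega : i < l.length),
      List.getD_eq_getElem l 0 (by omega : j < l.length)]
    exact List.pairwise_iff_getElem.1 h2 i j _ _ hij

lemma pairSum_append {α : Type*} (f : α → α → ℕ) (s t : List α) :
    pairSum f (s ++ t) = pairSum f s + (s.map fun x => (t.map (f x)).sum).sum + pairSum f t := by
  induction s with
  | nil => simp [pairSum]
  | cons x s ih =>
    simp only [List.cons_append, pairSum, ih, List.map_append, List.sum_append, List.map_cons,
      List.sum_cons]
    ring

lemma tripleSum_append {α : Type*} (T : α → α → α → ℕ) (s t : List α) :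
    tripleSum T (s ++ t) = tripleSum T s + pairSum (fun x y => (t.map (T x y)).sum) s +
      (s.map fun x => pairSum (T x) t).sum + tripleSum T t := by
  induction s with
  | nil => simp [tripleSum, pairSum]
  | cons x s ih =>
    simp only [List.cons_append, tripleSum, pairSum, ih, pairSum_append, List.map_cons,
      List.sum_cons]
    ring

lemma pairSum_map {α β : Type*} (f : β → β → ℕ) (g : α → β) (s : List α) :
    pairSum f (s.map g) = pairSum (fun x y => f (g x) (g y)) s := by
  induction s with
  | nil => rfl
  | cons x s ih => simp only [List.map_cons, pairSum, ih, List.map_map, Function.comp_def]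

lemma tripleSum_map {α β : Type*} (T : β → β → β → ℕ) (g : α → β) (s : List α) :
    tripleSum T (s.map g) = tripleSum (fun x y z => T (g x) (g y) (g z)) s := by
  induction s with
  | nil => rfl
  | cons x s ih => simp only [List.map_cons, tripleSum, ih, pairSum_map]

lemma pairSum_mul_right {α : Type*} (f : α → α → ℕ) (c : ℕ) (s : List α) :
    pairSum (fun x y => f x y * c) s = pairSum f s * c := by
  induction s with
  | nil => simp [pairSum]
  | cons x s ih => simp only [pairSum, ih, List.sum_map_mul_right, add_mul]

section edges

variable {α : Type} [DecidableEq α]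

/-- The indicator of `{x, y, z}` being an edge. -/
def edgeInd (E : Finset (Finset α)) (x y z : α) : ℕ := if {x, y, z} ∈ E then 1 else 0

/-- The number of edges that contain `D` and are contained in `D ∪ S`. -/
def edgesOver (E : Finset (Finset α)) (D S : Finset α) : ℕ :=
  (E.filter fun e => D ⊆ e ∧ e ⊆ D ∪ S).card

lemma edgesOver_insert (E : Finset (Finset α)) (D S : Finset α) (x : α) (hD : x ∉ D)
    (hS : x ∉ S) : edgesOver E D (insert x S) = edgesOver E (insert x D) S + edgesOver E D S := by
  rw [edgesOver, ← Finset.card_filter_add_card_filter_not (fun e => x ∈ e), edgesOver, edgesOver,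
    Finset.filter_filter, Finset.filter_filter]
  congr 2
  · ext e
    simp only [Finset.mem_filter, Finset.insert_subset_iff, Finset.insert_union,
      Finset.union_insert]
    tauto
  · ext e
    simp only [Finset.mem_filter, Finset.union_insert]
    refine and_congr_right fun _ => ⟨?_, ?_⟩
    · rintro ⟨⟨h1, h2⟩, h3⟩
      exact ⟨h1, (Finset.subset_insert_iff_of_notMem h3).1 h2⟩
    · rintro ⟨h1, h2⟩
      refine ⟨⟨h1, h2.trans (Finset.subset_insert _ _)⟩, fun h => ?_⟩
      rcases Finset.mem_union.1 (h2 h) with h | h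
      · exact hD h
      · exact hS h

variable {E : Finset (Finset α)} (hE : ∀ e ∈ E, e.card = 3)
include hE

lemma edgesOver_empty (D : Finset α) (hD : D.card ≠ 3) : edgesOver E D ∅ = 0 := by
  rw [edgesOver, Finset.card_eq_zero, Finset.filter_eq_empty_iff]
  rintro e he ⟨h1, h2⟩
  rw [Finset.union_empty] at h2
  exact hD ((h1.antisymm h2) ▸ hE e he)

lemma edgesOver_of_card_eq_three (D S : Finset α) (hD : D.card = 3) :
    edgesOver E D S = if D ∈ E then 1 else 0 := by
  have : ∀ e ∈ E, (D ⊆ e ∧ e ⊆ D ∪ S) ↔ D = e := by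
    refine fun e he => ⟨fun h => Finset.eq_of_subset_of_card_le h.1 (by rw [hE e he, hD]), ?_⟩
    rintro rfl
    exact ⟨subset_rfl, Finset.subset_union_left⟩
  rw [edgesOver, Finset.filter_congr this, Finset.filter_eq]
  split_ifs <;> simp

lemma edgesOver_pair (x y : α) (hxy : x ≠ y) (l : List α) (hl : l.Nodup) (hx : x ∉ l)
    (hy : y ∉ l) : edgesOver E {x, y} l.toFinset = (l.map (edgeInd E x y)).sum := by
  induction l with
  | nil =>
    rw [List.toFinset_nil, edgesOver_empty hE]
    · rfl
    · rw [Finset.card_pair hxy]; norm_num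
  | cons z l ih =>
    rw [List.nodup_cons] at hl
    simp only [List.mem_cons, not_or] at hx hy
    have e : ({z, x, y} : Finset α) = {x, y, z} := by ext; simp; tauto
    rw [List.toFinset_cons, edgesOver_insert _ _ _ _ (by simp; tauto) (by simpa using hl.1),
      ih hl.2 hx.2 hy.2, edgesOver_of_card_eq_three hE, e, List.map_cons, List.sum_cons, edgeInd]
    exact Finset.card_eq_three.2 ⟨z, x, y, Ne.symm hx.1, Ne.symm hy.1, hxy, rfl⟩

lemma edgesOver_singleton (x : α) (l : List α) (hl : l.Nodup) (hx : x ∉ l) :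
    edgesOver E {x} l.toFinset = pairSum (edgeInd E x) l := by
  induction l with
  | nil => rw [List.toFinset_nil, edgesOver_empty hE _ (by simp)]; rfl
  | cons y l ih =>
    rw [List.nodup_cons] at hl
    simp only [List.mem_cons, not_or] at hx
    rw [List.toFinset_cons, edgesOver_insert _ _ _ _ (by simpa using Ne.symm hx.1)
      (by simpa using hl.1), ih hl.2 hx.2, Finset.pair_comm, edgesOver_pair hE x y hx.1 l hl.2 hx.2
      hl.1, pairSum]

lemma card_filter_subset_toFinset (l : List α) (hl : l.Nodup) :
    (E.filter fun e => e ⊆ l.toFinset).card = tripleSum (edgeInd E) l := by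
  have key : ∀ S : Finset α, (E.filter fun e => e ⊆ S).card = edgesOver E ∅ S := by
    simp [edgesOver]
  rw [key]
  induction l with
  | nil => rw [List.toFinset_nil, edgesOver_empty hE _ (by simp)]; rfl
  | cons x l ih =>
    rw [List.nodup_cons] at hl
    rw [List.toFinset_cons, edgesOver_insert _ _ _ _ (by simp) (by simpa using hl.1), ih hl.2,
      insert_empty_eq, edgesOver_singleton hE x l hl.2 hl.1, tripleSum]

end edges

/-- A sequence of `L` disjoint blocks whose edges follow the pattern `D`. -/
structure IsPatternChain {α Q : Type} [DecidableEq α] (D : BlockPattern Q)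
    (E : Finset (Finset α)) (L : ℕ) (ψ : ℕ → Q → α) : Prop where
  inj : ∀ i < L, ∀ j < L, ∀ a b, ψ i a = ψ j b → i = j ∧ a = b
  inner : ∀ i < L, ∀ a b c, edgeInd E (ψ i a) (ψ i b) (ψ i c) = D.inner a b c
  left : ∀ j < L, ∀ i < j, ∀ a b c, edgeInd E (ψ i a) (ψ i b) (ψ j c) = D.left a b
  right : ∀ j < L, ∀ i < j, ∀ a b c, edgeInd E (ψ i a) (ψ j b) (ψ j c) = D.right a b c
  cross : ∀ k < L, ∀ j < k, ∀ i < j, ∀ a b c, edgeInd E (ψ i a) (ψ j b) (ψ k c) = D.cross a b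

/-- The vertices of a sequence of blocks which is placed from position `i` on. -/
def placeBlocks {α Q : Type} (ψ : ℕ → Q → α) : ℕ → List (List Q) → List α
  | _, [] => []
  | i, s :: l => s.map (ψ i) ++ placeBlocks ψ (i + 1) l

section placeBlocks

variable {α Q : Type} (ψ : ℕ → Q → α)

lemma length_placeBlocks (i : ℕ) (l : List (List Q)) :
    (placeBlocks ψ i l).length = BlockPattern.size l := by
  induction l generalizing i with
  | nil => rfl
  | cons s l ih => simp [placeBlocks, ih]

lemma exists_of_mem_placeBlocks (i : ℕ) (l : List (List Q)) (x : α)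
    (hx : x ∈ placeBlocks ψ i l) : ∃ j a, i ≤ j ∧ j < i + l.length ∧ x = ψ j a := by
  induction l generalizing i with
  | nil => simp [placeBlocks] at hx
  | cons s l ih =>
    rw [placeBlocks, List.mem_append, List.mem_map] at hx
    rcases hx with ⟨a, -, rfl⟩ | hx
    · exact ⟨i, a, le_rfl, by simp, rfl⟩
    · obtain ⟨j, a, h1, h2, h3⟩ := ih (i + 1) hx
      exact ⟨j, a, by omega, by simp only [List.length_cons]; omega, h3⟩

lemma sum_map_eq_length_mul {β : Type*} (f : β → ℕ) (c : ℕ) (l : List β)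
    (h : ∀ x ∈ l, f x = c) : (l.map f).sum = c * l.length := by
  rw [List.map_congr_left h, List.map_const', List.sum_replicate, smul_eq_mul, mul_comm]

end placeBlocks

namespace IsPatternChain

variable {α Q : Type} [DecidableEq α] {D : BlockPattern Q} {E : Finset (Finset α)} {L : ℕ}
  {ψ : ℕ → Q → α} (h : IsPatternChain D E L ψ)
include h

lemma nodup_placeBlocks (l : List (List Q)) (hl : ∀ s ∈ l, s.Nodup) (i : ℕ)
    (hi : i + l.length ≤ L) : (placeBlocks ψ i l).Nodup := by
  induction l generalizing i with
  | nil => simp [placeBlocks]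
  | cons s l ih =>
    simp only [List.length_cons] at hi
    rw [placeBlocks, List.nodup_append]
    refine ⟨(List.nodup_map_iff fun a b hab => (h.inj i (by omega) i (by omega) a b hab).2).2
      (hl s (by simp)), ih (fun t ht => hl t (by simp [ht])) (i + 1) (by omega), ?_⟩
    rintro x hx y hy rfl
    obtain ⟨a, -, rfl⟩ := List.mem_map.1 hx
    obtain ⟨j, b, h1, h2, h3⟩ := exists_of_mem_placeBlocks ψ _ _ _ hy
    have := (h.inj i (by omega) j (by omega) a b h3).1
    omega

lemma pairSum_placeBlocks (i : ℕ) (u : Q) (l : List (List Q)) (j : ℕ) (hij : i < j)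
    (hj : j + l.length ≤ L) :
    pairSum (edgeInd E (ψ i u)) (placeBlocks ψ j l) = D.link u l := by
  induction l generalizing j with
  | nil => rfl
  | cons s l ih =>
    simp only [List.length_cons] at hj
    rw [placeBlocks, pairSum_append, pairSum_map, ih (j + 1) (by omega) (by omega),
      BlockPattern.link]
    simp only [h.right j (by omega) i hij]
    congr 2
    rw [List.map_map, ← List.sum_map_mul_right]
    congr 1
    refine List.map_congr_left fun a _ => ?_
    rw [Function.comp_apply, ← length_placeBlocks ψ (j + 1)]
    refine sum_map_eq_length_mul _ _ _ fun x hx => ?_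
    obtain ⟨k, c, h1, h2, rfl⟩ := exists_of_mem_placeBlocks ψ _ _ _ hx
    exact h.cross k (by omega) j (by omega) i hij u a c

lemma tripleSum_placeBlocks (l : List (List Q)) (i : ℕ) (hi : i + l.length ≤ L) :
    tripleSum (edgeInd E) (placeBlocks ψ i l) = D.count l := by
  induction l generalizing i with
  | nil => rfl
  | cons s l ih =>
    simp only [List.length_cons] at hi
    rw [placeBlocks, tripleSum_append, tripleSum_map, ih (i + 1) (by omega), BlockPattern.count,
      List.map_map, pairSum_map]
    simp only [h.inner i (by omega)]
    have e1 : (fun a b => ((placeBlocks ψ (i + 1) l).map (edgeInd E (ψ i a) (ψ i b))).sum) =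
        fun a b => D.left a b * BlockPattern.size l := by
      funext a b
      rw [← length_placeBlocks ψ (i + 1)]
      refine sum_map_eq_length_mul _ _ _ fun x hx => ?_
      obtain ⟨k, c, h1, h2, rfl⟩ := exists_of_mem_placeBlocks ψ _ _ _ hx
      exact h.left k (by omega) i (by omega) a b c
    have e2 : ((fun x => pairSum (edgeInd E x) (placeBlocks ψ (i + 1) l)) ∘ ψ i) =
        fun u => D.link u l := by
      funext u
      exact h.pairSum_placeBlocks i u l (i + 1) (by omega) (by omega)
    rw [e1, e2, pairSum_mul_right]

lemma exists_of_attains (hE : ∀ e ∈ E, e.card = 3) (m : ℕ) (hm : m + 1 ≤ L) (v : ℤ)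
    (hv : D.Attains m v) :
    ∃ S : Finset α, S.card = m ∧ ((E.filter fun e => e ⊆ S).card : ℤ) = v := by
  obtain ⟨l, h1, h2, h3, h4⟩ := hv
  have hn := h.nodup_placeBlocks l h3 0 (by omega)
  refine ⟨(placeBlocks ψ 0 l).toFinset, ?_, ?_⟩
  · rw [List.toFinset_card_of_nodup hn, length_placeBlocks, h1]
  · rw [card_filter_subset_toFinset hE _ hn, h.tripleSum_placeBlocks l 0 (by omega), h4]

end IsPatternChain

open Finset in
/-- The edges of the complement of a `3`-graph. -/
def complEdges {α : Type} [DecidableEq α] [Fintype α] (E : Finset (Finset α)) :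
    Finset (Finset α) :=
  powersetCard 3 univ \ E

section edges

variable {α : Type} [DecidableEq α]

lemma edgeInd_eq_toNat (E : Finset (Finset α)) (x y z : α) :
    edgeInd E x y z = (decide ({x, y, z} ∈ E)).toNat := by
  by_cases h : {x, y, z} ∈ E <;> simp [edgeInd, h]

lemma edgeInd_complEdges [Fintype α] (E : Finset (Finset α)) (x y z : α) :
    edgeInd (complEdges E) x y z =
      if x ≠ y ∧ x ≠ z ∧ y ≠ z then 1 - edgeInd E x y z else 0 := by
  by_cases h : x ≠ y ∧ x ≠ z ∧ y ≠ z
  · have : ({x, y, z} : Finset α).card = 3 :=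
      Finset.card_eq_three.2 ⟨x, y, z, h.1, h.2.1, h.2.2, rfl⟩
    rw [if_pos h]
    by_cases hE : {x, y, z} ∈ E <;> simp [edgeInd, complEdges, hE, this]
  · rw [if_neg h, edgeInd, if_neg]
    intro h'
    rw [complEdges, Finset.mem_sdiff, Finset.mem_powersetCard_univ] at h'
    exact h (ne_of_card_eq_three (E := {{x, y, z}}) (by simpa using h'.1) (by simp))

lemma card_of_mem_complEdges [Fintype α] {E : Finset (Finset α)} {e : Finset α}
    (he : e ∈ complEdges E) : e.card = 3 :=
  Finset.mem_powersetCard_univ.1 (Finset.mem_sdiff.1 he).1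

lemma card_filter_complEdges [Fintype α] {E : Finset (Finset α)} (hE : ∀ e ∈ E, e.card = 3)
    (S : Finset α) : (E.filter fun e => e ⊆ S).card +
      ((complEdges E).filter fun e => e ⊆ S).card = S.card.choose 3 := by
  rw [← Finset.card_powersetCard, ← Finset.card_union_of_disjoint]
  · congr 1
    ext e
    simp only [Finset.mem_union, Finset.mem_filter, Finset.mem_powersetCard, complEdges,
      Finset.mem_sdiff, Finset.subset_univ, true_and]
    have := hE e
    tauto
  · refine Finset.disjoint_filter_filter ?_
    exact Finset.disjoint_sdiff

end edges

namespace BlockPattern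

/-- The pattern of the complement. -/
def compl {Q : Type*} [DecidableEq Q] (D : BlockPattern Q) : BlockPattern Q where
  inner a b c := if a ≠ b ∧ a ≠ c ∧ b ≠ c then 1 - D.inner a b c else 0
  left a b := if a ≠ b then 1 - D.left a b else 0
  right a b c := if b ≠ c then 1 - D.right a b c else 0
  cross a b := 1 - D.cross a b
  inner_le a b c := by split_ifs <;> omega
  left_le a b := by split_ifs <;> omega
  right_le a b c := by split_ifs <;> omega
  cross_le a b := by omega

end BlockPattern

lemma IsPatternChain.compl {α Q : Type} [DecidableEq α] [Fintype α] [DecidableEq Q]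
    {D : BlockPattern Q} {E : Finset (Finset α)} {L : ℕ} {ψ : ℕ → Q → α}
    (h : IsPatternChain D E L ψ) : IsPatternChain D.compl (complEdges E) L ψ := by
  have hi : ∀ i < L, ∀ a b, ψ i a ≠ ψ i b ↔ a ≠ b := fun i hi a b =>
    not_congr ⟨fun e => (h.inj i hi i hi a b e).2, fun e => e ▸ rfl⟩
  have hne : ∀ j < L, ∀ i < j, ∀ a b, ψ i a ≠ ψ j b := fun j hj i hij a b e =>
    hij.ne (h.inj i (hij.trans hj) j hj a b e).1
  refine ⟨h.inj, fun i hl a b c => ?_, fun j hj i hij a b c => ?_, fun j hj i hij a b c => ?_,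
    fun k hk j hjk i hij a b c => ?_⟩
  · simp only [edgeInd_complEdges, hi i hl, h.inner i hl, BlockPattern.compl]
  · simp only [edgeInd_complEdges, hi i (hij.trans hj), h.left j hj i hij, BlockPattern.compl]
    simp [hne j hj i hij a c, hne j hj i hij b c]
  · simp only [edgeInd_complEdges, hi j hj, h.right j hj i hij, BlockPattern.compl]
    simp [hne j hj i hij a b, hne j hj i hij a c]
  · have hj := hjk.trans hk
    have h1 := hne j hj i hij a b
    have h2 := hne k hk i (hij.trans hjk) a c
    have h3 := hne k hk j hjk b c
    rw [edgeInd_complEdges, if_pos ⟨h1, h2, h3⟩, h.cross k hk j hjk i hij, BlockPattern.compl]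

lemma exists_isPatternChain (M : ℕ) (hM : 1 ≤ M) (L : ℕ) : ∃ C : ℕ, ∀ {α : Type}
    [DecidableEq α] (E E' : Finset (Finset α)) (_ : ∀ e ∈ E, e.card = 3)
    (_ : ∀ e ∈ E', e.card = 3)
    (_ : Disjoint E E') (s : ℕ) (_ : 8 ≤ s) (_ : 4 * M ≤ s)
    (_ : ∀ S : Finset α, S.card = s → ∃ e ∈ E, e ⊆ S)
    (_ : ∀ S : Finset α, S.card = s → ∃ e ∈ E', e ⊆ S) (W : Finset α),
    s ^ C ≤ W.card → ∃ (D : BlockPattern (Fin 4 × Fin M)) (ψ : ℕ → Fin 4 × Fin M → α),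
      IsPatternChain D E L ψ ∧ (∀ a b, 1 ≤ L → D.left (0, a) (1, b) = 1) ∧
        (∀ a b, 1 ≤ L → D.left (2, a) (3, b) = 0) := by
  obtain ⟨N, hN⟩ := exists_monochromatic
    (((Fin 4 × Fin M) → (Fin 4 × Fin M) → Bool) ×
      ((Fin 4 × Fin M) → (Fin 4 × Fin M) → (Fin 4 × Fin M) → Bool) ×
      ((Fin 4 × Fin M) → (Fin 4 × Fin M) → Bool) ×
      ((Fin 4 × Fin M) → (Fin 4 × Fin M) → (Fin 4 × Fin M) → Bool)) (L + 1)
  obtain ⟨C, hC⟩ := exists_isChain3 M hM (N + 1) 0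
  refine ⟨C, fun {α} _ E E' hE hE' hd s hs hsM h1 h0 W hW => ?_⟩
  obtain ⟨φ, hφ⟩ := hC E E' hE hE' hd s hs hsM h1 h0 ∅ W le_rfl hW
  obtain ⟨o⟩ : Nonempty (Fin 4 × Fin M) := ⟨(0, ⟨0, hM⟩)⟩
  obtain ⟨⟨g, Λ, Γ, R⟩, f, hf, hc⟩ := hN fun i j =>
    (fun a b => decide ({φ i a, φ j b, φ (j + 1) o} ∈ E),
      fun a b c => decide ({φ i a, φ j b, φ j c} ∈ E),
      fun a b => decide ({φ i a, φ i b, φ (i + 1) o} ∈ E),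
      fun a b c => decide ({φ i a, φ i b, φ i c} ∈ E))
  simp only [Prod.mk.injEq, funext_iff] at hc
  have hcol : ∀ j, j < N → ∀ k, j < k → k < N → ∀ i ≤ j, ∀ a b c,
      ({φ i a, φ j b, φ k c} ∈ E ↔ {φ i a, φ j b, φ (j + 1) o} ∈ E) := by
    intro j hj k hjk hk i hij a b c
    have := hφ.color j (by omega) (φ i a) (Or.inr ⟨i, hij, a, rfl⟩) b
    exact ⟨this k (by omega) hjk (j + 1) (by omega) (by omega) c o,
      this (j + 1) (by omega) (by omega) k (by omega) hjk o c⟩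
  have hΓ : ∀ i < L, ∀ a b, (decide ({φ (f i) a, φ (f i) b, φ (f i + 1) o} ∈ E)) = Γ a b :=
    fun i hi => (hc i (i + 1) (by omega) (by omega)).2.2.2.1
  refine ⟨⟨fun a b c => (R a b c).toNat, fun a b => (Γ a b).toNat, fun a b c => (Λ a b c).toNat,
    fun a b => (g a b).toNat, fun _ _ _ => Bool.toNat_le _, fun _ _ => Bool.toNat_le _,
    fun _ _ _ => Bool.toNat_le _, fun _ _ => Bool.toNat_le _⟩, fun i => φ (f i),
    ⟨?_, ?_, ?_, ?_, ?_⟩, ?_, ?_⟩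
  · intro i hi j hj a b h
    obtain ⟨h1, h2⟩ := hφ.inj _ ((hf i (by omega)).trans (by omega)) _
      ((hf j (by omega)).trans (by omega)) a b h
    refine ⟨?_, h2⟩
    rcases lt_trichotomy i j with h | h | h
    · exact absurd h1 (hc i j h (by omega)).1.ne
    · exact h
    · exact absurd h1 (hc j i h (by omega)).1.ne'
  · intro i hi a b c
    rw [edgeInd_eq_toNat, (hc i (i + 1) (by omega) (by omega)).2.2.2.2]
  · intro j hj i hij a b c
    change _ = (Γ a b).toNat
    rw [edgeInd_eq_toNat, ← hΓ i (by omega)]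
    simp only [hcol (f i) (hf i (by omega)) (f j) (hc i j hij (by omega)).1 (hf j (by omega))
      (f i) le_rfl]
  · intro j hj i hij a b c
    rw [edgeInd_eq_toNat, (hc i j hij (by omega)).2.2.1]
  · intro k hk j hjk i hij a b c
    change _ = (g a b).toNat
    rw [edgeInd_eq_toNat, ← (hc i j hij (by omega)).2.1]
    simp only [hcol (f j) (hf j (by omega)) (f k) (hc j k hjk (by omega)).1 (hf k (by omega))
      (f i) (hc i j hij (by omega)).1.le]
  · intro a b hL
    have := hφ.edge (f 0 + 1) (by have := hf 0 (by omega); omega) (f 0) (by omega) a b o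
    simp only [← hΓ 0 hL, this]
    rfl
  · intro a b hL
    have := hφ.nonedge (f 0 + 1) (by have := hf 0 (by omega); omega) (f 0) (by omega) a b o
    simp only [← hΓ 0 hL, this]
    rfl

lemma one_le_numSizes (n m : ℕ) (hnm : m ≤ n) (E : Finset (Finset (Fin n)))
    (hE : ∀ e ∈ E, e.card = 3) : 1 ≤ numSizes n m E := by
  obtain ⟨S, -, hS⟩ := Finset.exists_subset_card_eq
    (show m ≤ (Finset.univ : Finset (Fin n)).card by simpa using hnm)
  refine (Set.ncard_pos ((Set.finite_Iic _).subset fun f hf => hf.1)).2 ⟨_, ?_, S, hS, rfl⟩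
  have := card_filter_complEdges hE S
  rw [hS] at this
  omega

lemma card_le_numSizes {n m : ℕ} {E : Finset (Finset (Fin n))} (hE : ∀ e ∈ E, e.card = 3)
    (V : Finset ℤ) (hV : ∀ v ∈ V, ∃ S : Finset (Fin n), S.card = m ∧
      ((E.filter fun e => e ⊆ S).card : ℤ) = v) : V.card ≤ numSizes n m E := by
  have hinj : Set.InjOn Int.toNat (V : Set ℤ) := by
    intro v hv w hw h
    obtain ⟨S, -, rfl⟩ := hV v hv
    obtain ⟨T, -, rfl⟩ := hV w hw
    simpa using h
  rw [← Finset.card_image_of_injOn hinj, ← Set.ncard_coe_finset]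
  refine Set.ncard_le_ncard ?_ ((Set.finite_Iic _).subset fun f hf => hf.1)
  intro f hf
  obtain ⟨v, hv, rfl⟩ := Finset.mem_image.1 (Finset.mem_coe.1 hf)
  obtain ⟨S, hS, rfl⟩ := hV v hv
  refine ⟨?_, S, hS, by simp⟩
  have := card_filter_complEdges hE S
  rw [hS] at this
  simp only [Int.toNat_natCast]
  omega

lemma card_le_numSizes_of_complEdges {n m : ℕ} {E : Finset (Finset (Fin n))}
    (hE : ∀ e ∈ E, e.card = 3) (V : Finset ℤ)
    (hV : ∀ v ∈ V, ∃ S : Finset (Fin n), S.card = m ∧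
      (((complEdges E).filter fun e => e ⊆ S).card : ℤ) = v) : V.card ≤ numSizes n m E := by
  rw [← Finset.card_image_of_injective V (sub_right_injective (b := ((m.choose 3 : ℕ) : ℤ)))]
  refine card_le_numSizes hE _ fun v hv => ?_
  obtain ⟨w, hw, rfl⟩ := Finset.mem_image.1 hv
  obtain ⟨S, hS, rfl⟩ := hV w hw
  refine ⟨S, hS, ?_⟩
  have := card_filter_complEdges hE S
  rw [hS] at this
  simp only [← this]
  push_cast
  ring

namespace BlockPattern

lemma exists_attains_of_cross_eq_zero {Q : Type*} (D : BlockPattern Q)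
    (hg : ∀ a b, D.cross a b = 0) (m k : ℕ) (hk : 1 ≤ k)
    (hm : 10000 * k ≤ m) (hm2 : m < 20000 * k) (p q : Fin m → Q) (hp : p.Injective)
    (hq : q.Injective) (hpq : ∀ i j, p i ≠ q j) (hleft : ∀ i j, D.left (p i) (q j) = 1) :
    ∃ V : Finset ℤ, (∀ v ∈ V, D.Attains m v) ∧ m ^ 3 ≤ 20000 ^ 3 * V.card := by
  by_cases h : ∀ u v w, v ≠ w → D.left v w = D.right u v w
  · exact exists_attains_of_left_eq_right D hg h m k hk hm hm2 p q hp hq hpq hleft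
  · push Not at h
    obtain ⟨u, v, w, hvw, hne⟩ := h
    exact exists_attains_of_left_ne_right D hg u v w hvw hne m k hk hm hm2 p q hp hq hpq hleft

end BlockPattern

lemma IsPatternChain.pow_three_le_numSizes {n m : ℕ} (hm : 10000 ≤ m)
    {E : Finset (Finset (Fin n))} (hE : ∀ e ∈ E, e.card = 3)
    {D : BlockPattern (Fin 4 × Fin m)} {ψ : ℕ → Fin 4 × Fin m → Fin n}
    (h : IsPatternChain D E (m + 1) ψ) (h1 : ∀ a b, D.left (0, a) (1, b) = 1)
    (h0 : ∀ a b, D.left (2, a) (3, b) = 0) : m ^ 3 ≤ 20000 ^ 3 * numSizes n m E := by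
  have hk : 1 ≤ m / 10000 := by omega
  have hk1 : 10000 * (m / 10000) ≤ m := by omega
  have hk2 : m < 20000 * (m / 10000) := by omega
  have hinj : ∀ i : Fin 4, Function.Injective fun a : Fin m => (i, a) :=
    fun i a b hab => (Prod.mk.inj hab).2
  obtain ⟨o⟩ : Nonempty (Fin 4 × Fin m) := ⟨(0, ⟨0, by omega⟩)⟩
  by_cases hc : ∀ a b, D.cross a b = D.cross o o
  · rcases Nat.le_one_iff_eq_zero_or_eq_one.1 (D.cross_le o o) with hz | hz
    · obtain ⟨V, hV, hVc⟩ := D.exists_attains_of_cross_eq_zero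
        (fun a b => (hc a b).trans hz) m _ hk hk1 hk2 _ _ (hinj 0) (hinj 1) (by simp) h1
      exact hVc.trans (Nat.mul_le_mul_left _ (card_le_numSizes hE V fun v hv =>
        h.exists_of_attains hE m le_rfl v (hV v hv)))
    · obtain ⟨V, hV, hVc⟩ := D.compl.exists_attains_of_cross_eq_zero
        (fun a b => by simp [BlockPattern.compl, hc a b, hz]) m _ hk hk1 hk2 _ _ (hinj 2) (hinj 3)
        (by simp) (fun i j => by simp [BlockPattern.compl, h0])
      exact hVc.trans (Nat.mul_le_mul_left _ (card_le_numSizes_of_complEdges hE V fun v hv =>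
        h.compl.exists_of_attains (fun e he => card_of_mem_complEdges he) m le_rfl v (hV v hv)))
  · push Not at hc
    obtain ⟨a, b, hne⟩ := hc
    obtain ⟨V, hV, hVc⟩ := D.exists_attains_of_cross_ne a b o o hne m _ hk hk1 hk2
    exact hVc.trans (Nat.mul_le_mul_left _ (card_le_numSizes hE V fun v hv =>
      h.exists_of_attains hE m le_rfl v (hV v hv)))

/-- A power of `n` with small exponent is, up to rounding, large but much smaller than `n`. -/
lemma exists_ceil_rpow_pow_le (C A : ℕ) : ∃ ε : ℝ, 0 < ε ∧ ∃ n₀ : ℕ, ∀ n : ℕ, n₀ ≤ n →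
    A ≤ ⌈(n : ℝ) ^ ε⌉₊ ∧ ⌈(n : ℝ) ^ ε⌉₊ ^ C ≤ n := by
  refine ⟨1 / (2 * C + 1 : ℕ), by positivity, (A + 2) ^ (2 * C + 1), fun n hn => ?_⟩
  obtain ⟨x, hx⟩ : ∃ x : ℝ, x = (n : ℝ) ^ (1 / (2 * C + 1 : ℕ) : ℝ) := ⟨_, rfl⟩
  have hxn : x ^ (2 * C + 1) = n := by
    rw [hx, one_div, Real.rpow_inv_natCast_pow (Nat.cast_nonneg _) (by omega)]
  have hx0 : 0 ≤ x := hx ▸ Real.rpow_nonneg (Nat.cast_nonneg _) _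
  have hxA : (A + 2 : ℝ) ≤ x := by
    refine le_of_pow_le_pow_left₀ (n := 2 * C + 1) (by omega) hx0 ?_
    rw [hxn]
    exact_mod_cast hn
  have hA : (0 : ℝ) ≤ A := Nat.cast_nonneg _
  rw [← hx]
  constructor
  · exact_mod_cast (show (A : ℝ) ≤ (⌈x⌉₊ : ℝ) by linarith [Nat.le_ceil x])
  · have h1 : (⌈x⌉₊ : ℝ) ≤ x ^ 2 := by nlinarith [Nat.ceil_lt_add_one hx0]
    have h2 : (⌈x⌉₊ : ℝ) ^ C ≤ n := calc
      (⌈x⌉₊ : ℝ) ^ C ≤ (x ^ 2) ^ C := by gcongr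
      _ = x ^ (2 * C) := (pow_mul _ _ _).symm
      _ ≤ x ^ (2 * C + 1) := pow_le_pow_right₀ (by linarith) (by omega)
      _ = n := hxn
    exact_mod_cast h2

theorem stmt2 :
    ∃ c : ℝ, 0 < c ∧
      ∀ m : ℕ, 3 ≤ m →
        ∃ ε : ℝ, 0 < ε ∧
          ∃ n₀ : ℕ, ∀ n : ℕ, n₀ ≤ n →
            ∀ E : Finset (Finset (Fin n)), (∀ e ∈ E, e.card = 3) →
              (¬ ∃ S : Finset (Fin n), (n : ℝ) ^ ε ≤ (S.card : ℝ) ∧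
                (IsClique3 E S ∨ IsIndep3 E S)) →
              c * (m : ℝ) ^ 3 ≤ (numSizes n m E : ℝ) := by
  refine ⟨1 / 20000 ^ 3, by positivity, fun m hm3 => ?_⟩
  have reduce : ∀ {N : ℕ}, m ^ 3 ≤ 20000 ^ 3 * N → 1 / 20000 ^ 3 * (m : ℝ) ^ 3 ≤ (N : ℝ) := by
    intro N h
    have : (m : ℝ) ^ 3 ≤ 20000 ^ 3 * N := by exact_mod_cast h
    rw [one_div, inv_mul_le_iff₀ (by positivity)]
    exact this
  rcases lt_or_ge m 10000 with hm | hm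
  · refine ⟨1, one_pos, m, fun n hn E hE _ => reduce ?_⟩
    calc m ^ 3 ≤ 20000 ^ 3 * 1 := by
          rw [mul_one]
          exact Nat.pow_le_pow_left (by omega) 3
      _ ≤ _ := Nat.mul_le_mul_left _ (one_le_numSizes n m hn E hE)
  · obtain ⟨C, hC⟩ := exists_isPatternChain m (by omega) (m + 1)
    obtain ⟨ε, hε, n₀, hn₀⟩ := exists_ceil_rpow_pow_le C (4 * m)
    refine ⟨ε, hε, n₀, fun n hn E hE hG => reduce ?_⟩
    obtain ⟨hs, hsC⟩ := hn₀ n hn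
    push Not at hG
    obtain ⟨D, ψ, hψ, h1, h0⟩ := hC E (complEdges E) hE (fun e he => card_of_mem_complEdges he)
      Finset.disjoint_sdiff _ (by omega) hs (fun S hS => by
        obtain ⟨-, h⟩ := hG S (hS ▸ Nat.le_ceil _)
        simp only [IsIndep3] at h
        push Not at h
        obtain ⟨e, h1, -, h3⟩ := h
        exact ⟨e, h3, h1⟩) (fun S hS => by
        obtain ⟨h, -⟩ := hG S (hS ▸ Nat.le_ceil _)
        simp only [IsClique3] at h
        push Not at h
        obtain ⟨e, h1, h2, h3⟩ := h
        exact ⟨e, Finset.mem_sdiff.2 ⟨Finset.mem_powersetCard_univ.2 h2, h3⟩, h1⟩) Finset.univ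
      (by simpa using hsC)
    exact hψ.pow_three_le_numSizes hm hE (fun a b => h1 a b (by omega))
      (fun a b => h0 a b (by omega))
end

section
/- For every m ≥ 3, every integer 0 ≤ f ≤ binom(m,3) and every sufficiently large n, every n-vertex 3-graph with no (m,f)-subset contains a homogeneous set of size at least (1/2)·(log₂ n)^{1/(2(m−2))}. -/
/-- The `k`-times iterated base-2 logarithm: `iterLog 0 x = x`,
`iterLog (k+1) x = log₂ (iterLog k x)`. -/
noncomputable def iterLog : ℕ → ℝ → ℝ
  | 0, x => x
  | k + 1, x => Real.logb 2 (iterLog k x)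

/-- `S` is a clique in the `r`-graph with edge set `E`: every `r`-subset of `S` is an edge. -/
def IsRClique {n : ℕ} (r : ℕ) (E : Finset (Finset (Fin n))) (S : Finset (Fin n)) : Prop :=
  ∀ e : Finset (Fin n), e ⊆ S → e.card = r → e ∈ E

/-- `S` is an independent set in the `r`-graph with edge set `E`:
no `r`-subset of `S` is an edge. -/
def IsRIndep {n : ℕ} (r : ℕ) (E : Finset (Finset (Fin n))) (S : Finset (Fin n)) : Prop :=
  ∀ e : Finset (Fin n), e ⊆ S → e.card = r → e ∉ E

/-- The `r`-graph with edge set `E` has an `(m,f)`-subset: a set of `m` vertices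
inducing exactly `f` edges. -/
def HasMFSubset {n : ℕ} (E : Finset (Finset (Fin n))) (m f : ℕ) : Prop :=
  ∃ S : Finset (Fin n), S.card = m ∧ (E.filter (fun e => e ⊆ S)).card = f

open Finset in
/-- The Erdős–Rado selection argument: a long sequence in which `T (v h) (v i) (v j)` does not
depend on the choice of `j > i`. -/
theorem exists_end_homogeneous_seq {V : Type*} [DecidableEq V] (T : V → V → V → Prop) (r : ℕ) :
    ∀ P C : Finset V, 2 ^ (P.card * r + r ^ 2) ≤ C.card →
      ∃ v : ℕ → V, (∀ i ≤ r, v i ∈ C) ∧ (∀ i ≤ r, ∀ j ≤ r, v i = v j → i = j) ∧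
        (∀ p ∈ P, ∀ i j k, i < j → i < k → j ≤ r → k ≤ r →
          (T p (v i) (v j) ↔ T p (v i) (v k))) ∧
        (∀ h i j k, h < i → i < j → i < k → j ≤ r → k ≤ r →
          (T (v h) (v i) (v j) ↔ T (v h) (v i) (v k))) := by
  classical
  induction r with
  | zero =>
    intro P C hC
    obtain ⟨x, hx⟩ : C.Nonempty := by
      rw [← card_pos]
      exact lt_of_lt_of_le (by positivity) hC
    exact ⟨fun _ => x, fun _ _ => hx, fun i hi j hj _ => by omega,
      fun p _ i j k _ _ _ _ => Iff.rfl, fun h i j k _ _ _ _ _ => Iff.rfl⟩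
  | succ r ih =>
    intro P C hC
    obtain ⟨x, hx⟩ : C.Nonempty := by
      rw [← card_pos]
      exact lt_of_lt_of_le (by positivity) hC
    have hcard : P.powerset.card * 2 ^ ((P.card + 1) * r + r ^ 2) ≤ (C.erase x).card := by
      rw [card_powerset, ← pow_add, card_erase_of_mem hx]
      have h1 : 2 ^ (P.card + ((P.card + 1) * r + r ^ 2) + 1) ≤ C.card :=
        le_trans (Nat.pow_le_pow_right (by norm_num) (by nlinarith)) hC
      have h2 : 1 ≤ 2 ^ (P.card + ((P.card + 1) * r + r ^ 2)) := Nat.one_le_two_pow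
      rw [pow_succ] at h1
      omega
    obtain ⟨y, -, hy⟩ := exists_le_card_fiber_of_mul_le_card_of_maps_to
      (s := C.erase x) (t := P.powerset) (f := fun y => P.filter (fun p => T p x y))
      (fun a _ => mem_powerset.2 (filter_subset _ _)) ⟨∅, by simp⟩ hcard
    obtain ⟨v, hvC, hvi, hvP, hvv⟩ := ih (insert x P) _
      (le_trans (Nat.pow_le_pow_right (by norm_num)
        (by gcongr; exact card_insert_le _ _)) hy)
    have hmem : ∀ i ≤ r, v i ∈ C ∧ v i ≠ x ∧ ∀ p ∈ P, (T p x (v i) ↔ p ∈ y) := by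
      intro i hi
      have h := hvC i hi
      simp only [mem_filter, mem_erase] at h
      refine ⟨h.1.2, h.1.1, fun p hp => ?_⟩
      rw [← h.2]
      simp [hp]
    refine ⟨fun i => Nat.casesOn i x v, ?_, ?_, ?_, ?_⟩
    · rintro (_ | i) hi
      · exact hx
      · exact (hmem i (by omega)).1
    · rintro (_ | i) hi (_ | j) hj hij
      · rfl
      · exact absurd hij.symm (hmem j (by omega)).2.1
      · exact absurd hij (hmem i (by omega)).2.1
      · rw [hvi i (by omega) j (by omega) hij]
    · rintro p hp (_ | i) (_ | j) (_ | k) hij hik hj hk <;> try omega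
      · exact ((hmem j (by omega)).2.2 p hp).trans ((hmem k (by omega)).2.2 p hp).symm
      · exact hvP p (mem_insert_of_mem hp) i j k (by omega) (by omega) (by omega) (by omega)
    · rintro (_ | h) (_ | i) (_ | j) (_ | k) hhi hij hik hj hk <;> try omega
      · exact hvP x (mem_insert_self _ _) i j k (by omega) (by omega) (by omega) (by omega)
      · exact hvv h i j k (by omega) (by omega) (by omega) (by omega) (by omega)

open Finset in
/-- Greedy step: if every `N`-set contains a member of `Q`, then either some vertex is followed by
a member of `Q` inside its `τ`-neighbourhood, or there is a large `τ`-independent set. -/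
theorem exists_step_or_independent {α : Type*} [DecidableEq α] (lt τ : α → α → Prop)
    (hmin : ∀ A : Finset α, A.Nonempty → ∃ a ∈ A, ∀ b ∈ A, b ≠ a → lt a b)
    (hτ : ∀ a b, τ a b → τ b a) (X : Finset α) (Q : Finset α → Prop) (N : ℕ) (hN : 1 ≤ N)
    (hQ : ∀ A ⊆ X, N ≤ A.card → ∃ S ⊆ A, Q S) (j : ℕ) :
    ∀ A ⊆ X, N * j ≤ A.card →
      (∃ a ∈ A, ∃ S ⊆ A, Q S ∧ ∀ b ∈ S, lt a b ∧ τ a b) ∨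
      ∃ S ⊆ A, S.card = j ∧ ∀ a ∈ S, ∀ b ∈ S, a ≠ b → ¬ τ a b := by
  classical
  induction j with
  | zero => exact fun A _ _ => Or.inr ⟨∅, by simp, by simp, by simp⟩
  | succ j ih =>
    intro A hAX hA
    rw [mul_add, mul_one] at hA
    obtain ⟨a, haA, ha⟩ := hmin A (card_pos.1 (by omega))
    have hsplit : ((A.erase a).filter (fun b => τ a b)).card +
        ((A.erase a).filter (fun b => ¬ τ a b)).card = A.card - 1 := by
      rw [← card_erase_of_mem haA]
      exact card_filter_add_card_filter_not _
    have hBA : ∀ (p : α → Prop) [DecidablePred p], (A.erase a).filter p ⊆ A :=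
      fun p _ => (filter_subset _ _).trans (erase_subset _ _)
    by_cases hB : N ≤ ((A.erase a).filter (fun b => τ a b)).card
    · obtain ⟨S, hS, hQS⟩ := hQ _ ((hBA _).trans hAX) hB
      refine Or.inl ⟨a, haA, S, hS.trans (hBA _), hQS, fun b hb => ?_⟩
      have h := hS hb
      simp only [mem_filter, mem_erase] at h
      exact ⟨ha b h.1.2 h.1.1, h.2⟩
    · rcases ih _ ((hBA (fun b => ¬ τ a b)).trans hAX) (by omega) with
        ⟨x, hx, S, hS, h⟩ | ⟨S, hS, hSj, h⟩
      · exact Or.inl ⟨x, hBA _ hx, S, hS.trans (hBA _), h⟩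
      · have hS' : ∀ b ∈ S, b ≠ a ∧ ¬ τ a b := by
          intro b hb
          have h := hS hb
          simp only [mem_filter, mem_erase] at h
          exact ⟨h.1.1, h.2⟩
        refine Or.inr ⟨insert a S, insert_subset haA (hS.trans (hBA _)), ?_, ?_⟩
        · rw [card_insert_of_notMem (fun h => (hS' a h).1 rfl), hSj]
        · intro b hb c hc hbc
          rcases mem_insert.1 hb with hba | hbS <;> rcases mem_insert.1 hc with hca | hcS
          · exact absurd (hba.trans hca.symm) hbc
          · exact hba ▸ (hS' c hcS).2
          · exact hca ▸ fun h' => (hS' b hbS).2 (hτ _ _ h')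
          · exact h b hbS c hcS hbc

open Finset in
/-- The number of triples of `U` satisfying `P`. -/
noncomputable def tripleCount (P : Finset ℕ → Prop) (U : Finset ℕ) : ℕ :=
  open Classical in ((powersetCard 3 U).filter P).card

open Finset Classical in
theorem tripleCount_insert (P : Finset ℕ → Prop) {a : ℕ} {U : Finset ℕ} (ha : a ∉ U) :
    tripleCount P (insert a U) =
      tripleCount P U + ((powersetCard 2 U).filter (fun p => P (insert a p))).card := by
  unfold tripleCount
  rw [powersetCard_succ_insert ha, filter_union, card_union_of_disjoint, filter_image,
    card_image_of_injOn]
  · intro p hp q hq hpq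
    simp only [coe_filter, mem_powersetCard, Set.mem_ofPred_eq] at hp hq
    have h := congrArg (fun e => e.erase a) hpq
    simpa [erase_insert (fun h => ha (hp.1.1 h)), erase_insert (fun h => ha (hq.1.1 h))] using h
  · rw [disjoint_left]
    intro e he he'
    simp only [mem_filter, mem_powersetCard, mem_image] at he he'
    obtain ⟨⟨p, -, rfl⟩, -⟩ := he'
    exact ha (he.1.1 (mem_insert_self _ _))

open Finset in
theorem exists_pair_of_mem_powersetCard_two {s : ℕ} {S p : Finset ℕ} (hS : ∀ b ∈ S, b < s)
    (hp : p ∈ powersetCard 2 (insert s S)) :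
    ∃ b ∈ S, ∃ c ∈ insert s S, b < c ∧ c ≤ s ∧ p = {b, c} := by
  rw [mem_powersetCard] at hp
  obtain ⟨x, y, hxy, rfl⟩ := card_eq_two.1 hp.2
  have hx := hp.1 (mem_insert_self x {y})
  have hy := hp.1 (mem_insert_of_mem (mem_singleton_self y))
  rw [mem_insert] at hx hy
  rcases hx with rfl | hx <;> rcases hy with rfl | hy
  · exact absurd rfl hxy
  · exact ⟨y, hy, x, mem_insert_self _ _, hS y hy, le_rfl, pair_comm _ _⟩
  · exact ⟨x, hx, y, mem_insert_self _ _, hS x hx, le_rfl, rfl⟩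
  · rcases lt_or_gt_of_ne hxy with h | h
    · exact ⟨x, hx, y, mem_insert_of_mem hy, h, (hS y hy).le, rfl⟩
    · exact ⟨y, hy, x, mem_insert_of_mem hx, h, (hS x hx).le, pair_comm _ _⟩

section EndHomogeneous

variable {P : Finset ℕ → Prop} {s : ℕ}

open Finset Classical in
theorem tripleCount_insert_of_full
    (hP : ∀ i j k, i < j → j < k → k ≤ s → (P {i, j, k} ↔ P {i, j, s}))
    {a : ℕ} {S : Finset ℕ} (hS : ∀ b ∈ S, b < s) (has : a < s)
    (h : ∀ b ∈ S, a < b ∧ P {a, b, s}) :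
    tripleCount P (insert s (insert a S)) =
      tripleCount P (insert s S) + (S.card + 1).choose 2 := by
  have ha : a ∉ insert s S := by
    rw [mem_insert, not_or]
    exact ⟨has.ne, fun h' => lt_irrefl _ (h a h').1⟩
  rw [insert_comm, tripleCount_insert P ha, filter_true_of_mem, card_powersetCard,
    card_insert_of_notMem (fun h' => lt_irrefl _ (hS s h'))]
  intro p hp
  obtain ⟨b, hb, c, -, hbc, hcs, rfl⟩ := exists_pair_of_mem_powersetCard_two hS hp
  exact (hP a b c (h b hb).1 hbc hcs).2 (h b hb).2

open Finset Classical in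
theorem tripleCount_insert_of_empty
    (hP : ∀ i j k, i < j → j < k → k ≤ s → (P {i, j, k} ↔ P {i, j, s}))
    {a : ℕ} {S : Finset ℕ} (hS : ∀ b ∈ S, b < s) (has : a < s)
    (h : ∀ b ∈ S, a < b ∧ ¬ P {a, b, s}) :
    tripleCount P (insert s (insert a S)) = tripleCount P (insert s S) := by
  have ha : a ∉ insert s S := by
    rw [mem_insert, not_or]
    exact ⟨has.ne, fun h' => lt_irrefl _ (h a h').1⟩
  rw [insert_comm, tripleCount_insert P ha, filter_false_of_mem, card_empty, add_zero]
  intro p hp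
  obtain ⟨b, hb, c, -, hbc, hcs, rfl⟩ := exists_pair_of_mem_powersetCard_two hS hp
  exact fun h' => (h b hb).2 ((hP a b c (h b hb).1 hbc hcs).1 h')

open Finset Classical in
theorem tripleCount_insert_of_full_except_last
    (hP : ∀ i j k, i < j → j < k → k ≤ s → (P {i, j, k} ↔ P {i, j, s}))
    {a d : ℕ} {S : Finset ℕ} (hd : ∀ b ∈ S, b < d) (hds : d < s) (had : a < d)
    (h : ∀ b ∈ S, a < b ∧ P {a, b, s}) (had' : ¬ P {a, d, s}) :
    tripleCount P (insert s (insert a (insert d S))) =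
      tripleCount P (insert s (insert d S)) + ((S.card + 2).choose 2 - 1) := by
  have hS : ∀ b ∈ insert d S, b < s := by
    intro b hb
    rcases mem_insert.1 hb with rfl | hb
    · exact hds
    · exact (hd b hb).trans hds
  have ha : a ∉ insert s (insert d S) := by
    simp only [mem_insert, not_or]
    exact ⟨(had.trans hds).ne, had.ne, fun h' => lt_irrefl _ (h a h').1⟩
  have hfilter : (powersetCard 2 (insert s (insert d S))).filter (fun p => P (insert a p)) =
      (powersetCard 2 (insert s (insert d S))).erase {d, s} := by
    ext p
    rw [mem_filter, mem_erase, and_comm]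
    refine and_congr_left fun hp => ⟨?_, fun hne => ?_⟩
    · rintro h' rfl
      exact had' h'
    · obtain ⟨b, hb, c, hc, hbc, hcs, rfl⟩ := exists_pair_of_mem_powersetCard_two hS hp
      rcases mem_insert.1 hb with rfl | hb
      · exfalso
        rcases mem_insert.1 hc with rfl | hc
        · exact hne rfl
        · rcases mem_insert.1 hc with rfl | hc
          · exact lt_irrefl _ hbc
          · exact lt_asymm hbc (hd c hc)
      · exact (hP a b c (h b hb).1 hbc hcs).2 (h b hb).2
  rw [insert_comm, tripleCount_insert P ha, hfilter, card_erase_of_mem, card_powersetCard,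
    card_insert_of_notMem (fun h' => lt_irrefl _ (hS s h')),
    card_insert_of_notMem (fun h' => lt_irrefl _ (hd d h'))]
  rw [mem_powersetCard]
  exact ⟨by intro x; simp only [mem_insert, mem_singleton]; tauto, card_pair hds.ne⟩

open Finset in
/-- Without homogeneous sets of size `t`, a first vertex joined to everything after it, or to
nothing after it, can be prepended at the cost of a factor `t`. -/
theorem exists_prepend {t N : ℕ} (hN : 1 ≤ N)
    (hfull : ¬ ∃ S ⊆ range s, S.card = t ∧ ∀ a ∈ S, ∀ b ∈ S, a ≠ b → P {a, b, s})
    (hempty : ¬ ∃ S ⊆ range s, S.card = t ∧ ∀ a ∈ S, ∀ b ∈ S, a ≠ b → ¬ P {a, b, s})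
    {Q : Finset ℕ → Prop} (hQ : ∀ A ⊆ range s, N ≤ A.card → ∃ S ⊆ A, Q S)
    {A : Finset ℕ} (hAs : A ⊆ range s) (hA : N * t ≤ A.card) :
    (∃ a ∈ A, ∃ S ⊆ A, Q S ∧ ∀ b ∈ S, a < b ∧ P {a, b, s}) ∧
    (∃ a ∈ A, ∃ S ⊆ A, Q S ∧ ∀ b ∈ S, a < b ∧ ¬ P {a, b, s}) ∧
    (∃ a ∈ A, ∃ S ⊆ A, Q S ∧ ∀ b ∈ S, b < a ∧ ¬ P {b, a, s}) := by
  have hcomm : ∀ a b, ({a, b, s} : Finset ℕ) = {b, a, s} := fun a b => insert_comm _ _ _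
  have hmin : ∀ A : Finset ℕ, A.Nonempty → ∃ a ∈ A, ∀ b ∈ A, b ≠ a → a < b :=
    fun A hA => ⟨A.min' hA, A.min'_mem hA, fun b hb hne => lt_of_le_of_ne (A.min'_le b hb) hne.symm⟩
  have hmax : ∀ A : Finset ℕ, A.Nonempty → ∃ a ∈ A, ∀ b ∈ A, b ≠ a → b < a :=
    fun A hA => ⟨A.max' hA, A.max'_mem hA, fun b hb hne => lt_of_le_of_ne (A.le_max' b hb) hne⟩
  refine ⟨?_, ?_, ?_⟩
  · refine (exists_step_or_independent (· < ·) (fun a b => P {a, b, s}) hmin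
      (fun a b h => by rwa [hcomm]) _ Q N hN hQ t A hAs hA).resolve_right ?_
    rintro ⟨S, hS, h⟩
    exact hempty ⟨S, hS.trans hAs, h⟩
  · refine (exists_step_or_independent (· < ·) (fun a b => ¬ P {a, b, s}) hmin
      (fun a b h => by rwa [hcomm]) _ Q N hN hQ t A hAs hA).resolve_right ?_
    rintro ⟨S, hS, hc, h⟩
    exact hfull ⟨S, hS.trans hAs, hc, fun a ha b hb hab => not_not.1 (h a ha b hb hab)⟩
  · refine (exists_step_or_independent (fun a b => b < a) (fun a b => ¬ P {b, a, s}) hmax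
      (fun a b h => by rwa [hcomm]) _ Q N hN hQ t A hAs hA).resolve_right ?_
    rintro ⟨S, hS, hc, h⟩
    exact hfull ⟨S, hS.trans hAs, hc, fun a ha b hb hab => not_not.1 (h b hb a ha hab.symm)⟩

open Finset in
/-- A configuration consisting of a first vertex joined to an independent set, followed by an
isolated vertex. -/
theorem exists_tripleCount_eq_choose_sub_one {t k : ℕ} (ht : 1 ≤ t)
    (hP : ∀ i j k, i < j → j < k → k ≤ s → (P {i, j, k} ↔ P {i, j, s}))
    (hfull : ¬ ∃ S ⊆ range s, S.card = t ∧ ∀ a ∈ S, ∀ b ∈ S, a ≠ b → P {a, b, s})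
    (hempty : ¬ ∃ S ⊆ range s, S.card = t ∧ ∀ a ∈ S, ∀ b ∈ S, a ≠ b → ¬ P {a, b, s})
    {U : Finset ℕ → Prop}
    (hU : ∀ S, U S → S.card = k ∧ ∀ d, (∀ b ∈ S, b < d ∧ ¬ P {b, d, s}) → d < s →
      tripleCount P (insert s (insert d S)) = 0)
    {j : ℕ} (hQ : ∀ A ⊆ range s, t ^ j ≤ A.card → ∃ S ⊆ A, U S)
    {A : Finset ℕ} (hAs : A ⊆ range s) (hA : t ^ (j + 2) ≤ A.card) :
    ∃ S ⊆ A, S.card = k + 2 ∧ tripleCount P (insert s S) = (k + 2).choose 2 - 1 := by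
  obtain ⟨-, -, d, hd, S, hSA, ⟨a, ha, S', hS', hUS, rfl, haS⟩, hdS⟩ :=
    exists_prepend (N := t ^ (j + 1)) (Nat.one_le_pow _ _ ht) hfull hempty
    (Q := fun S => ∃ a ∈ S, ∃ S' ⊆ S, U S' ∧ S = insert a S' ∧ ∀ b ∈ S', a < b ∧ P {a, b, s})
    (fun A hAs hA => by
      obtain ⟨⟨a, ha, S, hSA, hUS, h⟩, -⟩ := exists_prepend (N := t ^ j)
        (Nat.one_le_pow _ _ ht) hfull hempty hQ hAs (by rwa [pow_succ] at hA)
      exact ⟨insert a S, insert_subset ha hSA, a, mem_insert_self _ _, S, subset_insert _ _, hUS,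
        rfl, h⟩) hAs (by rwa [pow_succ] at hA)
  have hds : d < s := mem_range.1 (hAs hd)
  have had := hdS a ha
  have hdS' : ∀ b ∈ S', b < d ∧ ¬ P {b, d, s} := fun b hb => hdS b (hS' hb)
  obtain ⟨hk, hU0⟩ := hU S' hUS
  refine ⟨insert a (insert d S'), ?_, ?_, ?_⟩
  · exact insert_subset (hSA ha) (insert_subset hd (hS'.trans hSA))
  · rw [card_insert_of_notMem, card_insert_of_notMem, hk]
    · exact fun h => lt_irrefl _ (hdS' d h).1
    · rw [mem_insert, not_or]
      exact ⟨had.1.ne, fun h => lt_irrefl _ (haS a h).1⟩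
  · rw [tripleCount_insert_of_full_except_last hP (fun b hb => (hdS' b hb).1) hds had.1 haS had.2,
      hU0 d hdS' hds, hk, zero_add]

open Finset in
theorem exists_tripleCount_eq {t : ℕ} (ht : 1 ≤ t)
    (hP : ∀ i j k, i < j → j < k → k ≤ s → (P {i, j, k} ↔ P {i, j, s}))
    (hfull : ¬ ∃ S ⊆ range s, S.card = t ∧ ∀ a ∈ S, ∀ b ∈ S, a ≠ b → P {a, b, s})
    (hempty : ¬ ∃ S ⊆ range s, S.card = t ∧ ∀ a ∈ S, ∀ b ∈ S, a ≠ b → ¬ P {a, b, s})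
    (k : ℕ) : ∀ f ≤ (k + 2).choose 3, ∀ A ⊆ range s, t ^ k ≤ A.card →
      ∃ S ⊆ A, S.card = k + 1 ∧ tripleCount P (insert s S) = f := by
  have hpair : ∀ d < s, tripleCount P (insert s {d}) = 0 := by
    intro d hd
    unfold tripleCount
    rw [powersetCard_eq_empty.2, filter_empty, card_empty]
    exact lt_of_le_of_lt (card_insert_le _ _) (by simp)
  have hlt : ∀ {S A : Finset ℕ}, S ⊆ A → A ⊆ range s → ∀ b ∈ S, b < s :=
    fun hS hA b hb => mem_range.1 (hA (hS hb))
  have hone : ∀ A ⊆ range s, t ^ 0 ≤ A.card → ∃ S ⊆ A, ∃ c, c < s ∧ S = {c} := by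
    intro A hAs hA
    obtain ⟨c, hc⟩ := card_pos.1 (lt_of_lt_of_le Nat.one_pos hA)
    exact ⟨{c}, singleton_subset_iff.2 hc, c, mem_range.1 (hAs hc), rfl⟩
  induction k with
  | zero =>
    intro f hf A hAs hA
    obtain ⟨S, hSA, c, hc, rfl⟩ := hone A hAs hA
    have hf0 : f = 0 := by simpa [Nat.choose] using hf
    exact ⟨{c}, hSA, by simp, by rw [hpair c hc, hf0]⟩
  | succ k ih =>
    intro f hf A hAs hA
    have hN : 1 ≤ t ^ k := Nat.one_le_pow _ _ ht
    have hA' : t ^ k * t ≤ A.card := by rwa [pow_succ] at hA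
    have hpascal : (k + 3).choose 3 = (k + 2).choose 2 + (k + 2).choose 3 :=
      Nat.choose_succ_succ _ _
    rw [show k + 1 + 2 = k + 3 from rfl, hpascal] at hf
    by_cases hf1 : f ≤ (k + 2).choose 3
    · obtain ⟨-, ⟨a, ha, S, hSA, ⟨hSk, hSf⟩, h⟩, -⟩ :=
        exists_prepend hN hfull hempty (ih f hf1) hAs hA'
      refine ⟨insert a S, insert_subset ha hSA, ?_, ?_⟩
      · rw [card_insert_of_notMem (fun h' => lt_irrefl _ (h a h').1), hSk]
      · rw [tripleCount_insert_of_empty hP (hlt hSA hAs) (mem_range.1 (hAs ha)) h, hSf]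
    by_cases hf2 : (k + 2).choose 2 ≤ f
    · obtain ⟨⟨a, ha, S, hSA, ⟨hSk, hSf⟩, h⟩, -⟩ :=
        exists_prepend hN hfull hempty (ih (f - (k + 2).choose 2) (by omega)) hAs hA'
      refine ⟨insert a S, insert_subset ha hSA, ?_, ?_⟩
      · rw [card_insert_of_notMem (fun h' => lt_irrefl _ (h a h').1), hSk]
      · rw [tripleCount_insert_of_full hP (hlt hSA hAs) (mem_range.1 (hAs ha)) h, hSf, hSk,
          show k + 1 + 1 = k + 2 from rfl]
        omega
    have hk : k < 3 := by
      by_contra hk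
      have h : (k + 2).choose 3 * 3 = (k + 2).choose 2 * (k + 2 - 2) :=
        Nat.choose_succ_right_eq (k + 2) 2
      have h3 : (k + 2).choose 2 * 3 ≤ (k + 2).choose 2 * (k + 2 - 2) :=
        Nat.mul_le_mul_left _ (by omega)
      omega
    interval_cases k
    · norm_num [Nat.choose] at hf1 hf2
      omega
    · have hf' : f = (1 + 2).choose 2 - 1 := by
        norm_num [Nat.choose] at hf1 hf2 ⊢
        omega
      rw [hf']
      refine exists_tripleCount_eq_choose_sub_one (k := 1) ht hP hfull hempty ?_ hone hAs hA
      rintro _ ⟨c, hc, rfl⟩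
      refine ⟨card_singleton c, fun d hd hds => ?_⟩
      have hcd := hd c (mem_singleton_self c)
      rw [pair_comm, tripleCount_insert_of_empty hP (by simpa using hds) hc (by simpa using hcd),
        hpair d hds]
    · have hf' : f = (2 + 2).choose 2 - 1 := by
        norm_num [Nat.choose] at hf1 hf2 ⊢
        omega
      rw [hf']
      refine exists_tripleCount_eq_choose_sub_one (k := 2) (j := 1)
        (U := fun S => ∃ b c, b < c ∧ c < s ∧ ¬ P {b, c, s} ∧ S = {b, c})
        ht hP hfull hempty ?_ ?_ hAs hA
      · rintro _ ⟨b, c, hbc, hcs, hP', rfl⟩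
        refine ⟨card_pair hbc.ne, fun d hd hds => ?_⟩
        have hbd := hd b (by simp)
        have hcd := hd c (by simp)
        rw [insert_comm d b, pair_comm d c,
          tripleCount_insert_of_empty hP (by simp; omega) (by omega) (by simp; tauto),
          tripleCount_insert_of_empty hP (by simpa using hds) hcs (by simpa using hcd),
          hpair d hds]
      · intro A hAs hA
        obtain ⟨-, ⟨b, hb, _, hSA, ⟨c, hc, rfl⟩, h⟩, -⟩ :=
          exists_prepend (Nat.one_le_pow 0 _ ht) hfull hempty hone hAs (by simpa using hA)
        have h' := h c (mem_singleton_self c)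
        exact ⟨{b, c}, insert_subset hb hSA, b, c, h'.1, hc, h'.2, rfl⟩

end EndHomogeneous

open Finset in
theorem card_filter_subset_image_eq_tripleCount {n s : ℕ} (E : Finset (Finset (Fin n)))
    (hE : ∀ e ∈ E, e.card = 3) (v : ℕ → Fin n) (hv : ∀ i ≤ s, ∀ j ≤ s, v i = v j → i = j)
    {U : Finset ℕ} (hU : ∀ i ∈ U, i ≤ s) :
    (E.filter (fun e => e ⊆ U.image v)).card = tripleCount (fun e => e.image v ∈ E) U := by
  classical
  have hinj : Set.InjOn v U := fun i hi j hj h => hv i (hU i hi) j (hU j hj) h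
  have h : E.filter (fun e => e ⊆ U.image v) =
      ((powersetCard 3 U).filter (fun e => e.image v ∈ E)).image (fun e => e.image v) := by
    ext e
    simp only [mem_filter, mem_image, mem_powersetCard]
    constructor
    · rintro ⟨heE, heU⟩
      obtain ⟨e', he'U, rfl⟩ := subset_image_iff.1 heU
      refine ⟨e', ⟨⟨by simpa using he'U, ?_⟩, heE⟩, rfl⟩
      rw [← hE _ heE, card_image_of_injOn (hinj.mono (by simpa using he'U))]
    · rintro ⟨e', ⟨⟨he'U, -⟩, heE⟩, rfl⟩
      exact ⟨heE, image_subset_image he'U⟩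
  rw [h, card_image_of_injOn]
  · unfold tripleCount
    congr
  · intro p hp q hq hpq
    simp only [coe_filter, mem_powersetCard, Set.mem_ofPred_eq] at hp hq
    have hpq' : v '' (p : Set ℕ) = v '' (q : Set ℕ) := by
      rw [← coe_image, ← coe_image]
      exact congrArg _ hpq
    exact coe_injective ((hinj.image_eq_image_iff (by simpa using hp.1.1)
      (by simpa using hq.1.1)).1 hpq')

open Finset in
theorem exists_sorted_triple_of_card_eq_three {e : Finset ℕ} (he : e.card = 3) :
    ∃ i j k, i < j ∧ j < k ∧ e = {i, j, k} := by
  refine ⟨e.orderEmbOfFin he 0, e.orderEmbOfFin he 1, e.orderEmbOfFin he 2, ?_, ?_, ?_⟩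
  · exact (e.orderEmbOfFin he).strictMono (by decide)
  · exact (e.orderEmbOfFin he).strictMono (by decide)
  · ext x
    rw [← mem_coe, ← range_orderEmbOfFin e he]
    simp [-range_orderEmbOfFin, Fin.exists_fin_succ, eq_comm]

open Finset in
theorem exists_homogeneous_of_two_pow_le {k t n f : ℕ} (ht : 1 ≤ t) (hf : f ≤ (k + 2).choose 3)
    (hn : 2 ^ ((t ^ k) ^ 2) ≤ n) (E : Finset (Finset (Fin n))) (hE : ∀ e ∈ E, e.card = 3)
    (hmf : ¬ HasMFSubset E (k + 2) f) :
    ∃ S : Finset (Fin n), S.card = t ∧ (IsRClique 3 E S ∨ IsRIndep 3 E S) := by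
  set s := t ^ k with hs
  obtain ⟨v, -, hv, -, hvE⟩ := exists_end_homogeneous_seq
    (fun a b c : Fin n => ({a, b, c} : Finset (Fin n)) ∈ E) s ∅ univ (by simpa using hn)
  set P : Finset ℕ → Prop := fun e => e.image v ∈ E with hPdef
  have hP : ∀ i j k, i < j → j < k → k ≤ s → (P {i, j, k} ↔ P {i, j, s}) := by
    intro i j k hij hjk hk
    simpa [hPdef, image_insert] using hvE i j k s hij hjk (by omega) hk le_rfl
  have hvS : ∀ S ⊆ range s, Set.InjOn v S := fun S hS i hi j hj h =>
    hv i (mem_range.1 (hS hi)).le j (mem_range.1 (hS hj)).le h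
  have htriple : ∀ S ⊆ range s, ∀ e ⊆ S.image v, e.card = 3 →
      ∃ i ∈ S, ∃ j ∈ S, i ≠ j ∧ (e ∈ E ↔ P {i, j, s}) := by
    intro S hS e he he3
    obtain ⟨e', he'S, rfl⟩ := subset_image_iff.1 he
    have he'S : e' ⊆ S := by simpa using he'S
    rw [card_image_of_injOn (hvS e' (he'S.trans hS))] at he3
    obtain ⟨i, j, k, hij, hjk, rfl⟩ := exists_sorted_triple_of_card_eq_three he3
    exact ⟨i, he'S (by simp), j, he'S (by simp), hij.ne,
      hP i j k hij hjk (mem_range.1 (hS (he'S (by simp)))).le⟩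
  by_cases hfull : ∃ S ⊆ range s, S.card = t ∧ ∀ a ∈ S, ∀ b ∈ S, a ≠ b → P {a, b, s}
  · obtain ⟨S, hS, hSt, h⟩ := hfull
    refine ⟨S.image v, by rw [card_image_of_injOn (hvS S hS), hSt], Or.inl fun e he he3 => ?_⟩
    obtain ⟨i, hi, j, hj, hij, hiff⟩ := htriple S hS e he he3
    exact hiff.2 (h i hi j hj hij)
  by_cases hempty : ∃ S ⊆ range s, S.card = t ∧ ∀ a ∈ S, ∀ b ∈ S, a ≠ b → ¬ P {a, b, s}
  · obtain ⟨S, hS, hSt, h⟩ := hempty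
    refine ⟨S.image v, by rw [card_image_of_injOn (hvS S hS), hSt], Or.inr fun e he he3 => ?_⟩
    obtain ⟨i, hi, j, hj, hij, hiff⟩ := htriple S hS e he he3
    exact fun h' => h i hi j hj hij (hiff.1 h')
  exfalso
  obtain ⟨S, hS, hSk, hSf⟩ := exists_tripleCount_eq ht hP hfull hempty k f hf (range s)
    subset_rfl (by rw [card_range])
  have hle : ∀ i ∈ insert s S, i ≤ s := by
    intro i hi
    rcases mem_insert.1 hi with rfl | hi
    · exact le_rfl
    · exact (mem_range.1 (hS hi)).le
  refine hmf ⟨(insert s S).image v, ?_, ?_⟩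
  · rw [card_image_of_injOn (fun i hi j hj h => hv i (hle i hi) j (hle j hj) h),
      card_insert_of_notMem (fun h => lt_irrefl _ (mem_range.1 (hS h))), hSk]
  · rw [card_filter_subset_image_eq_tripleCount E hE v hv hle, hSf]

theorem stmt4 (m : ℕ) (hm : 3 ≤ m) (f : ℕ) (hf : f ≤ Nat.choose m 3) :
    ∃ n₀ : ℕ, ∀ n : ℕ, n₀ ≤ n →
      ∀ E : Finset (Finset (Fin n)), (∀ e ∈ E, e.card = 3) →
        ¬ HasMFSubset E m f →
        ∃ S : Finset (Fin n),
          (1 / 2 : ℝ) * Real.logb 2 (n : ℝ) ^ ((1 : ℝ) / (2 * ((m : ℝ) - 2))) ≤ (S.card : ℝ) ∧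
          (IsRClique 3 E S ∨ IsRIndep 3 E S) := by
  obtain ⟨k, rfl⟩ : ∃ k, m = k + 2 := ⟨m - 2, by omega⟩
  have hk : 1 ≤ k := by omega
  refine ⟨2 ^ (2 ^ (2 * k)), fun n hn E hE hmf => ?_⟩
  have hcast : (2 : ℝ) * (((k + 2 : ℕ) : ℝ) - 2) = ((2 * k : ℕ) : ℝ) := by push_cast; ring
  rw [hcast]
  have hn' : (2 : ℝ) ^ ((2 : ℝ) ^ (2 * k)) ≤ (n : ℝ) := by
    have h : ((2 ^ (2 ^ (2 * k)) : ℕ) : ℝ) ≤ (n : ℝ) := Nat.cast_le.2 hn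
    have h' : (2 : ℝ) ^ ((2 : ℝ) ^ (2 * k)) = ((2 ^ (2 ^ (2 * k)) : ℕ) : ℝ) := by
      rw [Nat.cast_pow, ← Real.rpow_natCast _ (2 ^ (2 * k))]
      push_cast
      rfl
    rwa [h']
  have hnpos : (0 : ℝ) < n := lt_of_lt_of_le (by positivity) hn'
  have hL : (2 : ℝ) ^ (2 * k) ≤ Real.logb 2 n :=
    (Real.le_logb_iff_rpow_le (by norm_num) hnpos).2 hn'
  have hLpos : 0 ≤ Real.logb 2 n := le_trans (by positivity) hL
  set x : ℝ := Real.logb 2 n ^ ((1 : ℝ) / ((2 * k : ℕ) : ℝ)) with hx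
  have hx0 : 0 ≤ x := Real.rpow_nonneg hLpos _
  have hxpow : x ^ (2 * k) = Real.logb 2 n := by
    rw [hx, one_div, Real.rpow_inv_natCast_pow hLpos (by omega)]
  have hx2 : 2 ≤ x := by
    rw [← hxpow] at hL
    exact (pow_le_pow_iff_left₀ (by norm_num) hx0 (by omega)).1 hL
  have htx : (⌈1 / 2 * x⌉₊ : ℝ) ≤ x := by
    have := Nat.ceil_lt_add_one (show 0 ≤ 1 / 2 * x by positivity)
    linarith
  have ht : 1 ≤ ⌈1 / 2 * x⌉₊ := Nat.one_le_ceil_iff.2 (by linarith)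
  have htn : 2 ^ ((⌈1 / 2 * x⌉₊ ^ k) ^ 2) ≤ n := by
    have h : ((((⌈1 / 2 * x⌉₊ ^ k) ^ 2 : ℕ) : ℕ) : ℝ) ≤ Real.logb 2 n := by
      rw [← hxpow, ← pow_mul, mul_comm k 2]
      push_cast
      gcongr
    rw [Real.le_logb_iff_rpow_le (by norm_num) hnpos, Real.rpow_natCast] at h
    exact_mod_cast h
  obtain ⟨S, hS, hom⟩ := exists_homogeneous_of_two_pow_le ht hf htn E hE hmf
  exact ⟨S, by rw [hS]; exact Nat.le_ceil _, hom⟩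
end

section
/- For every r ≥ 4 there is a constant c₀(r) > 0 such that for every m ≥ 5r², every integer 0 ≤ f ≤ binom(m,r), and every positive integer h, every ordered graph G' with at least h^{m − 5r² + 1/c₀(r)} vertices contains a homogeneous set of size h or a weighted (m,f)-subset. -/
/-- `PeelSum W x y f` says that `f` is the total weight of an ordered graph on the positions
`x, …, y - 1` (numbered from right to left) that is built by repeatedly adding, at the left end or
at the right end, a vertex joined to all or to none of the previous ones; an edge weighs `W i`,
where `i` is its right endpoint. -/
inductive PeelSum (W : ℕ → ℕ) : ℕ → ℕ → ℕ → Prop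
  | nil (x : ℕ) : PeelSum W x x 0
  | leftNon {x y f : ℕ} : PeelSum W x y f → PeelSum W x (y + 1) f
  | leftAdj {x y f : ℕ} : PeelSum W x y f → PeelSum W x (y + 1) (f + ∑ i ∈ Finset.Ico x y, W i)
  | rightNon {x y f : ℕ} : PeelSum W (x + 1) y f → PeelSum W x y f
  | rightAdj {x y f : ℕ} : PeelSum W (x + 1) y f → PeelSum W x y (f + (y - (x + 1)) * W x)

namespace PeelSum

theorem le {W : ℕ → ℕ} {x y f : ℕ} (h : PeelSum W x y f) : x ≤ y := by
  induction h <;> omega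

theorem pad {W : ℕ → ℕ} {x y f : ℕ} (h : PeelSum W x y f) (g : ℕ) : PeelSum W x (y + g) f := by
  induction g with
  | zero => exact h
  | succ g ih => exact ih.leftNon

theorem pad_to {W : ℕ → ℕ} {x y z f : ℕ} (h : PeelSum W x y f) (hz : y ≤ z) :
    PeelSum W x z f := by
  obtain ⟨g, rfl⟩ := Nat.exists_eq_add_of_le hz
  exact h.pad g

end PeelSum

section Embedding

section Order

variable {V : Type*} [LinearOrder V]

/-- A large set either has a vertex with many forward `R`-neighbours, or contains a large set
without `R`-related pairs. -/
theorem exists_forward_or_free (R : V → V → Prop) (M : ℕ) (hM : 0 < M) (h : ℕ)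
    (A : Finset V) (hA : h * M ≤ A.card) :
    (∃ v ∈ A, ∃ B ⊆ A, M ≤ B.card ∧ ∀ w ∈ B, v < w ∧ R v w) ∨
      ∃ S ⊆ A, S.card = h ∧ ∀ x ∈ S, ∀ y ∈ S, x < y → ¬ R x y := by
  classical
  induction h generalizing A with
  | zero => exact Or.inr ⟨∅, by simp, by simp, by simp⟩
  | succ h ih =>
    have hne : A.Nonempty := by
      rw [← Finset.card_pos]
      nlinarith
    set v := A.min' hne with hv
    have hvA : v ∈ A := A.min'_mem hne
    by_cases hd : M ≤ (A.filter fun w => v < w ∧ R v w).card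
    · exact Or.inl ⟨v, hvA, _, Finset.filter_subset _ _, hd, fun w hw => (Finset.mem_filter.1 hw).2⟩
    set B := A.filter fun w => v < w ∧ ¬ R v w with hB
    have hBA : B ⊆ A := Finset.filter_subset _ _
    have hcover : A ⊆ insert v ((A.filter fun w => v < w ∧ R v w) ∪ B) := by
      intro w hw
      have hle : v ≤ w := A.min'_le w hw
      rcases hle.eq_or_lt with rfl | hlt
      · simp
      · by_cases hR : R v w <;> simp [hB, hw, hlt, hR]
    have hcard := Finset.card_le_card hcover
    have h1 := Finset.card_insert_le v ((A.filter fun w => v < w ∧ R v w) ∪ B)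
    have h2 := Finset.card_union_le (A.filter fun w => v < w ∧ R v w) B
    have hBc : h * M ≤ B.card := by
      rw [Nat.succ_mul] at hA
      omega
    rcases ih B hBc with ⟨x, hx, C, hC, hCM⟩ | ⟨S, hS, hSc, hSR⟩
    · exact Or.inl ⟨x, hBA hx, C, hC.trans hBA, hCM⟩
    · have hvS : ∀ y ∈ S, v < y ∧ ¬ R v y := fun y hy => (Finset.mem_filter.1 (hS hy)).2
      refine Or.inr ⟨insert v S, ?_, ?_, ?_⟩
      · exact Finset.insert_subset hvA (hS.trans hBA)
      · rw [Finset.card_insert_of_notMem fun hmem => (hvS v hmem).1.false, hSc]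
      · intro x hx y hy hxy
        rcases Finset.mem_insert.1 hx with rfl | hx
        · rcases Finset.mem_insert.1 hy with rfl | hy
          · exact absurd hxy (lt_irrefl _)
          · exact (hvS y hy).2
        · rcases Finset.mem_insert.1 hy with rfl | hy
          · exact absurd hxy (hvS x hx).1.asymm
          · exact hSR x hx y hy hxy

theorem exists_backward_or_free (R : V → V → Prop) (M : ℕ) (hM : 0 < M) (h : ℕ)
    (A : Finset V) (hA : h * M ≤ A.card) :
    (∃ v ∈ A, ∃ B ⊆ A, M ≤ B.card ∧ ∀ w ∈ B, w < v ∧ R v w) ∨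
      ∃ S ⊆ A, S.card = h ∧ ∀ x ∈ S, ∀ y ∈ S, y < x → ¬ R x y :=
  exists_forward_or_free (V := Vᵒᵈ) R M hM h A hA

/-- A set of `h` vertices which is a clique or an independent set. -/
def HasHomogeneous (G : SimpleGraph V) (h : ℕ) : Prop :=
  ∃ S : Finset V, S.card = h ∧
    ((∀ x ∈ S, ∀ y ∈ S, x ≠ y → G.Adj x y) ∨ (∀ x ∈ S, ∀ y ∈ S, ¬ G.Adj x y))

theorem hasHomogeneous_of_lt (G : SimpleGraph V) {h : ℕ} {S : Finset V} (hS : S.card = h)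
    {b : Prop} (H : ∀ x ∈ S, ∀ y ∈ S, x < y → ¬ (G.Adj x y ↔ b)) : HasHomogeneous G h := by
  refine ⟨S, hS, ?_⟩
  by_cases hb : b
  · right
    intro x hx y hy hxy
    rcases hxy.ne.lt_or_gt with hlt | hlt
    · exact H x hx y hy hlt (by simp [hb, hxy])
    · exact H y hy x hx hlt (by simp [hb, hxy.symm])
  · left
    intro x hx y hy hne
    by_contra hxy
    rcases hne.lt_or_gt with hlt | hlt
    · exact H x hx y hy hlt (by simp [hb, hxy])
    · exact H y hy x hx hlt (by simp [hb, G.adj_comm, hxy])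

variable (G : SimpleGraph V)

theorem exists_forward {h M : ℕ} (hG : ¬ HasHomogeneous G h) (hM : 0 < M) (b : Prop)
    {A : Finset V} (hA : h * M ≤ A.card) :
    ∃ v ∈ A, ∃ B ⊆ A, M ≤ B.card ∧ ∀ w ∈ B, v < w ∧ (G.Adj v w ↔ b) := by
  rcases exists_forward_or_free (fun v w => G.Adj v w ↔ b) M hM h A hA with
    hB | ⟨S, -, hS, H⟩
  · exact hB
  · exact absurd (hasHomogeneous_of_lt G hS H) hG

theorem exists_backward {h M : ℕ} (hG : ¬ HasHomogeneous G h) (hM : 0 < M) (b : Prop)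
    {A : Finset V} (hA : h * M ≤ A.card) :
    ∃ v ∈ A, ∃ B ⊆ A, M ≤ B.card ∧ ∀ w ∈ B, w < v ∧ (G.Adj v w ↔ b) := by
  rcases exists_backward_or_free (fun v w => G.Adj v w ↔ b) M hM h A hA with
    hB | ⟨S, -, hS, H⟩
  · exact hB
  · refine absurd (hasHomogeneous_of_lt G hS (b := b) fun x hx y hy hxy => ?_) hG
    rw [G.adj_comm]
    exact H y hy x hx hxy

end Order

section Weight

variable {V : Type*} (G : SimpleGraph V) [DecidableRel G.Adj]

/-- The total weight of the edges of `G` among `u x, …, u (y - 1)`. -/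
def edgeWeight (W : ℕ → ℕ) (u : ℕ → V) (x y : ℕ) : ℕ :=
  ∑ i ∈ Finset.Ico x y, ∑ j ∈ Finset.Ico x y, if i < j ∧ G.Adj (u i) (u j) then W i else 0

theorem edgeWeight_congr (W : ℕ → ℕ) {u u' : ℕ → V} {x y : ℕ}
    (H : ∀ i, x ≤ i → i < y → u i = u' i) : edgeWeight G W u x y = edgeWeight G W u' x y := by
  refine Finset.sum_congr rfl fun i hi => Finset.sum_congr rfl fun j hj => ?_
  rw [Finset.mem_Ico] at hi hj
  rw [H i hi.1 hi.2, H j hj.1 hj.2]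

theorem edgeWeight_succ_right (W : ℕ → ℕ) (u : ℕ → V) {x y : ℕ} (hxy : x ≤ y) :
    edgeWeight G W u x (y + 1) =
      edgeWeight G W u x y + ∑ i ∈ Finset.Ico x y, if G.Adj (u y) (u i) then W i else 0 := by
  have hlast : ∑ j ∈ Finset.Ico x (y + 1), (if y < j ∧ G.Adj (u y) (u j) then W y else 0) = 0 := by
    refine Finset.sum_eq_zero fun j hj => if_neg fun hj' => ?_
    have := (Finset.mem_Ico.1 hj).2
    omega
  unfold edgeWeight
  rw [Finset.sum_Ico_succ_top hxy, hlast, add_zero, ← Finset.sum_add_distrib]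
  refine Finset.sum_congr rfl fun i hi => ?_
  rw [Finset.sum_Ico_succ_top hxy]
  simp [(Finset.mem_Ico.1 hi).2, G.adj_comm]

theorem edgeWeight_pred_left (W : ℕ → ℕ) (u : ℕ → V) {x y : ℕ} (hxy : x + 1 ≤ y) :
    edgeWeight G W u x y =
      edgeWeight G W u (x + 1) y +
        ∑ j ∈ Finset.Ico (x + 1) y, if G.Adj (u x) (u j) then W x else 0 := by
  unfold edgeWeight
  rw [Finset.sum_eq_sum_Ico_succ_bot (by omega : x < y), add_comm]
  congr 1
  · refine Finset.sum_congr rfl fun i hi => ?_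
    rw [Finset.sum_eq_sum_Ico_succ_bot (by omega : x < y), if_neg, zero_add]
    have := (Finset.mem_Ico.1 hi).1
    omega
  · rw [Finset.sum_eq_sum_Ico_succ_bot (by omega : x < y), if_neg (by simp), zero_add]
    refine Finset.sum_congr rfl fun j hj => ?_
    have : x < j := (Finset.mem_Ico.1 hj).1
    simp [this]

end Weight

variable {V : Type*} [LinearOrder V] (G : SimpleGraph V) [DecidableRel G.Adj]

theorem exists_embedding_left {h : ℕ} (hh : 0 < h) (hG : ¬ HasHomogeneous G h) (W : ℕ → ℕ)
    (b : Prop) [Decidable b] {x y f : ℕ} (hxy : x ≤ y)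
    (ih : ∀ A : Finset V, h ^ (y - x) ≤ A.card → ∃ u : ℕ → V, (∀ i, x ≤ i → i < y → u i ∈ A) ∧
      (∀ i j, x ≤ i → i < j → j < y → u j < u i) ∧ edgeWeight G W u x y = f)
    (A : Finset V) (hA : h ^ (y + 1 - x) ≤ A.card) :
    ∃ u : ℕ → V, (∀ i, x ≤ i → i < y + 1 → u i ∈ A) ∧
      (∀ i j, x ≤ i → i < j → j < y + 1 → u j < u i) ∧
      edgeWeight G W u x (y + 1) = f + ∑ i ∈ Finset.Ico x y, if b then W i else 0 := by
  rw [Nat.succ_sub hxy, pow_succ'] at hA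
  obtain ⟨v, hv, B, hBA, hB, hvB⟩ := exists_forward G hG (pow_pos hh _) b hA
  obtain ⟨u, hu, hmono, hw⟩ := ih B hB
  have hne : ∀ i, i < y → Function.update u y v i = u i := fun i hi =>
    Function.update_of_ne hi.ne _ _
  refine ⟨Function.update u y v, ?_, ?_, ?_⟩
  · intro i hi hiy
    rcases (Nat.lt_succ_iff.1 hiy).eq_or_lt with rfl | hlt
    · simpa using hv
    · rw [hne i hlt]
      exact hBA (hu i hi hlt)
  · intro i j hi hij hj
    rw [hne i (by omega)]
    rcases (Nat.lt_succ_iff.1 hj).eq_or_lt with rfl | hlt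
    · simpa using (hvB _ (hu i hi hij)).1
    · rw [hne j hlt]
      exact hmono i j hi hij hlt
  · rw [edgeWeight_succ_right G W _ hxy, edgeWeight_congr G W (u' := u) fun i _ hi => hne i hi, hw]
    congr 1
    refine Finset.sum_congr rfl fun i hi => ?_
    rw [Finset.mem_Ico] at hi
    rw [hne i hi.2, Function.update_self]
    simp [(hvB _ (hu i hi.1 hi.2)).2]

theorem exists_embedding_right {h : ℕ} (hh : 0 < h) (hG : ¬ HasHomogeneous G h) (W : ℕ → ℕ)
    (b : Prop) [Decidable b] {x y f : ℕ} (hxy : x + 1 ≤ y)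
    (ih : ∀ A : Finset V, h ^ (y - (x + 1)) ≤ A.card → ∃ u : ℕ → V,
      (∀ i, x + 1 ≤ i → i < y → u i ∈ A) ∧
      (∀ i j, x + 1 ≤ i → i < j → j < y → u j < u i) ∧ edgeWeight G W u (x + 1) y = f)
    (A : Finset V) (hA : h ^ (y - x) ≤ A.card) :
    ∃ u : ℕ → V, (∀ i, x ≤ i → i < y → u i ∈ A) ∧
      (∀ i j, x ≤ i → i < j → j < y → u j < u i) ∧
      edgeWeight G W u x y = f + ∑ _j ∈ Finset.Ico (x + 1) y, if b then W x else 0 := by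
  rw [show y - x = (y - (x + 1)) + 1 by omega, pow_succ'] at hA
  obtain ⟨v, hv, B, hBA, hB, hvB⟩ := exists_backward G hG (pow_pos hh _) b hA
  obtain ⟨u, hu, hmono, hw⟩ := ih B hB
  have hne : ∀ i, x + 1 ≤ i → Function.update u x v i = u i := fun i hi =>
    Function.update_of_ne (by omega) _ _
  refine ⟨Function.update u x v, ?_, ?_, ?_⟩
  · intro i hi hiy
    rcases hi.eq_or_lt with rfl | hlt
    · simpa using hv
    · rw [hne i hlt]
      exact hBA (hu i hlt hiy)
  · intro i j hi hij hj
    rw [hne j (by omega)]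
    rcases hi.eq_or_lt with rfl | hlt
    · simpa using (hvB _ (hu j hij hj)).1
    · rw [hne i hlt]
      exact hmono i j hlt hij hj
  · rw [edgeWeight_pred_left G W _ hxy, edgeWeight_congr G W (u' := u) fun i hi _ => hne i hi, hw]
    congr 1
    refine Finset.sum_congr rfl fun j hj => ?_
    rw [Finset.mem_Ico] at hj
    rw [hne j hj.1, Function.update_self]
    simp [(hvB _ (hu j hj.1 hj.2)).2]

theorem PeelSum.exists_embedding {h : ℕ} (hh : 0 < h) (hG : ¬ HasHomogeneous G h) {W : ℕ → ℕ}
    {x y f : ℕ} (hP : PeelSum W x y f) (A : Finset V) (hA : h ^ (y - x) ≤ A.card) :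
    ∃ u : ℕ → V, (∀ i, x ≤ i → i < y → u i ∈ A) ∧
      (∀ i j, x ≤ i → i < j → j < y → u j < u i) ∧ edgeWeight G W u x y = f := by
  induction hP generalizing A with
  | nil x =>
    obtain ⟨v, -⟩ : A.Nonempty := by
      rw [← Finset.card_pos]
      exact (pow_pos hh _).trans_le hA
    exact ⟨fun _ => v, fun i _ _ => by omega, fun i j _ _ _ => by omega, by simp [edgeWeight]⟩
  | leftNon hP ih => simpa using exists_embedding_left G hh hG W False hP.le ih A hA
  | leftAdj hP ih => simpa using exists_embedding_left G hh hG W True hP.le ih A hA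
  | rightNon hP ih => simpa using exists_embedding_right G hh hG W False hP.le ih A hA
  | rightAdj hP ih => simpa using exists_embedding_right G hh hG W True hP.le ih A hA

end Embedding

section Numbers

/-- The total weight of the edges with left endpoint at position `y`. -/
def vertexSum (k y : ℕ) : ℕ := (k + y).choose (k + 1)

/-- The total weight of all edges among the positions below `y`. -/
def totalSum (k y : ℕ) : ℕ := (k + y).choose (k + 2)

/-- Sums obtainable with the edge weights of a weighted `(m, f)`-subset, for `k = r - 2`. -/
abbrev ChoosePeel (k x y f : ℕ) : Prop := PeelSum (fun i => (k + i).choose k) x y f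

theorem vertexSum_succ (k y : ℕ) : vertexSum k (y + 1) = vertexSum k y + (k + y).choose k := by
  unfold vertexSum
  rw [← add_assoc, Nat.choose_succ_succ', add_comm]

theorem totalSum_succ (k y : ℕ) : totalSum k (y + 1) = totalSum k y + vertexSum k y := by
  unfold totalSum vertexSum
  rw [← add_assoc, Nat.choose_succ_succ', add_comm]

theorem vertexSum_zero (k : ℕ) : vertexSum k 0 = 0 := by simp [vertexSum]

theorem vertexSum_one (k : ℕ) : vertexSum k 1 = 1 := by simp [vertexSum]

theorem totalSum_zero (k : ℕ) : totalSum k 0 = 0 :=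
  Nat.choose_eq_zero_of_lt (by omega)

theorem vertexSum_mono (k : ℕ) : Monotone (vertexSum k) :=
  monotone_nat_of_le_succ fun y => by rw [vertexSum_succ]; omega

theorem vertexSum_lt_succ (k y : ℕ) : vertexSum k y < vertexSum k (y + 1) := by
  rw [vertexSum_succ]
  have : 0 < (k + y).choose k := Nat.choose_pos (by omega)
  omega

theorem vertexSum_succ_pos (k y : ℕ) : 0 < vertexSum k (y + 1) :=
  (Nat.zero_le _).trans_lt (vertexSum_lt_succ k y)

theorem choose_mul_eq_vertexSum_mul (k y : ℕ) :
    (k + y).choose k * y = vertexSum k y * (k + 1) := by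
  have := Nat.choose_succ_right_eq (k + y) k
  rw [Nat.add_sub_cancel_left] at this
  exact this.symm

theorem vertexSum_succ_mul (k y : ℕ) :
    vertexSum k (y + 1) * y = vertexSum k y * (k + 1 + y) := by
  rw [vertexSum_succ, add_mul, choose_mul_eq_vertexSum_mul]
  ring

theorem totalSum_mul (k y : ℕ) :
    totalSum k (y + 1) * (k + 2) = vertexSum k (y + 1) * y := by
  have := Nat.choose_succ_right_eq (k + (y + 1)) (k + 1)
  rwa [show k + (y + 1) - (k + 1) = y by omega] at this

theorem vertexSum_add_sum (k : ℕ) {x y : ℕ} (h : x ≤ y) :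
    vertexSum k x + ∑ i ∈ Finset.Ico x y, (k + i).choose k = vertexSum k y := by
  induction y, h using Nat.le_induction with
  | base => simp
  | succ y hy ih => rw [Finset.sum_Ico_succ_top hy, vertexSum_succ]; omega

namespace ChoosePeel

variable {k : ℕ}

theorem left_adj {x y f g : ℕ} (h : ChoosePeel k x y f)
    (hg : g + vertexSum k x = f + vertexSum k y) : ChoosePeel k x (y + 1) g := by
  have := vertexSum_add_sum k h.le
  obtain rfl : g = f + ∑ i ∈ Finset.Ico x y, (k + i).choose k := by omega
  exact h.leftAdj

theorem exists_compl {x y f : ℕ} (h : ChoosePeel k x y f) :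
    ∃ g, ChoosePeel k x y g ∧
      f + g + totalSum k x + (y - x) * vertexSum k x = totalSum k y := by
  induction h with
  | nil x => exact ⟨0, PeelSum.nil x, by simp⟩
  | @leftNon x y f hP ih =>
    obtain ⟨g, hg, hfg⟩ := ih
    have hs := vertexSum_add_sum k hP.le
    refine ⟨_, hg.leftAdj, ?_⟩
    rw [Nat.succ_sub hP.le, Nat.succ_mul, totalSum_succ]
    omega
  | @leftAdj x y f hP ih =>
    obtain ⟨g, hg, hfg⟩ := ih
    have hs := vertexSum_add_sum k hP.le
    refine ⟨_, hg.leftNon, ?_⟩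
    rw [Nat.succ_sub hP.le, Nat.succ_mul, totalSum_succ]
    omega
  | @rightNon x y f hP ih =>
    obtain ⟨g, hg, hfg⟩ := ih
    refine ⟨_, hg.rightAdj, ?_⟩
    obtain ⟨d, rfl⟩ := Nat.exists_eq_add_of_le hP.le
    rw [totalSum_succ, vertexSum_succ] at hfg
    rw [show x + 1 + d - (x + 1) = d by omega] at hfg ⊢
    rw [show x + 1 + d - x = d + 1 by omega]
    linarith
  | @rightAdj x y f hP ih =>
    obtain ⟨g, hg, hfg⟩ := ih
    refine ⟨_, hg.rightNon, ?_⟩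
    obtain ⟨d, rfl⟩ := Nat.exists_eq_add_of_le hP.le
    rw [totalSum_succ, vertexSum_succ] at hfg
    rw [show x + 1 + d - (x + 1) = d by omega] at hfg ⊢
    rw [show x + 1 + d - x = d + 1 by omega]
    linarith

end ChoosePeel

/-- The number of vertices that suffices to write every number below `vertexSum k (x + 1)` as a
sum of the values `vertexSum k i` with `1 ≤ i ≤ x`. -/
def digitCount (k x : ℕ) : ℕ := ∑ i ∈ Finset.range x, (k + 1 + i) / (i + 1)

theorem digitCount_mono (k : ℕ) : Monotone (digitCount k) :=
  monotone_nat_of_le_succ fun x => by simp [digitCount, Finset.sum_range_succ]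

theorem ChoosePeel.add_digits {k x y v t : ℕ} (hP : ChoosePeel k x y v)
    (ht : t < vertexSum k (x + 1)) :
    ChoosePeel k 0 (y + digitCount k x) (v + (y - x) * vertexSum k x + totalSum k x + t) := by
  induction x generalizing y v t with
  | zero =>
    obtain rfl : t = 0 := by simpa [vertexSum_one] using ht
    simpa [digitCount, vertexSum_zero, totalSum_zero] using hP
  | succ x ih =>
    have hpos := vertexSum_succ_pos k x
    set s := vertexSum k (x + 1) with hs
    obtain ⟨g, t, rfl, hlt⟩ : ∃ g t', t = s * g + t' ∧ t' < s :=
      ⟨t / s, t % s, (Nat.div_add_mod t s).symm, Nat.mod_lt t hpos⟩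
    have hgc : g ≤ (k + 1 + x) / (x + 1) := by
      rw [Nat.le_div_iff_mul_le (by omega)]
      have h1 := vertexSum_succ_mul k (x + 1)
      have h2 : s * g < vertexSum k (x + 1 + 1) := by omega
      have h3 : s * (g * (x + 1)) < s * (k + 1 + (x + 1)) := by
        rw [← h1, ← mul_assoc]
        exact Nat.mul_lt_mul_of_pos_right h2 (by omega)
      have := lt_of_mul_lt_mul_left h3 (Nat.zero_le _)
      omega
    obtain ⟨d, rfl⟩ := Nat.exists_eq_add_of_le hP.le
    have hQ := ih ((PeelSum.pad hP g).rightAdj) hlt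
    have hcount : x + 1 + d + g + digitCount k x ≤ x + 1 + d + digitCount k (x + 1) := by
      simp only [digitCount, Finset.sum_range_succ]
      omega
    convert PeelSum.pad_to hQ hcount using 1
    rw [show x + 1 + d + g - (x + 1) = d + g by omega, show x + 1 + d + g - x = d + g + 1 by omega,
      show x + 1 + d - (x + 1) = d by omega, totalSum_succ]
    have := vertexSum_succ k x
    rw [← hs] at this
    simp only [this]
    ring

theorem two_mul_choose_le {k y : ℕ} (hy : 2 * (k + 1) ≤ y) :
    2 * (k + y).choose k ≤ vertexSum k y := by
  have h := choose_mul_eq_vertexSum_mul k y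
  have : (2 * (k + y).choose k) * (k + 1) ≤ vertexSum k y * (k + 1) := by
    rw [← h]
    nlinarith
  exact le_of_mul_le_mul_right this (by omega)

theorem totalSum_add_mul_le (k x q : ℕ) :
    totalSum k x + q * vertexSum k x ≤ totalSum k (x + q) := by
  induction q with
  | zero => simp
  | succ q ih =>
    rw [← add_assoc, totalSum_succ, Nat.succ_mul]
    have := vertexSum_mono k (Nat.le_add_right x q)
    omega

theorem vertexSum_add_le {k x : ℕ} (hx : 2 * (k + 1) ≤ x) (q : ℕ) :
    vertexSum k (x + q) + totalSum k x + q * vertexSum k x ≤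
      totalSum k (x + q) + vertexSum k (x + 1) + vertexSum k x := by
  induction q with
  | zero => simp; omega
  | succ q ih =>
    rw [← add_assoc, totalSum_succ, Nat.succ_mul, vertexSum_succ k (x + q)]
    have h1 := two_mul_choose_le (hx.trans (Nat.le_add_right x q))
    have h2 := totalSum_add_mul_le k x q
    have h3 := vertexSum_lt_succ k x
    omega

theorem ChoosePeel.exists_near {k x : ℕ} (hx : 2 * (k + 1) ≤ x) (q f : ℕ)
    (hf : f + totalSum k x + q * vertexSum k x < totalSum k (x + q) + vertexSum k (x + 1)) :
    ∃ e, ChoosePeel k x (x + q) e ∧ e ≤ f ∧ f < e + vertexSum k (x + 1) := by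
  induction q generalizing f with
  | zero => exact ⟨0, PeelSum.nil x, Nat.zero_le _, by simp at hf; omega⟩
  | succ q ih =>
    rw [← add_assoc, totalSum_succ, Nat.succ_mul] at hf
    by_cases h : f + totalSum k x + q * vertexSum k x < totalSum k (x + q) + vertexSum k (x + 1)
    · obtain ⟨e, he, h1, h2⟩ := ih f h
      exact ⟨e, he.leftNon, h1, h2⟩
    · have h0 := vertexSum_add_le hx q
      have hm := vertexSum_mono k (Nat.le_add_right x q)
      obtain ⟨e, he, h1, h2⟩ := ih (f + vertexSum k x - vertexSum k (x + q)) (by omega)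
      exact ⟨e + vertexSum k (x + q) - vertexSum k x, he.left_adj (by omega), by omega, by omega⟩

theorem ChoosePeel.of_mem_window {k x : ℕ} (hx : 2 * (k + 1) ≤ x) {q f : ℕ}
    (hl : totalSum k x + q * vertexSum k x ≤ f)
    (hf : f < totalSum k (x + q) + vertexSum k (x + 1)) :
    ChoosePeel k 0 (x + q + digitCount k x) f := by
  obtain ⟨e, he, h1, h2⟩ :=
    exists_near hx q (f - totalSum k x - q * vertexSum k x) (by omega)
  have := he.add_digits (t := f - totalSum k x - q * vertexSum k x - e) (by omega)
  rw [Nat.add_sub_cancel_left] at this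
  convert this using 1
  omega

theorem ChoosePeel.of_le_totalSum {k x : ℕ} (hx : 2 * (k + 1) ≤ x) (y : ℕ) {f : ℕ}
    (hf : f ≤ totalSum k y) : ChoosePeel k 0 (y + digitCount k x) f := by
  induction y with
  | zero =>
    obtain rfl : f = 0 := by simpa [totalSum_zero] using hf
    exact (PeelSum.nil 0).pad_to (Nat.zero_le _)
  | succ y ih =>
    by_cases h : f ≤ totalSum k y
    · exact (ih h).pad_to (by omega)
    rw [totalSum_succ] at hf
    have hlt := vertexSum_lt_succ k y
    rcases lt_or_ge y x with hyx | hxy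
    · have := (show ChoosePeel k y y 0 from PeelSum.nil y).add_digits (t := f - totalSum k y)
        (by omega)
      have hm := digitCount_mono k hyx.le
      refine PeelSum.pad_to (y := y + digitCount k y) ?_ (by omega)
      convert this using 1
      simp
      omega
    · obtain ⟨q, rfl⟩ := Nat.exists_eq_add_of_le hxy
      have h1 := totalSum_add_mul_le k x q
      have h2 := vertexSum_lt_succ k x
      by_cases hq : totalSum k x + (q + 1) * vertexSum k x ≤ f
      · refine of_mem_window hx hq ?_
        rw [← add_assoc, totalSum_succ]
        omega
      · rw [Nat.succ_mul] at hq
        exact (of_mem_window hx (q := q) (by omega) (by omega)).pad_to (by omega)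

theorem digitCount_le_mul (k x : ℕ) : digitCount k x ≤ x * (k + 1) := by
  unfold digitCount
  refine (Finset.sum_le_card_nsmul _ _ (k + 1) fun i _ => ?_).trans (by simp)
  refine Nat.div_le_of_le_mul ?_
  nlinarith

theorem digitCount_le_log (k x : ℕ) : (digitCount k x : ℝ) ≤ x + k * (1 + Real.log x) := by
  have h1 : (digitCount k x : ℝ) ≤ ∑ i ∈ Finset.range x, (1 + k * ((i : ℝ) + 1)⁻¹) := by
    unfold digitCount
    push_cast
    refine Finset.sum_le_sum fun i _ => ?_
    refine Nat.cast_div_le.trans (le_of_eq ?_)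
    push_cast
    field_simp
    ring
  have h2 := harmonic_le_one_add_log x
  simp only [harmonic] at h2
  push_cast at h2
  rw [Finset.sum_add_distrib, ← Finset.mul_sum] at h1
  simp only [Finset.sum_const, Finset.card_range, nsmul_eq_mul, mul_one] at h1
  nlinarith [mul_le_mul_of_nonneg_left h2 (Nat.cast_nonneg (α := ℝ) k)]

theorem vertexSum_add_le_exp {k y : ℕ} (hy : 0 < y) (d : ℕ) :
    (vertexSum k (y + d) : ℝ) ≤ vertexSum k y * Real.exp (d * ((k + 1) / y)) := by
  have hy' : (0 : ℝ) < y := by exact_mod_cast hy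
  induction d with
  | zero => simp
  | succ d ih =>
    have h := vertexSum_succ_mul k (y + d)
    have h' : (vertexSum k (y + d + 1) : ℝ) * (y + d) = vertexSum k (y + d) * (k + 1 + (y + d)) := by
      exact_mod_cast h
    have hpos : (0 : ℝ) < y + d := by positivity
    have h1 : (vertexSum k (y + d + 1) : ℝ) = vertexSum k (y + d) * ((k + 1) / (y + d) + 1) := by
      field_simp
      linarith
    have h2 : ((k : ℝ) + 1) / (y + d) ≤ (k + 1) / y := by
      gcongr
      simp
    have h3 := Real.add_one_le_exp (((k : ℝ) + 1) / y)
    rw [← add_assoc, h1]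
    push_cast
    rw [add_mul, one_mul, Real.exp_add, ← mul_assoc]
    gcongr
    linarith

theorem vertexSum_add_digitCount_le {k y : ℕ} (hk : 2 ≤ k)
    (hy : 3 * (k + 2) ^ 2 ≤ y + 1 + 2 * (k + 2)) :
    vertexSum k (y + 1 + digitCount k (2 * (k + 1))) ≤ totalSum k (y + 1) := by
  set d := digitCount k (2 * (k + 1)) with hd
  have hk' : (2 : ℝ) ≤ k := by exact_mod_cast hk
  have hyR : 3 * ((k : ℝ) + 2) ^ 2 ≤ y + 1 + 2 * (k + 2) := by exact_mod_cast hy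
  have hexp := vertexSum_add_le_exp (k := k) (y := y + 1) (by omega) d
  have hlog := digitCount_le_log k (2 * (k + 1))
  rw [← hd] at hlog
  push_cast at hexp hlog
  have hl0 : 0 ≤ Real.log (2 * ((k : ℝ) + 1)) := Real.log_nonneg (by linarith)
  set l := Real.log (2 * ((k : ℝ) + 1)) with hl
  have hdl : (d : ℝ) ≤ (k + 2) * (3 + l) := by nlinarith
  have hdiv : ((k : ℝ) + 1) / (y + 1) ≤ 1 / (3 * (k + 2)) := by
    rw [div_le_div_iff₀ (by positivity) (by positivity)]
    nlinarith
  have hexpo : (d : ℝ) * ((k + 1) / (y + 1)) ≤ (3 + l) / 3 := by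
    calc (d : ℝ) * ((k + 1) / (y + 1)) ≤ ((k + 2) * (3 + l)) * (1 / (3 * (k + 2))) := by
          gcongr
      _ = (3 + l) / 3 := by field_simp
  have hcube : Real.exp ((3 + l) / 3) ≤ y / (k + 2) := by
    refine le_of_pow_le_pow_left₀ (n := 3) (by norm_num) (by positivity) ?_
    rw [← Real.exp_nat_mul, show ((3 : ℕ) : ℝ) * ((3 + l) / 3) = 1 + 1 + 1 + l by push_cast; ring,
      Real.exp_add, hl, Real.exp_log (by positivity), Real.exp_add, Real.exp_add]
    have he := Real.exp_one_lt_d9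
    have h27 : Real.exp 1 * Real.exp 1 * Real.exp 1 ≤ 27 := by
      calc Real.exp 1 * Real.exp 1 * Real.exp 1 ≤ 3 * 3 * 3 := by gcongr <;> linarith
        _ = 27 := by norm_num
    have hq : 3 * (k : ℝ) + 3 ≤ y / (k + 2) := by
      rw [le_div_iff₀ (by positivity)]
      nlinarith
    calc _ ≤ 27 * (2 * ((k : ℝ) + 1)) := by gcongr
      _ ≤ (3 * (k : ℝ) + 3) ^ 3 := by
          have h0 : (0 : ℝ) ≤ k := by linarith
          nlinarith [mul_nonneg h0 h0, pow_nonneg h0 3]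
      _ ≤ _ := by gcongr
  have htot : (totalSum k (y + 1) : ℝ) * (k + 2) = vertexSum k (y + 1) * y := by
    exact_mod_cast totalSum_mul k y
  have hfin : (vertexSum k (y + 1 + d) : ℝ) ≤ totalSum k (y + 1) := by
    calc (vertexSum k (y + 1 + d) : ℝ)
        ≤ vertexSum k (y + 1) * Real.exp (d * ((k + 1) / (y + 1))) := hexp
      _ ≤ vertexSum k (y + 1) * (y / (k + 2)) := by
          gcongr
          exact (Real.exp_le_exp.2 hexpo).trans hcube
      _ = totalSum k (y + 1) := by
          field_simp
          linarith
  exact_mod_cast hfin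

/-- Left-adding `p` vertices extends the range of representable numbers. -/
theorem ChoosePeel.extend {k z t : ℕ} (hz : k + 1 ≤ z) (htz : vertexSum k z ≤ t)
    (H : ∀ f ≤ t, ChoosePeel k 0 z f) (p : ℕ) {f : ℕ}
    (hf : f + totalSum k z ≤ t + totalSum k (z + p)) : ChoosePeel k 0 (z + p) f := by
  have gap : ∀ p, vertexSum k (z + p) + totalSum k z ≤ t + totalSum k (z + p) := by
    intro p
    induction p with
    | zero => simpa using htz
    | succ p ih =>
      rw [← add_assoc, vertexSum_succ, totalSum_succ]
      have hc := choose_mul_eq_vertexSum_mul k (z + p)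
      have : (k + (z + p)).choose k ≤ vertexSum k (z + p) := by
        refine le_of_mul_le_mul_right ?_ (Nat.succ_pos k)
        rw [Nat.succ_eq_add_one, ← hc]
        exact Nat.mul_le_mul_left _ (by omega)
      have := totalSum_add_mul_le k z p
      have := vertexSum_mono k (Nat.le_add_right z p)
      by_cases hp : p = 0
      · subst hp
        simp only [add_zero] at *
        omega
      · have : 1 * vertexSum k z ≤ p * vertexSum k z := by
          gcongr
          omega
        omega
  induction p generalizing f with
  | zero => exact H f (by simpa using hf)
  | succ p ih =>
    by_cases h : f + totalSum k z ≤ t + totalSum k (z + p)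
    · exact (ih h).leftNon
    · rw [← add_assoc, totalSum_succ] at hf
      have := gap p
      refine (ih (f := f - vertexSum k (z + p)) (by omega)).left_adj ?_
      rw [vertexSum_zero]
      omega

theorem ChoosePeel.of_compl {k n f : ℕ} (hf : f ≤ totalSum k n)
    (h : ChoosePeel k 0 n (totalSum k n - f)) : ChoosePeel k 0 n f := by
  obtain ⟨g, hg, hfg⟩ := h.exists_compl
  rw [totalSum_zero, vertexSum_zero] at hfg
  obtain rfl : g = f := by omega
  exact hg

theorem choosePeel_base {k : ℕ} (hk : 2 ≤ k) {f : ℕ}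
    (hf : f ≤ totalSum k (5 * (k + 2) ^ 2 - k)) :
    ChoosePeel k 0 (5 * (k + 2) ^ 2 - k) f := by
  have hd := digitCount_le_mul k (2 * (k + 1))
  set d := digitCount k (2 * (k + 1)) with hd'
  obtain ⟨y, hy⟩ : ∃ y, 5 * (k + 2) ^ 2 - 6 * (k + 2) + 6 = y + 1 + d := by
    have : 1 + d + 6 * (k + 2) ≤ 5 * (k + 2) ^ 2 + 6 := by nlinarith
    exact ⟨5 * (k + 2) ^ 2 + 6 - (1 + d + 6 * (k + 2)), by lia⟩
  have h6 : 6 * (k + 2) ≤ 5 * (k + 2) ^ 2 := by nlinarith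
  have hn : 5 * (k + 2) ^ 2 - k = y + 1 + d + (5 * k + 6) := by omega
  have hy3 : 3 * (k + 2) ^ 2 ≤ y + 1 + 2 * (k + 2) := by
    zify [h6] at hy hd ⊢
    nlinarith
  have hle := vertexSum_add_digitCount_le hk hy3
  rw [← hd'] at hle
  rw [hn] at hf ⊢
  have hz : k + 1 ≤ y + 1 + d := by nlinarith
  have key := fun f => ChoosePeel.extend hz hle
    (fun f hf => ChoosePeel.of_le_totalSum le_rfl (y + 1) hf) (5 * k + 6) (f := f)
  have hhalf : 2 * totalSum k (y + 1 + d) ≤ totalSum k (y + 1 + d + (5 * k + 6)) := by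
    have h1 := totalSum_add_mul_le k (y + 1 + d) (5 * k + 6)
    have h2 : totalSum k (y + 1 + d) ≤ (5 * k + 6) * vertexSum k (y + 1 + d) := by
      refine le_of_mul_le_mul_right (a := k + 2) ?_ (by omega)
      have h3 := totalSum_mul k (y + d)
      rw [show y + d + 1 = y + 1 + d by ring] at h3
      rw [h3, mul_comm (5 * k + 6), mul_assoc]
      gcongr
      zify [h6] at hy
      zify
      nlinarith
    omega
  by_cases hfs : f + totalSum k (y + 1 + d) ≤
      totalSum k (y + 1) + totalSum k (y + 1 + d + (5 * k + 6))
  · exact key f hfs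
  · exact ChoosePeel.of_compl hf (key _ (by omega))

theorem choosePeel_of_le_totalSum {k n : ℕ} (hk : 2 ≤ k) (hn : 5 * (k + 2) ^ 2 - k ≤ n) {f : ℕ}
    (hf : f ≤ totalSum k n) : ChoosePeel k 0 n f := by
  induction n, hn using Nat.le_induction generalizing f with
  | base => exact choosePeel_base hk hf
  | succ n hn ih =>
    by_cases h : f ≤ totalSum k n
    · exact (ih h).leftNon
    · rw [totalSum_succ] at hf
      have hle : vertexSum k n ≤ totalSum k n := by
        have hn' : 2 * k + 4 ≤ n := by
          refine le_trans ?_ hn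
          have : 2 * k + 4 + k ≤ 5 * (k + 2) ^ 2 := by nlinarith
          omega
        obtain ⟨y, rfl⟩ : ∃ y, n = y + 1 := ⟨n - 1, by omega⟩
        refine le_of_mul_le_mul_right (a := k + 2) ?_ (by omega)
        rw [totalSum_mul]
        gcongr
        omega
      refine (ih (f := f - vertexSum k n) (by omega)).left_adj ?_
      rw [vertexSum_zero]
      omega

end Numbers

theorem stmt6 (r : ℕ) (hr : 4 ≤ r) :
    ∃ c₀ : ℝ, 0 < c₀ ∧
      ∀ m : ℕ, 5 * r ^ 2 ≤ m → ∀ f : ℕ, f ≤ Nat.choose m r → ∀ h : ℕ, 0 < h →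
        ∀ (V : Type) [Fintype V] [LinearOrder V] (G : SimpleGraph V) [DecidableRel G.Adj],
          (h : ℝ) ^ ((m : ℝ) - 5 * (r : ℝ) ^ 2 + 1 / c₀) ≤ (Fintype.card V : ℝ) →
          (∃ S : Finset V, S.card = h ∧
            ((∀ x ∈ S, ∀ y ∈ S, x ≠ y → G.Adj x y) ∨ (∀ x ∈ S, ∀ y ∈ S, ¬ G.Adj x y))) ∨
          (∃ u : Fin (m - r + 2) → V, StrictMono u ∧
            (∑ i : Fin (m - r + 2), ∑ j : Fin (m - r + 2),
              if i < j ∧ G.Adj (u i) (u j) then Nat.choose (m - (j.val + 1)) (r - 2)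
              else 0) = f) := by
  obtain ⟨k, rfl⟩ : ∃ k, r = k + 2 := ⟨r - 2, by omega⟩
  refine ⟨1 / (5 * ((k + 2 : ℕ) : ℝ) ^ 2), by positivity, ?_⟩
  intro m hm f hf h hh V _ _ G _ hV
  refine or_iff_not_imp_left.2 fun hG => ?_
  have hkm : k + 2 ≤ m := by nlinarith
  rw [one_div_one_div, sub_add_cancel, Real.rpow_natCast] at hV
  have hV' : h ^ m ≤ Fintype.card V := by exact_mod_cast hV
  have htot : totalSum k (m - k) = m.choose (k + 2) := by
    rw [totalSum, Nat.add_sub_cancel' (by omega)]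
  obtain ⟨u, -, hmono, hsum⟩ :=
    (choosePeel_of_le_totalSum (n := m - k) (by omega) (by omega)
      (htot ▸ hf)).exists_embedding G hh hG Finset.univ
      (by
        rw [Finset.card_univ]
        exact (Nat.pow_le_pow_right hh (by omega)).trans hV')
  have hn : m - (k + 2) + 2 = m - k := by omega
  rw [hn]
  refine ⟨fun i => u (Fin.rev i), fun i j hij => hmono _ _ (Nat.zero_le _) ?_ (Fin.is_lt _), ?_⟩
  · exact Fin.rev_lt_rev.2 hij
  · rw [← hsum, edgeWeight, ← Finset.range_eq_Ico, Finset.sum_range, Finset.sum_comm]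
    refine Fintype.sum_equiv Fin.revPerm _ _ fun j => ?_
    rw [Finset.sum_range]
    refine Fintype.sum_equiv Fin.revPerm _ _ fun i => ?_
    have hw : m - (j.val + 1) = k + (Fin.rev j).val := by
      rw [Fin.val_rev]
      omega
    simp only [Fin.revPerm_apply, hw, Nat.add_sub_cancel, Fin.val_fin_lt, Fin.rev_lt_rev,
      G.adj_comm]
end
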